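/- Lower semicontinuity and compactness of the restricted energy: Let V ⊂ ℝ^d be the closure of a bounded domain, α,β,δ > 0, and define 𝓕 : 𝒮_V → [0,∞] by 𝓕(ρ) := inf{J_{α,β,δ}(ρ,m,μ) : (m,μ) ∈ M(X_V;ℝ^d)×M(X_V)}. Then the domain of 𝓕 equals H_V, and for ρ_t = h(t)δ_{γ(t)} ∈ H_V one has 𝓕(ρ) = ∫_{{h>0}} ( (β/2)|γ'(t)|²h(t) + (βδ²/2)(h'(t))²/h(t) + αh(t) ) dt. Moreover 𝓕 is lower semicontinuous with respect to the distance D, and its sublevel sets {ρ ∈ 𝒮_V : 𝓕(ρ) ≤ c} are compact in (𝒮_V, D) for every c ≥ 0. -/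

import Mathlib

open MeasureTheory Set Filter Topology
open scoped ENNReal NNReal

noncomputable section

namespace Paper

abbrev Euc (d : ℕ) : Type := EuclideanSpace ℝ (Fin d)

abbrev XX (d : ℕ) : Type := ℝ × Euc d

variable {d : ℕ}

/-- `Ω` is the closure of a bounded domain (a nonempty bounded open connected set). -/
def IsClosureOfBoundedDomain (Ω : Set (Euc d)) : Prop :=
  ∃ U : Set (Euc d), IsOpen U ∧ U.Nonempty ∧ IsConnected U ∧
    Bornology.IsBounded U ∧ Ω = closure U

/-- `Ω` is the closure of a bounded convex domain. -/
def IsClosureOfBoundedConvexDomain (Ω : Set (Euc d)) : Prop :=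
  ∃ U : Set (Euc d), IsOpen U ∧ U.Nonempty ∧ Convex ℝ U ∧
    Bornology.IsBounded U ∧ Ω = closure U

/-- clamping of `ℝ` onto `[0,1]`. -/
def clamp (t : ℝ) : ℝ := max 0 (min 1 t)

/-- `t ↦ ρ t` is a narrowly continuous curve (on `[0,1]`) of finite positive
measures concentrated on `Ω`, i.e. an element of `C_w([0,1]; M⁺(Ω))`. -/
def NarrowCurve (Ω : Set (Euc d)) (ρ : ℝ → Measure (Euc d)) : Prop :=
  (∀ t ∈ Icc (0:ℝ) 1, ρ t Ωᶜ = 0 ∧ ρ t Set.univ ≠ ⊤) ∧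
  (∀ φ : Euc d → ℝ, Continuous φ →
      ContinuousOn (fun t => ∫ x, φ x ∂(ρ t)) (Icc (0:ℝ) 1))

/-- Test functions for the continuity equation on `X_Ω = (0,1) × Ω` (no-flux form:
compact support in time, free at the spatial boundary). -/
def IsTest (φ : XX d → ℝ) : Prop :=
  ContDiff ℝ (⊤ : ℕ∞) φ ∧ HasCompactSupport φ ∧
    tsupport φ ⊆ Ioo (0:ℝ) 1 ×ˢ (Set.univ : Set (Euc d))

/-- Distributional solution of `∂ₜ ρ + div (v ρ) = g ρ`. -/
def SolvesCE (ρ : ℝ → Measure (Euc d)) (v : XX d → Euc d) (g : XX d → ℝ) : Prop :=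
  ∀ φ : XX d → ℝ, IsTest φ →
    (∫ t in Ioo (0:ℝ) 1,
      ∫ x, (fderiv ℝ φ (t, x) (1, v (t, x)) + φ (t, x) * g (t, x)) ∂(ρ t)) = 0

/-- The Hellinger–Kantorovich energy `∫₀¹ ∫ (|v|² + g²) dρ_t dt`. -/
def EnergyVG (ρ : ℝ → Measure (Euc d)) (v : XX d → Euc d) (g : XX d → ℝ) : ℝ≥0∞ :=
  ∫⁻ t in Ioo (0:ℝ) 1, ∫⁻ x, ENNReal.ofReal (‖v (t, x)‖ ^ 2 + g (t, x) ^ 2) ∂(ρ t)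

/-- The class `D_{v,g}` of finite-energy narrowly continuous solutions. -/
def Dvg (Ω : Set (Euc d)) (v : XX d → Euc d) (g : XX d → ℝ)
    (ρ : ℝ → Measure (Euc d)) : Prop :=
  NarrowCurve Ω ρ ∧ SolvesCE ρ v g ∧ EnergyVG ρ v g < ⊤

/-- total variation `‖ρ‖_{M(X_Ω)}` of `ρ = dt ⊗ ρ_t`. -/
def TVcurve (ρ : ℝ → Measure (Euc d)) : ℝ≥0∞ :=
  ∫⁻ t in Ioo (0:ℝ) 1, ρ t Set.univ

/-- The cone `𝒞_V = {h δ_γ : h ≥ 0, γ ∈ V}` of weighted Dirac masses. -/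
def coneSet (V : Set (Euc d)) : Set (Measure (Euc d)) :=
  {μ | ∃ (a : ℝ) (x : Euc d), 0 ≤ a ∧ x ∈ V ∧ μ = ENNReal.ofReal a • Measure.dirac x}

/-- The space `𝒮_V` of narrowly continuous curves `[0,1] → 𝒞_V`
(extended to `ℝ` by clamping). -/
structure SCurve (V : Set (Euc d)) where
  toFun : ℝ → Measure (Euc d)
  clamped : ∀ t, toFun t = toFun (clamp t)
  cone : ∀ t, toFun t ∈ coneSet V
  narrow : ∀ φ : Euc d → ℝ, Continuous φ → Continuous fun t => ∫ x, φ x ∂(toFun t)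

/-- The flat distance `D_F` between measures. -/
def flatDist (μ ν : Measure (Euc d)) : ℝ :=
  sSup {r : ℝ | ∃ φ : Euc d → ℝ, Continuous φ ∧ (∀ x, |φ x| ≤ 1) ∧ LipschitzWith 1 φ ∧
        r = (∫ x, φ x ∂μ) - ∫ x, φ x ∂ν}

/-- The supremum distance `D` on `𝒮_V`. -/
def Ddist {V : Set (Euc d)} (η₁ η₂ : SCurve V) : ℝ :=
  sSup {r : ℝ | ∃ t ∈ Icc (0:ℝ) 1, r = flatDist (η₁.toFun t) (η₂.toFun t)}

/-- The topology of `(𝒮_V, D)`, generated by the open `D`-balls. -/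
def Stop (V : Set (Euc d)) : TopologicalSpace (SCurve V) :=
  TopologicalSpace.generateFrom
    {s | ∃ (η₀ : SCurve V) (ε : ℝ), 0 < ε ∧ s = {η | Ddist η₀ η < ε}}

/-- The Borel σ-algebra of `(𝒮_V, D)`. -/
def Sborel (V : Set (Euc d)) : MeasurableSpace (SCurve V) := @borel _ (Stop V)

instance (V : Set (Euc d)) : MeasurableSpace (SCurve V) := Sborel V

/-- `‖h‖_∞` for a curve `ρ_t = h(t) δ_{γ(t)} ∈ 𝒮_V`. -/
def supMass {V : Set (Euc d)} (η : SCurve V) : ℝ≥0∞ :=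
  ⨆ t ∈ Icc (0:ℝ) 1, η.toFun t Set.univ

/-- `AC²[0,1]`: absolutely continuous on `[0,1]` with a.e. derivative in `L²`. -/
def AC2 {F : Type*} [NormedAddCommGroup F] [NormedSpace ℝ F] (f : ℝ → F) : Prop :=
  ∃ f' : ℝ → F, IntegrableOn f' (Icc (0:ℝ) 1) ∧
    IntegrableOn (fun t => ‖f' t‖ ^ 2) (Icc (0:ℝ) 1) ∧
    ∀ t ∈ Icc (0:ℝ) 1, f t = f 0 + ∫ s in (0:ℝ)..t, f' s

/-- `(γ, h)` represents the curve `η ∈ 𝒮_V`, i.e. `η_t = h(t) δ_{γ(t)}` on `[0,1]`. -/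
def Represents {V : Set (Euc d)} (η : SCurve V) (γ : ℝ → Euc d) (h : ℝ → ℝ) : Prop :=
  ∀ t ∈ Icc (0:ℝ) 1, 0 ≤ h t ∧ γ t ∈ V ∧
    η.toFun t = ENNReal.ofReal (h t) • Measure.dirac (γ t)

/-- The set `H_V ⊆ 𝒮_V` of curves `h(t)δ_{γ(t)}` with `h, √h ∈ AC²[0,1]`,
`√h γ ∈ AC²([0,1];ℝ^d)`. -/
def MemH (V : Set (Euc d)) (η : SCurve V) : Prop :=
  ∃ (γ : ℝ → Euc d) (h : ℝ → ℝ), Represents η γ h ∧ AC2 h ∧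
    AC2 (fun t => Real.sqrt (h t)) ∧ AC2 (fun t => Real.sqrt (h t) • γ t)

/-- The set `H_V^{v,g}`: curves in `H_V` solving the characteristic system
`γ' = v(t,γ)` a.e. on `{h>0}` and `h' = g(t,γ) h` a.e. on `(0,1)`. -/
def MemHvg (V : Set (Euc d)) (v : XX d → Euc d) (g : XX d → ℝ) (η : SCurve V) : Prop :=
  ∃ (γ : ℝ → Euc d) (h : ℝ → ℝ), Represents η γ h ∧ AC2 h ∧
    AC2 (fun t => Real.sqrt (h t)) ∧ AC2 (fun t => Real.sqrt (h t) • γ t) ∧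
    (∀ᵐ t ∂(volume.restrict {t | t ∈ Ioo (0:ℝ) 1 ∧ 0 < h t}),
        HasDerivAt γ (v (t, γ t)) t) ∧
    (∀ᵐ t ∂(volume.restrict (Ioo (0:ℝ) 1)),
        HasDerivAt h (g (t, γ t) * h t) t)

/-- The set `𝒮*_V` of curves whose positivity set `{h > 0}` is `[0,1] ∩ (-∞, τ)`. -/
def MemSstar {V : Set (Euc d)} (η : SCurve V) : Prop :=
  ∃ τ : ℝ, {t | t ∈ Icc (0:ℝ) 1 ∧ η.toFun t Set.univ ≠ 0} = Icc (0:ℝ) 1 ∩ Iio τ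

/-- The vanishing time `τ(γ,h) = min { t ∈ [0,1] : h(t) = 0 }` (`∞` if none). -/
def tauS {V : Set (Euc d)} (η : SCurve V) : ℝ≥0∞ :=
  sInf {c : ℝ≥0∞ | ∃ t ∈ Icc (0:ℝ) 1, η.toFun t Set.univ = 0 ∧ c = ENNReal.ofReal t}


open Classical in
/-- The integrand `Ψ_δ(t,x,y)`. -/
def Psi (δ : ℝ) (t : ℝ) (x : Euc d) (y : ℝ) : ℝ≥0∞ :=
  if 0 < t then ENNReal.ofReal ((‖x‖ ^ 2 + δ ^ 2 * y ^ 2) / (2 * t))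
  else if t = 0 ∧ x = 0 ∧ y = 0 then 0 else ⊤

/-- `u` is a density of the signed measure `σ` with respect to `lam`. -/
def IsDensityS (σ : SignedMeasure (XX d)) (lam : Measure (XX d)) (u : XX d → ℝ) : Prop :=
  ∀ s : Set (XX d), MeasurableSet s → σ s = ∫ x in s, u x ∂lam

/-- `w` is a density of the vector measure `m` with respect to `lam`. -/
def IsDensityV (m : VectorMeasure (XX d) (Euc d)) (lam : Measure (XX d))
    (w : XX d → Euc d) : Prop :=
  ∀ s : Set (XX d), MeasurableSet s → m s = ∫ x in s, w x ∂lam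

/-- `r` is a density of the positive measure `P` with respect to `lam`. -/
def IsDensityP (P : Measure (XX d)) (lam : Measure (XX d)) (r : XX d → ℝ) : Prop :=
  ∀ s : Set (XX d), MeasurableSet s → P s = ∫⁻ x in s, ENNReal.ofReal (r x) ∂lam

/-- `(P, m, μ)` is a measure solution of `∂ₜ ρ + div m = μ` (with `P` positive). -/
def SolvesCEMeas (P : Measure (XX d)) (m : VectorMeasure (XX d) (Euc d))
    (μ : SignedMeasure (XX d)) : Prop :=
  ∀ (lam : Measure (XX d)), IsFiniteMeasure lam →
    ∀ (w : XX d → Euc d) (u : XX d → ℝ), Measurable w → Measurable u →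
      IsDensityV m lam w → IsDensityS μ lam u →
      ∀ φ : XX d → ℝ, IsTest φ →
        ((∫ x, fderiv ℝ φ x ((1:ℝ), (0 : Euc d)) ∂P) +
          (∫ x, fderiv ℝ φ x ((0:ℝ), w x) ∂lam) + ∫ x, φ x * u x ∂lam) = 0

/-- The Wasserstein–Fisher–Rao energy `B_δ(ρ,m,μ)` for a positive `ρ`. -/
def BdeltaMeas (δ : ℝ) (P : Measure (XX d)) (m : VectorMeasure (XX d) (Euc d))
    (μ : SignedMeasure (XX d)) : ℝ≥0∞ :=
  sInf {c : ℝ≥0∞ | ∃ lam : Measure (XX d), IsFiniteMeasure lam ∧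
    ∃ (r : XX d → ℝ) (w : XX d → Euc d) (u : XX d → ℝ),
      Measurable r ∧ Measurable w ∧ Measurable u ∧ (∀ x, 0 ≤ r x) ∧
      IsDensityP P lam r ∧ IsDensityV m lam w ∧ IsDensityS μ lam u ∧
      c = ∫⁻ x, Psi δ (r x) (w x) (u x) ∂lam}

open Classical in
/-- The coercive energy `J_{α,β,δ}(ρ,m,μ)` for a positive `ρ`. -/
def JMeas (α β δ : ℝ) (P : Measure (XX d)) (m : VectorMeasure (XX d) (Euc d))
    (μ : SignedMeasure (XX d)) : ℝ≥0∞ :=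
  if SolvesCEMeas P m μ then
    ENNReal.ofReal β * BdeltaMeas δ P m μ + ENNReal.ofReal α * P Set.univ
  else ⊤

/-- `(ρ, m, μ)` is a measure solution of `∂ₜ ρ + div m = μ` (signed case). -/
def SolvesCESigned (ρ : SignedMeasure (XX d)) (m : VectorMeasure (XX d) (Euc d))
    (μ : SignedMeasure (XX d)) : Prop :=
  ∀ (lam : Measure (XX d)), IsFiniteMeasure lam →
    ∀ (r : XX d → ℝ) (w : XX d → Euc d) (u : XX d → ℝ),
      Measurable r → Measurable w → Measurable u →
      IsDensityS ρ lam r → IsDensityV m lam w → IsDensityS μ lam u →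
      ∀ φ : XX d → ℝ, IsTest φ →
        (∫ x, (fderiv ℝ φ x ((1:ℝ), (0 : Euc d)) * r x
          + fderiv ℝ φ x ((0:ℝ), w x) + φ x * u x) ∂lam) = 0

/-- The Wasserstein–Fisher–Rao energy `B_δ(ρ,m,μ)`, signed case. -/
def BdeltaSigned (δ : ℝ) (ρ : SignedMeasure (XX d)) (m : VectorMeasure (XX d) (Euc d))
    (μ : SignedMeasure (XX d)) : ℝ≥0∞ :=
  sInf {c : ℝ≥0∞ | ∃ lam : Measure (XX d), IsFiniteMeasure lam ∧
    ∃ (r : XX d → ℝ) (w : XX d → Euc d) (u : XX d → ℝ),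
      Measurable r ∧ Measurable w ∧ Measurable u ∧
      IsDensityS ρ lam r ∧ IsDensityV m lam w ∧ IsDensityS μ lam u ∧
      c = ∫⁻ x, Psi δ (r x) (w x) (u x) ∂lam}

open Classical in
/-- The coercive energy `J_{α,β,δ}(ρ,m,μ)`, signed case. -/
def JSigned (α β δ : ℝ) (ρ : SignedMeasure (XX d)) (m : VectorMeasure (XX d) (Euc d))
    (μ : SignedMeasure (XX d)) : ℝ≥0∞ :=
  if SolvesCESigned ρ m μ then
    ENNReal.ofReal β * BdeltaSigned δ ρ m μ
      + ENNReal.ofReal α * ρ.totalVariation Set.univ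
  else ⊤

/-- A signed measure on `X = ℝ × ℝ^d` is concentrated on `X_Ω = (0,1) × Ω`. -/
def ConcS (Ω : Set (Euc d)) (ρ : SignedMeasure (XX d)) : Prop :=
  ∀ s : Set (XX d), MeasurableSet s → s ⊆ (Ioo (0:ℝ) 1 ×ˢ Ω)ᶜ → ρ s = 0

/-- A vector measure on `X = ℝ × ℝ^d` is concentrated on `X_Ω = (0,1) × Ω`. -/
def ConcV (Ω : Set (Euc d)) (m : VectorMeasure (XX d) (Euc d)) : Prop :=
  ∀ s : Set (XX d), MeasurableSet s → s ⊆ (Ioo (0:ℝ) 1 ×ˢ Ω)ᶜ → m s = 0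

/-- Integral of `φ` against a signed measure. -/
def sInt {α : Type*} [MeasurableSpace α] (σ : SignedMeasure α) (φ : α → ℝ) : ℝ :=
  (∫ x, φ x ∂σ.toJordanDecomposition.posPart) -
    ∫ x, φ x ∂σ.toJordanDecomposition.negPart

/-- Triples `(ρ, m, μ) ∈ M(X_Ω) × M(X_Ω; ℝ^d) × M(X_Ω)`. -/
abbrev Mtriple (d : ℕ) : Type :=
  SignedMeasure (XX d) × VectorMeasure (XX d) (Euc d) × SignedMeasure (XX d)

/-- `P` is the measure `dt ⊗ ρ_t` associated with the curve `η ∈ 𝒮_V`. -/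
def CurveMeasure {V : Set (Euc d)} (η : SCurve V) (P : Measure (XX d)) : Prop :=
  ∀ s : Set (XX d), MeasurableSet s →
    P s = ∫⁻ t in Ioo (0:ℝ) 1, η.toFun t {x | (t, x) ∈ s}

/-- `h'` and `γ'` are the a.e. derivatives of `h` on `(0,1)` and of `γ` on `{h>0}`. -/
def HasAEDerivs (γ : ℝ → Euc d) (h : ℝ → ℝ) (γ' : ℝ → Euc d) (h' : ℝ → ℝ) : Prop :=
  (∀ᵐ t ∂(volume.restrict (Ioo (0:ℝ) 1)), HasDerivAt h (h' t) t) ∧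
  (∀ᵐ t ∂(volume.restrict {t | t ∈ Ioo (0:ℝ) 1 ∧ 0 < h t}), HasDerivAt γ (γ' t) t)

/-- The triple `p = (ρ, m, μ)` is of characteristic form
`ρ = h dt ⊗ δ_γ`, `m = γ' ρ`, `μ = h' dt ⊗ δ_γ` with the regularity of `H_Ω`. -/
def CharRepr (Ω : Set (Euc d)) (γ : ℝ → Euc d) (h : ℝ → ℝ) (γ' : ℝ → Euc d)
    (h' : ℝ → ℝ) (p : Mtriple d) : Prop :=
  (∀ t ∈ Icc (0:ℝ) 1, 0 ≤ h t ∧ γ t ∈ Ω) ∧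
  AC2 h ∧ AC2 (fun t => Real.sqrt (h t)) ∧ AC2 (fun t => Real.sqrt (h t) • γ t) ∧
  (∀ φ : Euc d → ℝ, Continuous φ →
      ContinuousOn (fun t => h t * φ (γ t)) (Icc (0:ℝ) 1)) ∧
  HasAEDerivs γ h γ' h' ∧
  (∀ s : Set (XX d), MeasurableSet s →
      p.1 s = ∫ t in Ioo (0:ℝ) 1, Set.indicator {u : ℝ | (u, γ u) ∈ s} h t) ∧
  (∀ s : Set (XX d), MeasurableSet s →
      p.2.1 s = ∫ t in Ioo (0:ℝ) 1,
        Set.indicator {u : ℝ | (u, γ u) ∈ s} (fun u => h u • γ' u) t) ∧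
  (∀ s : Set (XX d), MeasurableSet s →
      p.2.2 s = ∫ t in Ioo (0:ℝ) 1, Set.indicator {u : ℝ | (u, γ u) ∈ s} h' t)

/-- The set `𝒞` of extremal characteristic triples. -/
def MemC (α β δ : ℝ) (Ω : Set (Euc d)) (p : Mtriple d) : Prop :=
  ∃ (γ : ℝ → Euc d) (h : ℝ → ℝ) (γ' : ℝ → Euc d) (h' : ℝ → ℝ),
    CharRepr Ω γ h γ' h' p ∧
    IsPreconnected {t | t ∈ Icc (0:ℝ) 1 ∧ 0 < h t} ∧
    JSigned α β δ p.1 p.2.1 p.2.2 = 1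


/-- Curves in `C_w([0,1]; M(Ω))`: narrowly continuous curves of signed measures
concentrated on `Ω`, extended to `ℝ` by clamping. -/
def IsCwCurve (Ω : Set (Euc d)) (f : ℝ → SignedMeasure (Euc d)) : Prop :=
  (∀ t, f t = f (clamp t)) ∧
  (∀ t, ∀ s : Set (Euc d), MeasurableSet s → s ⊆ Ωᶜ → f t s = 0) ∧
  (∀ φ : Euc d → ℝ, Continuous φ → Continuous fun t => sInt (f t) φ)

/-- `r` is a density with respect to `lam` of the measure `dt ⊗ f_t` on `X`. -/
def CwDensity (f : ℝ → SignedMeasure (Euc d)) (lam : Measure (XX d))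
    (r : XX d → ℝ) : Prop :=
  ∀ s : Set (XX d), MeasurableSet s →
    (∫ t in Ioo (0:ℝ) 1,
        sInt (f t) ({x : Euc d | (t, x) ∈ s}.indicator fun _ => (1:ℝ)))
      = ∫ x in s, r x ∂lam

/-- `(f, m, μ)` is a measure solution of `∂ₜ ρ + div m = μ`, `f` a curve. -/
def SolvesCECw (f : ℝ → SignedMeasure (Euc d)) (m : VectorMeasure (XX d) (Euc d))
    (μ : SignedMeasure (XX d)) : Prop :=
  ∀ (lam : Measure (XX d)), IsFiniteMeasure lam →
    ∀ (w : XX d → Euc d) (u : XX d → ℝ), Measurable w → Measurable u →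
      IsDensityV m lam w → IsDensityS μ lam u →
      ∀ φ : XX d → ℝ, IsTest φ →
        ((∫ t in Ioo (0:ℝ) 1, sInt (f t) fun x => fderiv ℝ φ (t, x) ((1:ℝ), (0 : Euc d)))
          + (∫ x, fderiv ℝ φ x ((0:ℝ), w x) ∂lam) + ∫ x, φ x * u x ∂lam) = 0

/-- `B_δ(dt ⊗ f_t, m, μ)`. -/
def BdeltaCw (δ : ℝ) (f : ℝ → SignedMeasure (Euc d)) (m : VectorMeasure (XX d) (Euc d))
    (μ : SignedMeasure (XX d)) : ℝ≥0∞ :=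
  sInf {c : ℝ≥0∞ | ∃ lam : Measure (XX d), IsFiniteMeasure lam ∧
    ∃ (r : XX d → ℝ) (w : XX d → Euc d) (u : XX d → ℝ),
      Measurable r ∧ Measurable w ∧ Measurable u ∧
      CwDensity f lam r ∧ IsDensityV m lam w ∧ IsDensityS μ lam u ∧
      c = ∫⁻ x, Psi δ (r x) (w x) (u x) ∂lam}

/-- `‖dt ⊗ f_t‖_{M(X_Ω)}`. -/
def TVCw (f : ℝ → SignedMeasure (Euc d)) : ℝ≥0∞ :=
  ∫⁻ t in Ioo (0:ℝ) 1, (f t).totalVariation Set.univ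

open Classical in
/-- `J_{α,β,δ}(dt ⊗ f_t, m, μ)`. -/
def JCw (α β δ : ℝ) (f : ℝ → SignedMeasure (Euc d)) (m : VectorMeasure (XX d) (Euc d))
    (μ : SignedMeasure (XX d)) : ℝ≥0∞ :=
  if SolvesCECw f m μ then
    ENNReal.ofReal β * BdeltaCw δ f m μ + ENNReal.ofReal α * TVCw f
  else ⊤

/-- The set `𝒞` in curve form: `(f, m, μ)` with `f_t = h(t) δ_{γ(t)}`,
`m = h γ' dt ⊗ δ_γ`, `μ = h' dt ⊗ δ_γ`, with `H_Ω`-regularity, connected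
positivity set and unit energy. -/
def MemCCw (α β δ : ℝ) (Ω : Set (Euc d)) (f : ℝ → SignedMeasure (Euc d))
    (m : VectorMeasure (XX d) (Euc d)) (μ : SignedMeasure (XX d)) : Prop :=
  ∃ (γ : ℝ → Euc d) (h : ℝ → ℝ) (γ' : ℝ → Euc d) (h' : ℝ → ℝ),
    (∀ t ∈ Icc (0:ℝ) 1, 0 ≤ h t ∧ γ t ∈ Ω) ∧
    AC2 h ∧ AC2 (fun t => Real.sqrt (h t)) ∧ AC2 (fun t => Real.sqrt (h t) • γ t) ∧
    (∀ φ : Euc d → ℝ, Continuous φ →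
        ContinuousOn (fun t => h t * φ (γ t)) (Icc (0:ℝ) 1)) ∧
    HasAEDerivs γ h γ' h' ∧
    (∀ t, f t = h (clamp t) • (Measure.dirac (γ (clamp t))).toSignedMeasure) ∧
    (∀ s : Set (XX d), MeasurableSet s →
        m s = ∫ t in Ioo (0:ℝ) 1,
          Set.indicator {u : ℝ | (u, γ u) ∈ s} (fun u => h u • γ' u) t) ∧
    (∀ s : Set (XX d), MeasurableSet s →
        μ s = ∫ t in Ioo (0:ℝ) 1, Set.indicator {u : ℝ | (u, γ u) ∈ s} h' t) ∧
    IsPreconnected {t | t ∈ Icc (0:ℝ) 1 ∧ 0 < h t} ∧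
    JCw α β δ f m μ = 1

/-- The mollified density `ρ_t ∗ ξ_ε + ε χ_V`. -/
def mollDens (V : Set (Euc d)) (ρ : ℝ → Measure (Euc d)) (ξ : Euc d → ℝ) (ε : ℝ)
    (t : ℝ) (x : Euc d) : ℝ :=
  (∫ y, (ε ^ d)⁻¹ * ξ (ε⁻¹ • (x - y)) ∂(ρ t)) + ε * V.indicator (fun _ => (1:ℝ)) x

/-- The mollified measure `ρ_t^ε = (ρ_t ∗ ξ_ε + ε χ_V) dx`. -/
def mollRho (V : Set (Euc d)) (ρ : ℝ → Measure (Euc d)) (ξ : Euc d → ℝ) (ε : ℝ) :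
    ℝ → Measure (Euc d) :=
  fun t => volume.withDensity fun x => ENNReal.ofReal (mollDens V ρ ξ ε t x)

open Classical in
/-- The mollified velocity field `v^ε = ((v ρ_t) ∗ ξ_ε) / ρ_t^ε`. -/
def mollV (V : Set (Euc d)) (ρ : ℝ → Measure (Euc d)) (v : XX d → Euc d)
    (ξ : Euc d → ℝ) (ε : ℝ) : XX d → Euc d :=
  fun p => if mollDens V ρ ξ ε p.1 p.2 = 0 then 0 else
    (mollDens V ρ ξ ε p.1 p.2)⁻¹ •
      ∫ y, ((ε ^ d)⁻¹ * ξ (ε⁻¹ • (p.2 - y))) • v (p.1, y) ∂(ρ p.1)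

open Classical in
/-- The mollified growth field `g^ε = ((g ρ_t) ∗ ξ_ε) / ρ_t^ε`. -/
def mollG (V : Set (Euc d)) (ρ : ℝ → Measure (Euc d)) (g : XX d → ℝ)
    (ξ : Euc d → ℝ) (ε : ℝ) : XX d → ℝ :=
  fun p => if mollDens V ρ ξ ε p.1 p.2 = 0 then 0 else
    (mollDens V ρ ξ ε p.1 p.2)⁻¹ *
      ∫ y, ((ε ^ d)⁻¹ * ξ (ε⁻¹ • (p.2 - y))) * g (p.1, y) ∂(ρ p.1)


/-- The restriction `𝓕` of the coercive energy to `𝒮_V`: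
`𝓕(ρ) = inf { J_{α,β,δ}(ρ,m,μ) : (m,μ) }`. -/
def FF (α β δ : ℝ) {V : Set (Euc d)} (η : SCurve V) : ℝ≥0∞ :=
  sInf {c : ℝ≥0∞ | ∃ (P : Measure (XX d)) (m : VectorMeasure (XX d) (Euc d))
    (μ : SignedMeasure (XX d)), CurveMeasure η P ∧ c = JMeas α β δ P m μ}

/-- coordinate projection -/
def cproj (i : Fin d) : Euc d →L[ℝ] ℝ := EuclideanSpace.proj i

@[simp] lemma cproj_apply (i : Fin d) (x : Euc d) : cproj i x = x i := rfl

/-- `z` is the indefinite integral of `z'` on `[0,1]`. -/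
def IsInt {F : Type*} [NormedAddCommGroup F] [NormedSpace ℝ F] (z z' : ℝ → F) : Prop :=
  IntervalIntegrable z' volume 0 1 ∧ ∀ t ∈ Icc (0:ℝ) 1, z t = z 0 + ∫ s in (0:ℝ)..t, z' s

section IsIntSec

set_option linter.unusedSectionVars false

variable {F : Type*} [NormedAddCommGroup F] [NormedSpace ℝ F]

lemma ii_sub {z' : ℝ → F} (h : IntervalIntegrable z' volume 0 1) {s t : ℝ}
    (hs : s ∈ Icc (0:ℝ) 1) (ht : t ∈ Icc (0:ℝ) 1) : IntervalIntegrable z' volume s t := by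
  apply h.mono_set
  rw [uIcc_of_le (zero_le_one' ℝ)]
  exact uIcc_subset_Icc hs ht

lemma IsInt.sub_eq {z z' : ℝ → F} (h : IsInt z z') {s t : ℝ}
    (hs : s ∈ Icc (0:ℝ) 1) (ht : t ∈ Icc (0:ℝ) 1) : z t - z s = ∫ r in s..t, z' r := by
  have h0 : (0:ℝ) ∈ Icc (0:ℝ) 1 := by simp
  rw [h.2 t ht, h.2 s hs, ← intervalIntegral.integral_interval_sub_left
    (ii_sub h.1 h0 ht) (ii_sub h.1 h0 hs)]
  abel

lemma IsInt.ae_hasDerivAt [CompleteSpace F] {z z' : ℝ → F} (h : IsInt z z') :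
    ∀ᵐ t, t ∈ Ioo (0:ℝ) 1 → HasDerivAt z (z' t) t := by
  filter_upwards [h.1.ae_hasDerivAt_integral] with t ht hI
  have h1 := ht (by rw [uIcc_of_le zero_le_one]; exact Ioo_subset_Icc_self hI) 0 (by simp)
  have h2 := h1.const_add (z 0)
  refine h2.congr_of_eventuallyEq ?_
  filter_upwards [Ioo_mem_nhds hI.1 hI.2] with s hs
  exact h.2 s (Ioo_subset_Icc_self hs)

lemma ac_of_dist_le {X : Type*} [PseudoMetricSpace X] {f : ℝ → X} {K : ℝ → ℝ} {a b : ℝ}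
    (hK : AbsolutelyContinuousOnInterval K a b)
    (hle : ∀ s ∈ uIcc a b, ∀ t ∈ uIcc a b, dist (f s) (f t) ≤ dist (K s) (K t)) :
    AbsolutelyContinuousOnInterval f a b := by
  rw [absolutelyContinuousOnInterval_iff] at hK ⊢
  intro ε hε
  obtain ⟨δ, hδ, H⟩ := hK ε hε
  refine ⟨δ, hδ, fun E hE hlt => lt_of_le_of_lt ?_ (H E hE hlt)⟩
  refine Finset.sum_le_sum fun i hi => ?_
  have := hE.1 i hi
  exact hle _ this.1 _ this.2

lemma IsInt.ac_comp {z z' : ℝ → F} (h : IsInt z z') {Φ : F → ℝ} {C : ℝ≥0}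
    (hΦ : LipschitzOnWith C Φ (z '' Icc 0 1)) :
    AbsolutelyContinuousOnInterval (fun t => Φ (z t)) 0 1 := by
  have h0 : (0:ℝ) ∈ Icc (0:ℝ) 1 := by simp
  have hK := (h.1.norm.absolutelyContinuousOnInterval_intervalIntegral (c := 0)
    (by simp)).const_mul (C:ℝ)
  refine ac_of_dist_le hK ?_
  have key : ∀ s ∈ Icc (0:ℝ) 1, ∀ t ∈ Icc (0:ℝ) 1, s ≤ t → dist (Φ (z s)) (Φ (z t)) ≤
      dist ((C:ℝ) * ∫ v in (0:ℝ)..s, ‖z' v‖) ((C:ℝ) * ∫ v in (0:ℝ)..t, ‖z' v‖) := by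
    intro s hs t ht hst
    refine (hΦ.dist_le_mul _ (mem_image_of_mem z hs) _ (mem_image_of_mem z ht)).trans ?_
    rw [dist_comm (_ * _), Real.dist_eq, ← mul_sub, intervalIntegral.integral_interval_sub_left
      (ii_sub h.1.norm h0 ht) (ii_sub h.1.norm h0 hs), abs_mul, NNReal.abs_eq]
    refine mul_le_mul_of_nonneg_left ?_ C.2
    rw [dist_comm, dist_eq_norm, h.sub_eq hs ht]
    exact (intervalIntegral.norm_integral_le_integral_norm hst).trans (le_abs_self _)
  intro s hs t ht
  rw [uIcc_of_le zero_le_one] at hs ht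
  rcases le_total s t with hst | hst
  · exact key s hs t ht hst
  · rw [dist_comm (Φ _), dist_comm (_ * _)]; exact key t ht s hs hst

lemma isInt_of_ac {f k : ℝ → ℝ} (hf : AbsolutelyContinuousOnInterval f 0 1)
    (hk : ∀ᵐ t, t ∈ Ioo (0:ℝ) 1 → HasDerivAt f (k t) t) : IsInt f k := by
  have hdk : ∀ᵐ t, t ∈ Ioo (0:ℝ) 1 → deriv f t = k t := by
    filter_upwards [hk] with t ht hI using (ht hI).deriv
  have hdk' : ∀ᵐ t, t ∈ uIoc (0:ℝ) 1 → deriv f t = k t := by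
    have h1 : ∀ᵐ t : ℝ, t ≠ 1 := by simp [ae_iff]
    filter_upwards [hdk, h1] with t ht h1 hI
    rw [uIoc_of_le zero_le_one] at hI
    exact ht ⟨hI.1, lt_of_le_of_ne hI.2 h1⟩
  refine ⟨hf.intervalIntegrable_deriv.congr_ae ((ae_restrict_iff' measurableSet_uIoc).2 hdk'), ?_⟩
  intro t ht
  have hs : uIcc 0 t ⊆ uIcc (0:ℝ) 1 := by
    rw [uIcc_of_le ht.1, uIcc_of_le zero_le_one]; exact Icc_subset_Icc_right ht.2
  have := (hf.mono hs).integral_deriv_eq_sub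
  rw [← intervalIntegral.integral_congr_ae (f := deriv f)]
  · rw [this]; ring
  · filter_upwards [hdk'] with r hr hI
    apply hr
    rw [uIoc_of_le ht.1] at hI
    rw [uIoc_of_le zero_le_one]
    exact ⟨hI.1, hI.2.trans ht.2⟩

lemma IsInt.continuousOn {z z' : ℝ → F} (h : IsInt z z') : ContinuousOn z (Icc 0 1) := by
  have : ContinuousOn (fun t => z 0 + ∫ s in (0:ℝ)..t, z' s) (Icc 0 1) := by
    apply continuousOn_const.add
    have := intervalIntegral.continuousOn_primitive_interval' h.1 (a := 0) (by simp)
    rwa [uIcc_of_le zero_le_one] at this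
  exact this.congr h.2

/-- chain rule for absolutely continuous curves -/
lemma IsInt.chain {z z' : ℝ → F} (h : IsInt z z') {Φ : F → ℝ}
    (hΦ : ∀ t ∈ Icc (0:ℝ) 1, ContDiffAt ℝ 1 Φ (z t)) {k : ℝ → ℝ}
    (hk : ∀ᵐ t, t ∈ Ioo (0:ℝ) 1 → HasDerivAt (fun t => Φ (z t)) (k t) t) :
    IsInt (fun t => Φ (z t)) k := by
  have hc : IsCompact (z '' Icc 0 1) := isCompact_Icc.image_of_continuousOn h.continuousOn
  have hl : LocallyLipschitzOn (z '' Icc 0 1) Φ := by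
    rintro _ ⟨t, ht, rfl⟩
    obtain ⟨K, s, hs, hL⟩ := (hΦ t ht).exists_lipschitzOnWith
    exact ⟨K, s, mem_nhdsWithin_of_mem_nhds hs, hL⟩
  obtain ⟨C, hC⟩ := hl.exists_lipschitzOnWith_of_compact hc
  exact isInt_of_ac (h.ac_comp hC) hk

lemma IsInt.clm {G : Type*} [NormedAddCommGroup G] [NormedSpace ℝ G]
    [CompleteSpace F] [CompleteSpace G] {z z' : ℝ → F} (h : IsInt z z')
    (L : F →L[ℝ] G) : IsInt (fun t => L (z t)) (fun t => L (z' t)) := by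
  refine ⟨⟨L.integrable_comp h.1.1, L.integrable_comp h.1.2⟩, fun t ht => ?_⟩
  beta_reduce
  rw [h.2 t ht, map_add, L.intervalIntegral_comp_comm (ii_sub h.1 (by simp) ht)]

lemma IsInt.prodMk {G : Type*} [NormedAddCommGroup G] [NormedSpace ℝ G]
    [CompleteSpace F] [CompleteSpace G] {z z' : ℝ → F} {w w' : ℝ → G}
    (h : IsInt z z') (hw : IsInt w w') :
    IsInt (fun t => (z t, w t)) (fun t => (z' t, w' t)) := by
  have hi : IntervalIntegrable (fun t => (z' t, w' t)) volume 0 1 :=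
    ⟨h.1.1.prodMk hw.1.1, h.1.2.prodMk hw.1.2⟩
  refine ⟨hi, fun t ht => ?_⟩
  have hi' := ii_sub hi (s := 0) (by simp) ht
  have e1 := (ContinuousLinearMap.fst ℝ F G).intervalIntegral_comp_comm hi'
  have e2 := (ContinuousLinearMap.snd ℝ F G).intervalIntegral_comp_comm hi'
  ext1
  · simp only [Prod.fst_add]; rw [h.2 t ht]; congr 1
  · simp only [Prod.snd_add]; rw [hw.2 t ht]; congr 1

lemma isInt_id : IsInt (fun t : ℝ => t) (fun _ => (1:ℝ)) :=
  ⟨by simp, fun t _ => by simp⟩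

lemma isInt_euc {z z' : ℝ → Euc d} (h : ∀ i, IsInt (fun t => z t i) (fun t => z' t i)) :
    IsInt z z' := by
  have hi : IntervalIntegrable z' volume 0 1 := by
    rw [intervalIntegrable_iff]
    have : IntegrableOn (fun t => fun i => z' t i) (uIoc 0 1) volume :=
      Integrable.of_eval (fun i => intervalIntegrable_iff.1 (h i).1)
    exact ((EuclideanSpace.equiv (Fin d) ℝ).symm.toContinuousLinearMap).integrable_comp this
  refine ⟨hi, fun t ht => ?_⟩
  ext i
  have := (cproj i).intervalIntegral_comp_comm (ii_sub hi (s := 0) (by simp) ht)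
  simp only [cproj_apply] at this
  simp only [PiLp.add_apply]
  rw [← this]
  exact (h i).2 t ht

/-- chain rule for absolutely continuous curves, vector valued -/
lemma IsInt.chainE {z z' : ℝ → F} (h : IsInt z z') {Φ : F → Euc d}
    (hΦ : ∀ t ∈ Icc (0:ℝ) 1, ContDiffAt ℝ 1 Φ (z t)) {k : ℝ → Euc d}
    (hk : ∀ᵐ t, t ∈ Ioo (0:ℝ) 1 → HasDerivAt (fun t => Φ (z t)) (k t) t) :
    IsInt (fun t => Φ (z t)) k := by
  refine isInt_euc fun i => ?_
  refine h.chain (Φ := fun x => Φ x i) (fun t ht => ?_) ?_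
  · exact (cproj i).contDiff.contDiffAt.comp _ (hΦ t ht)
  · filter_upwards [hk] with t ht hI
    exact (cproj i).hasFDerivAt.comp_hasDerivAt t (ht hI)

/-- passing to the limit in integral representations -/
lemma isInt_of_tendsto {z : ℝ → F} {k : ℝ → F} {zn kn : ℕ → ℝ → F} {bound : ℝ → ℝ}
    (hn : ∀ n, IsInt (zn n) (kn n)) (hb : IntervalIntegrable bound volume 0 1)
    (hle : ∀ n, ∀ᵐ t, t ∈ Ioo (0:ℝ) 1 → ‖kn n t‖ ≤ bound t)
    (hk : ∀ᵐ t, t ∈ Ioo (0:ℝ) 1 → Tendsto (fun n => kn n t) atTop (𝓝 (k t)))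
    (hz : ∀ t ∈ Icc (0:ℝ) 1, Tendsto (fun n => zn n t) atTop (𝓝 (z t))) : IsInt z k := by
  have h1 : ∀ᵐ t : ℝ, t ≠ 1 := by simp [ae_iff]
  have up : ∀ p : ℝ → Prop, (∀ᵐ t, t ∈ Ioo (0:ℝ) 1 → p t) → ∀ᵐ t, t ∈ uIoc (0:ℝ) 1 → p t := by
    intro p hp
    filter_upwards [hp, h1] with t ht h1 hI
    rw [uIoc_of_le zero_le_one] at hI
    exact ht ⟨hI.1, lt_of_le_of_ne hI.2 h1⟩
  have hle' := fun n => up _ (hle n)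
  have hk' := up _ hk
  have hms : ∀ n, AEStronglyMeasurable (kn n) (volume.restrict (uIoc 0 1)) :=
    fun n => (intervalIntegrable_iff.1 (hn n).1).1
  have hkm : AEStronglyMeasurable k (volume.restrict (uIoc 0 1)) :=
    aestronglyMeasurable_of_tendsto_ae atTop hms ((ae_restrict_iff' measurableSet_uIoc).2 hk')
  have hkint : IntervalIntegrable k volume 0 1 := by
    rw [intervalIntegrable_iff] at hb ⊢
    refine Integrable.mono' hb hkm ?_
    rw [ae_restrict_iff' measurableSet_uIoc]
    filter_upwards [ae_all_iff.2 hle', hk'] with t h1 h2 hI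
    exact le_of_tendsto (h2 hI).norm (Eventually.of_forall fun n => h1 n hI)
  refine ⟨hkint, fun t ht => ?_⟩
  have hsub : uIoc 0 t ⊆ uIoc (0:ℝ) 1 := by
    rw [uIoc_of_le ht.1, uIoc_of_le zero_le_one]; exact Ioc_subset_Ioc_right ht.2
  have hlim : Tendsto (fun n => zn n 0 + ∫ s in (0:ℝ)..t, kn n s) atTop
      (𝓝 (z 0 + ∫ s in (0:ℝ)..t, k s)) := by
    refine (hz 0 (by simp)).add ?_
    refine intervalIntegral.tendsto_integral_filter_of_dominated_convergence bound
      (Eventually.of_forall fun n => (hms n).mono_measure (Measure.restrict_mono hsub le_rfl))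
      (Eventually.of_forall fun n => ?_) (ii_sub hb (by simp) ht) ?_
    · filter_upwards [hle' n] with s hs hI using hs (hsub hI)
    · filter_upwards [hk'] with s hs hI using hs (hsub hI)
  refine tendsto_nhds_unique (hz t ht) (hlim.congr fun n => ((hn n).2 t ht).symm)

end IsIntSec

lemma ii_of_Ioo {F : Type*} [NormedAddCommGroup F] {k : ℝ → F} (hk : IntegrableOn k (Ioo 0 1)) :
    IntervalIntegrable k volume 0 1 := by
  rw [intervalIntegrable_iff_integrableOn_Ioo_of_le zero_le_one]; exact hk

lemma int_Ioo {F : Type*} [NormedAddCommGroup F] [NormedSpace ℝ F] (k : ℝ → F) :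
    ∫ t in Ioo (0:ℝ) 1, k t = ∫ t in (0:ℝ)..1, k t := by
  rw [intervalIntegral.integral_of_le zero_le_one, integral_Ioc_eq_integral_Ioo]

lemma compact_sub_Ioo {K : Set ℝ} (hK : IsCompact K) (hs : K ⊆ Ioo 0 1) :
    ∃ a b : ℝ, 0 < a ∧ a ≤ b ∧ b < 1 ∧ K ⊆ Icc a b := by
  rcases K.eq_empty_or_nonempty with rfl | hne
  · exact ⟨1/2, 1/2, by norm_num, le_rfl, by norm_num, by simp⟩
  · have h1 := hs (hK.sInf_mem hne)
    have h2 := hs (hK.sSup_mem hne)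
    refine ⟨sInf K, sSup K, h1.1, ?_, h2.2, fun x hx =>
      ⟨csInf_le hK.bddBelow hx, le_csSup hK.bddAbove hx⟩⟩
    exact (csInf_le hK.bddBelow hne.some_mem).trans (le_csSup hK.bddAbove hne.some_mem)

lemma exists_primitive_test {r : ℝ → ℝ} (hr : ContDiff ℝ (⊤ : ℕ∞) r) (hc : HasCompactSupport r)
    (hs : tsupport r ⊆ Ioo 0 1) (h0 : ∫ t in (0:ℝ)..1, r t = 0) :
    ∃ p : ℝ → ℝ, ContDiff ℝ (⊤ : ℕ∞) p ∧ HasCompactSupport p ∧ tsupport p ⊆ Ioo 0 1 ∧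
      deriv p = r := by
  obtain ⟨a, b, ha, hab, hb, hK⟩ := compact_sub_Ioo hc hs
  have hrz : ∀ t, t ∉ Icc a b → r t = 0 := fun t ht =>
    image_eq_zero_of_notMem_tsupport fun h => ht (hK h)
  let p : ℝ → ℝ := fun t => ∫ s in (0:ℝ)..t, r s
  have hd : ∀ t, HasDerivAt p (r t) t := fun t =>
    intervalIntegral.integral_hasDerivAt_right (hr.continuous.intervalIntegrable _ _)
      (hr.continuous.stronglyMeasurableAtFilter _ _) hr.continuous.continuousAt
  have hderiv : deriv p = r := funext fun t => (hd t).deriv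
  have hsupp : Function.support p ⊆ Icc a b := by
    intro t ht
    by_contra hn
    apply ht
    rcases lt_or_ge t a with h | h
    · have : EqOn r (fun _ => 0) (uIcc 0 t) := by
        intro s hs
        apply hrz
        intro h'
        have := hs.2
        have : s ≤ max 0 t := this
        have : max 0 t < a := max_lt ha h
        linarith [h'.1]
      simp only [p]
      rw [intervalIntegral.integral_congr this]; simp
    · have h : b < t := by
        by_contra h'; exact hn ⟨h, not_lt.1 h'⟩
      have : EqOn r (fun _ => 0) (uIcc 1 t) := by
        intro s hs
        apply hrz
        intro h'
        have := hs.1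
        have : min 1 t ≤ s := this
        have : b < min 1 t := lt_min hb h
        linarith [h'.2]
      simp only [p]
      rw [← intervalIntegral.integral_add_adjacent_intervals
        (hr.continuous.intervalIntegrable 0 1) (hr.continuous.intervalIntegrable 1 t), h0,
        intervalIntegral.integral_congr this]; simp
  have hts : tsupport p ⊆ Icc a b := closure_minimal hsupp isClosed_Icc
  refine ⟨p, ?_, isCompact_Icc.of_isClosed_subset (isClosed_tsupport p) hts,
    hts.trans fun x hx => ⟨ha.trans_le hx.1, hx.2.trans_lt hb⟩, hderiv⟩
  rw [contDiff_infty_iff_deriv, hderiv]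
  exact ⟨fun t => (hd t).differentiableAt, hr⟩

/-- du Bois-Reymond lemma -/
lemma dbr {f k : ℝ → ℝ} (hf : ContinuousOn f (Icc 0 1)) (hk : IntegrableOn k (Ioo 0 1))
    (H : ∀ p : ℝ → ℝ, ContDiff ℝ (⊤ : ℕ∞) p → HasCompactSupport p → tsupport p ⊆ Ioo 0 1 →
      ∫ t in Ioo (0:ℝ) 1, (deriv p t * f t + p t * k t) = 0) : IsInt f k := by
  have hki := ii_of_Ioo hk
  let K : ℝ → ℝ := fun t => ∫ s in (0:ℝ)..t, k s
  have hK : IsInt K k := ⟨hki, fun t _ => by simp [K]⟩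
  let w : ℝ → ℝ := fun t => f t - K t
  have hw : ContinuousOn w (Icc 0 1) := hf.sub hK.continuousOn
  have hcI : ∀ g : ℝ → ℝ, ContinuousOn g (Icc 0 1) → IntervalIntegrable g volume 0 1 := by
    intro g hg; apply ContinuousOn.intervalIntegrable; rwa [uIcc_of_le zero_le_one]
  have H1 : ∀ p : ℝ → ℝ, ContDiff ℝ (⊤ : ℕ∞) p → HasCompactSupport p → tsupport p ⊆ Ioo 0 1 →
      ∫ t in (0:ℝ)..1, deriv p t * w t = 0 := by
    intro p hp hpc hps
    have h1 := H p hp hpc hps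
    rw [int_Ioo] at h1
    have hpd : Continuous (deriv p) := hp.continuous_deriv (by simp)
    have h2 : IsInt (fun t => p t * K t) (fun t => deriv p t * K t + p t * k t) := by
      refine (isInt_id.prodMk hK).chain (Φ := fun x => p x.1 * x.2) (fun t _ => ?_) ?_
      · apply ContDiff.contDiffAt
        have : ContDiff ℝ 1 p := hp.of_le (by simp)
        fun_prop
      · filter_upwards [hK.ae_hasDerivAt] with t ht hI
        exact ((hp.differentiable (by simp)) t).hasDerivAt.mul (ht hI)
    have h3 := h2.2 1 (by simp)
    have hz : ∀ t, t ∉ Ioo (0:ℝ) 1 → p t = 0 := fun t ht =>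
      image_eq_zero_of_notMem_tsupport fun h => ht (hps h)
    simp only [hz 1 (by simp), hz 0 (by simp), zero_mul, zero_add] at h3
    have e : (fun t => deriv p t * w t) = fun t => (deriv p t * f t + p t * k t) -
        (deriv p t * K t + p t * k t) := by
      funext t; simp only [w]; ring
    rw [e, intervalIntegral.integral_sub, h1, ← h3, sub_zero]
    · exact (hcI _ (hpd.continuousOn.mul hf)).add (hki.continuousOn_mul hp.continuous.continuousOn)
    · exact h2.1
  let bmp : ContDiffBump (1/2 : ℝ) := ⟨1/8, 1/4, by norm_num, by norm_num⟩
  let ψ : ℝ → ℝ := bmp.normed volume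
  have hψ : ContDiff ℝ (⊤ : ℕ∞) ψ := bmp.contDiff_normed
  have hψc : HasCompactSupport ψ := bmp.hasCompactSupport_normed
  have hψs : tsupport ψ ⊆ Ioo 0 1 := by
    simp only [ψ]
    rw [bmp.tsupport_normed_eq]
    intro x hx
    rw [Metric.mem_closedBall, Real.dist_eq] at hx
    have := abs_le.1 hx
    simp only [bmp] at this
    constructor <;> linarith [this.1, this.2]
  have int_eq : ∀ q : ℝ → ℝ, tsupport q ⊆ Ioo 0 1 → ∫ t, q t = ∫ t in (0:ℝ)..1, q t := by
    intro q hq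
    rw [← int_Ioo, setIntegral_eq_integral_of_forall_compl_eq_zero]
    exact fun t ht => image_eq_zero_of_notMem_tsupport fun h => ht (hq h)
  have hψ1 : ∫ t in (0:ℝ)..1, ψ t = 1 := by
    rw [← int_eq ψ hψs]; exact bmp.integral_normed
  set c : ℝ := ∫ t in (0:ℝ)..1, ψ t * w t with hc
  have H2 : ∀ᵐ t, t ∈ Ioo (0:ℝ) 1 → w t - c = 0 := by
    refine isOpen_Ioo.ae_eq_zero_of_integral_contDiff_smul_eq_zero ?_ ?_
    · exact ((hw.sub continuousOn_const).mono Ioo_subset_Icc_self).locallyIntegrableOn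
        measurableSet_Ioo
    · intro q hq hqc hqs
      set I : ℝ := ∫ t in (0:ℝ)..1, q t with hI
      let r : ℝ → ℝ := fun t => q t - I * ψ t
      have hr : ContDiff ℝ (⊤ : ℕ∞) r := hq.sub (contDiff_const.mul hψ)
      have hrc : HasCompactSupport r := hqc.sub hψc.mul_left
      have hrs : tsupport r ⊆ Ioo 0 1 := by
        refine (tsupport_sub q (fun t => I * ψ t)).trans (union_subset hqs ?_)
        exact (tsupport_mul_subset_right (f := fun _ => I) (g := ψ)).trans hψs
      have hqi := hq.continuous.intervalIntegrable (μ := volume) 0 1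
      have hψi := hψ.continuous.intervalIntegrable (μ := volume) 0 1
      have hr0 : ∫ t in (0:ℝ)..1, r t = 0 := by
        simp only [r]
        rw [intervalIntegral.integral_sub hqi (hψi.const_mul I),
          intervalIntegral.integral_const_mul, hψ1]; simp [hI]
      obtain ⟨p, hp, hpc, hps, hpd⟩ := exists_primitive_test hr hrc hrs hr0
      have h1 := H1 p hp hpc hps
      rw [hpd] at h1
      have hqw : IntervalIntegrable (fun t => q t * w t) volume 0 1 := hcI _ (hq.continuous.continuousOn.mul hw)
      have hψw : IntervalIntegrable (fun t => ψ t * w t) volume 0 1 := hcI _ (hψ.continuous.continuousOn.mul hw)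
      have e1 : (fun t => r t * w t) = fun t => q t * w t - I * (ψ t * w t) := by
        funext t; simp only [r]; ring
      rw [e1, intervalIntegral.integral_sub hqw (hψw.const_mul I),
          intervalIntegral.integral_const_mul, ← hc] at h1
      rw [int_eq]
      · have e2 : (fun t => q t • (w t - c)) = fun t => q t * w t - q t * c := by
          funext t; simp only [smul_eq_mul]; ring
        rw [e2, intervalIntegral.integral_sub hqw (hqi.mul_const c),
          intervalIntegral.integral_mul_const]
        linarith
      · exact (tsupport_smul_subset_left q _).trans hqs
  have H3 : EqOn w (fun _ => c) (Icc 0 1) := by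
    refine Measure.eqOn_Icc_of_ae_eq volume zero_ne_one ?_ hw continuousOn_const
    rw [← restrict_Ioo_eq_restrict_Icc, EventuallyEq, ae_restrict_iff' measurableSet_Ioo]
    filter_upwards [H2] with t ht hI
    linarith [ht hI]
  refine ⟨hki, fun t ht => ?_⟩
  have a1 := H3 ht
  have a2 := H3 (show (0:ℝ) ∈ Icc 0 1 by simp)
  simp only [w, K, intervalIntegral.integral_same] at a1 a2
  linarith

/-- admissible mass/momentum pairs -/
structure Good (R : ℝ) (h : ℝ → ℝ) (b : ℝ → Euc d) : Prop where
  R0 : 0 ≤ R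
  hc : Continuous h
  bc : Continuous b
  h0 : ∀ t, 0 ≤ h t
  bR : ∀ t, ‖b t‖ ≤ R * h t

/-- position of the Dirac mass -/
def gam (h : ℝ → ℝ) (b : ℝ → Euc d) (t : ℝ) : Euc d := (h t)⁻¹ • b t

/-- velocity/growth fields in time for a pair `(h, b)` -/
structure Adm (h : ℝ → ℝ) (b : ℝ → Euc d) (V : ℝ → Euc d) (G : ℝ → ℝ) : Prop where
  mV : Measurable V
  mG : Measurable G
  iV : IntegrableOn (fun t => h t * ‖V t‖ ^ 2) (Ioo 0 1)
  iG : IntegrableOn (fun t => h t * G t ^ 2) (Ioo 0 1)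
  eh : IsInt h (fun t => h t * G t)
  eb : IsInt b (fun t => h t • (V t + G t • gam h b t))

lemma Good.b_eq {R : ℝ} {h : ℝ → ℝ} {b : ℝ → Euc d} (g : Good R h b) (t : ℝ) :
    b t = h t • gam h b t := by
  unfold gam
  by_cases h0 : h t = 0
  · have := g.bR t
    rw [h0, mul_zero] at this
    simp [norm_le_zero_iff.1 this]
  · rw [smul_smul, mul_inv_cancel₀ h0, one_smul]

lemma Good.gam_le {R : ℝ} {h : ℝ → ℝ} {b : ℝ → Euc d} (g : Good R h b) (t : ℝ) :
    ‖gam h b t‖ ≤ R := by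
  unfold gam
  by_cases h0 : h t = 0
  · simp [h0, g.R0]
  · have : 0 < h t := lt_of_le_of_ne (g.h0 t) (Ne.symm h0)
    rw [norm_smul, norm_inv, Real.norm_of_nonneg (g.h0 t), inv_mul_le_iff₀ this, mul_comm]
    exact g.bR t

lemma Good.gam_meas {R : ℝ} {h : ℝ → ℝ} {b : ℝ → Euc d} (g : Good R h b) :
    Measurable (gam h b) := g.hc.measurable.inv.smul g.bc.measurable

lemma Good.bdd {R : ℝ} {h : ℝ → ℝ} {b : ℝ → Euc d} (g : Good R h b) :
    ∃ M, 0 ≤ M ∧ ∀ t ∈ Icc (0:ℝ) 1, h t ≤ M := by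
  obtain ⟨M, hM⟩ := (isCompact_Icc (a := (0:ℝ)) (b := 1)).bddAbove_image g.hc.continuousOn
  exact ⟨M, (g.h0 0).trans (hM ⟨0, by simp, rfl⟩), fun t ht => hM ⟨t, ht, rfl⟩⟩

lemma Good.h_int {R : ℝ} {h : ℝ → ℝ} {b : ℝ → Euc d} (g : Good R h b) :
    IntegrableOn h (Ioo 0 1) :=
  (g.hc.continuousOn.integrableOn_compact isCompact_Icc).mono_set Ioo_subset_Icc_self

lemma ac2_of_isInt {F : Type*} [NormedAddCommGroup F] [NormedSpace ℝ F] {z z' : ℝ → F}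
    (h : IsInt z z') {bd : ℝ → ℝ} (hb : IntegrableOn bd (Ioo 0 1))
    (hle : ∀ t ∈ Ioo (0:ℝ) 1, ‖z' t‖ ^ 2 ≤ bd t) : AC2 z := by
  have hi : IntegrableOn z' (Ioo 0 1) :=
    (intervalIntegrable_iff_integrableOn_Ioo_of_le zero_le_one).1 h.1
  refine ⟨z', by rw [integrableOn_Icc_iff_integrableOn_Ioo]; exact hi, ?_, h.2⟩
  rw [integrableOn_Icc_iff_integrableOn_Ioo]
  refine Integrable.mono' hb (hi.1.norm.pow 2) ?_
  rw [ae_restrict_iff' measurableSet_Ioo]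
  refine Eventually.of_forall fun t ht => ?_
  rw [Real.norm_of_nonneg (by positivity)]
  exact hle t ht

lemma eps_tendsto : Tendsto (fun n : ℕ => (1:ℝ) / ((n:ℝ) + 1)) atTop (𝓝 0) :=
  tendsto_one_div_add_atTop_nhds_zero_nat

lemma Adm.sqrt_isInt {R : ℝ} {h : ℝ → ℝ} {b : ℝ → Euc d} (g : Good R h b)
    {V : ℝ → Euc d} {G : ℝ → ℝ} (A : Adm h b V G) :
    IsInt (fun t => √(h t)) (fun t => √(h t) * G t / 2) := by
  have hbd : IntegrableOn (fun t => 1 + h t * G t ^ 2) (Ioo 0 1) := by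
    refine Integrable.add ?_ A.iG
    exact integrable_const _
  refine isInt_of_tendsto (zn := fun n t => √(h t + 1 / ((n:ℝ) + 1)))
    (kn := fun n t => h t * G t / (2 * √(h t + 1 / ((n:ℝ) + 1)))) (bound := fun t => 1 + h t * G t ^ 2)
    (fun n => ?_) (ii_of_Ioo hbd) (fun n => ?_) ?_ ?_
  · have hε : (0:ℝ) < 1 / ((n:ℝ) + 1) := by positivity
    refine A.eh.chain (Φ := fun x => √(x + 1 / ((n:ℝ) + 1))) (fun t _ => ?_) ?_
    · have : h t + 1 / ((n:ℝ) + 1) ≠ 0 := by linarith [g.h0 t] |> ne_of_gt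
      exact (contDiffAt_id.add contDiffAt_const).sqrt this
    · filter_upwards [A.eh.ae_hasDerivAt] with t ht hI
      have : h t + 1 / ((n:ℝ) + 1) ≠ 0 := by linarith [g.h0 t] |> ne_of_gt
      exact ((ht hI).add_const _).sqrt this
  · refine Eventually.of_forall fun t _ => ?_
    have hε : (0:ℝ) < 1 / ((n:ℝ) + 1) := by positivity
    have hh := g.h0 t
    set s := √(h t + 1 / ((n:ℝ) + 1)) with hs
    have hs0 : 0 < s := Real.sqrt_pos.2 (by linarith)
    have hs2 : s ^ 2 = h t + 1 / ((n:ℝ) + 1) := Real.sq_sqrt (by linarith)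
    rw [Real.norm_eq_abs, abs_div, abs_mul, abs_of_nonneg hh, abs_of_pos (by positivity : 0 < 2 * s),
      div_le_iff₀ (by positivity)]
    have h1 : (s * |G t|) ^ 2 = s ^ 2 * G t ^ 2 := by rw [mul_pow, sq_abs]
    have h2 : h t ≤ s ^ 2 := by linarith
    have hG := abs_nonneg (G t)
    have h3 : h t * |G t| * s ≤ s * s * (1 + h t * G t ^ 2) := by
      have : h t * |G t| ≤ s * (1 + h t * G t ^ 2) := by
        set r := √(h t) with hr
        have hr2 : r ^ 2 = h t := Real.sq_sqrt hh
        have hr0 : 0 ≤ r := Real.sqrt_nonneg _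
        have hrs : r ≤ s := Real.sqrt_le_sqrt (by linarith)
        have e : h t * G t ^ 2 = (r * |G t|) ^ 2 := by rw [mul_pow, sq_abs, hr2]
        rw [e, ← hr2]
        have hx : 0 ≤ r * |G t| := by positivity
        have : r * |G t| ≤ 1 + (r * |G t|) ^ 2 := by nlinarith [sq_nonneg (r * |G t| - 1)]
        calc r ^ 2 * |G t| = r * (r * |G t|) := by ring
          _ ≤ s * (1 + (r * |G t|) ^ 2) := mul_le_mul hrs this hx hs0.le
      nlinarith
    have h4 : h t * |G t| ≤ s * (1 + h t * G t ^ 2) := by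
      have : (h t * |G t|) * s ≤ (s * (1 + h t * G t ^ 2)) * s := by linarith
      exact le_of_mul_le_mul_right this hs0
    have : 0 ≤ s * (1 + h t * G t ^ 2) := by positivity
    linarith
  · refine Eventually.of_forall fun t _ => ?_
    rcases eq_or_lt_of_le (g.h0 t) with h0 | h0
    · simp [← h0]
    · have e : √(h t) * G t / 2 = h t * G t / (2 * √(h t + 0)) := by
        rw [add_zero]
        have := Real.sqrt_pos.2 h0
        have h2 := Real.mul_self_sqrt h0.le
        field_simp
        rw [Real.sq_sqrt h0.le]; ring
      rw [e]
      refine tendsto_const_nhds.div (tendsto_const_nhds.mul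
        (Real.continuous_sqrt.continuousAt.tendsto.comp (tendsto_const_nhds.add eps_tendsto))) ?_
      rw [add_zero]; have := Real.sqrt_pos.2 h0; positivity
  · intro t _
    have : Tendsto (fun n : ℕ => √(h t + 1 / ((n:ℝ) + 1))) atTop (𝓝 (√(h t + 0))) :=
      Real.continuous_sqrt.continuousAt.tendsto.comp (tendsto_const_nhds.add eps_tendsto)
    simpa using this

lemma sqrt_mul_le {h x : ℝ} (hh : 0 ≤ h) : √h * |x| ≤ 1 + h * x ^ 2 := by
  have e : h * x ^ 2 = (√h * |x|) ^ 2 := by rw [mul_pow, sq_abs, Real.sq_sqrt hh]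
  rw [e]; nlinarith [sq_nonneg (√h * |x| - 1)]

lemma Adm.sqrtb_isInt {R : ℝ} {h : ℝ → ℝ} {b : ℝ → Euc d} (g : Good R h b)
    {V : ℝ → Euc d} {G : ℝ → ℝ} (A : Adm h b V G) :
    IsInt (fun t => √(h t) • gam h b t)
      (fun t => √(h t) • (V t + G t • gam h b t) - (√(h t) * G t / 2) • gam h b t) := by
  have hbd : IntegrableOn (fun t => (1 + h t * ‖V t‖ ^ 2) + 2 * R * (1 + h t * G t ^ 2))
      (Ioo 0 1) := by
    have h1 : IntegrableOn (fun _ : ℝ => (1:ℝ)) (Ioo 0 1) := integrable_const _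
    exact (h1.add A.iV).add ((h1.add A.iG).const_mul _)
  refine isInt_of_tendsto (zn := fun n t => (√(h t + 1 / ((n:ℝ) + 1)))⁻¹ • b t)
    (kn := fun n t => (√(h t + 1 / ((n:ℝ) + 1)))⁻¹ • (h t • (V t + G t • gam h b t)) +
      (-(h t * G t / (2 * √(h t + 1 / ((n:ℝ) + 1)))) / √(h t + 1 / ((n:ℝ) + 1)) ^ 2) • b t)
    (bound := fun t => (1 + h t * ‖V t‖ ^ 2) + 2 * R * (1 + h t * G t ^ 2))
    (fun n => ?_) (ii_of_Ioo hbd) (fun n => ?_) ?_ ?_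
  · have hε : (0:ℝ) < 1 / ((n:ℝ) + 1) := by positivity
    refine (A.eh.prodMk A.eb).chainE (Φ := fun x => (√(x.1 + 1 / ((n:ℝ) + 1)))⁻¹ • x.2)
      (fun t _ => ?_) ?_
    · have h1 : h t + 1 / ((n:ℝ) + 1) ≠ 0 := by linarith [g.h0 t] |> ne_of_gt
      have h2 : √(h t + 1 / ((n:ℝ) + 1)) ≠ 0 := (Real.sqrt_pos.2 (by linarith [g.h0 t])).ne'
      exact (((contDiffAt_fst.add contDiffAt_const).sqrt h1).inv h2).smul contDiffAt_snd
    · filter_upwards [A.eh.ae_hasDerivAt, A.eb.ae_hasDerivAt] with t ht htb hI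
      have h1 : h t + 1 / ((n:ℝ) + 1) ≠ 0 := by linarith [g.h0 t] |> ne_of_gt
      have h2 : √(h t + 1 / ((n:ℝ) + 1)) ≠ 0 := (Real.sqrt_pos.2 (by linarith [g.h0 t])).ne'
      exact ((((ht hI).add_const _).sqrt h1).inv h2).smul (htb hI)
  · refine Eventually.of_forall fun t _ => ?_
    have hε : (0:ℝ) < 1 / ((n:ℝ) + 1) := by positivity
    have hh := g.h0 t
    set s := √(h t + 1 / ((n:ℝ) + 1)) with hs
    have hs0 : 0 < s := Real.sqrt_pos.2 (by linarith)
    have hs2 : s ^ 2 = h t + 1 / ((n:ℝ) + 1) := Real.sq_sqrt (by linarith)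
    set r := √(h t) with hr
    have hr2 : r ^ 2 = h t := Real.sq_sqrt hh
    have hr0 : 0 ≤ r := Real.sqrt_nonneg _
    have hrs : r ≤ s := Real.sqrt_le_sqrt (by linarith)
    have hg := g.gam_le t
    have hV := sqrt_mul_le (x := ‖V t‖) hh
    rw [abs_norm] at hV
    have hG := sqrt_mul_le (x := G t) hh
    rw [← hr] at hV hG
    have hc1 : s⁻¹ * h t ≤ r := by
      rw [inv_mul_le_iff₀ hs0, ← hr2]; nlinarith
    have hc1' : 0 ≤ s⁻¹ * h t := by positivity
    have hc2 : h t / (2 * s) / s ^ 2 * h t ≤ r := by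
      have : h t / s ^ 2 ≤ 1 := by rw [div_le_one (by positivity)]; linarith
      have e : h t / (2 * s) / s ^ 2 * h t = (s⁻¹ * h t) * (h t / s ^ 2) / 2 := by
        field_simp
      rw [e]
      have h0' : 0 ≤ h t / s ^ 2 := by positivity
      nlinarith
    rw [g.b_eq t]
    have n1 : ‖s⁻¹ • (h t • (V t + G t • gam h b t))‖ ≤ r * ‖V t‖ + R * (r * |G t|) := by
      rw [smul_smul, norm_smul, Real.norm_of_nonneg hc1']
      have : ‖V t + G t • gam h b t‖ ≤ ‖V t‖ + |G t| * R := by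
        refine (norm_add_le _ _).trans ?_
        rw [norm_smul, Real.norm_eq_abs]
        gcongr
      calc _ ≤ r * (‖V t‖ + |G t| * R) := mul_le_mul hc1 this (norm_nonneg _) hr0
        _ = _ := by ring
    have n2 : ‖(-(h t * G t / (2 * s)) / s ^ 2) • (h t • gam h b t)‖ ≤ R * (r * |G t|) := by
      rw [smul_smul, norm_smul]
      have e : ‖-(h t * G t / (2 * s)) / s ^ 2 * h t‖ = (h t / (2 * s) / s ^ 2 * h t) * |G t| := by
        rw [show -(h t * G t / (2 * s)) / s ^ 2 * h t = -((h t / (2 * s) / s ^ 2 * h t) * G t) by ring,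
          norm_neg, norm_mul, Real.norm_of_nonneg (by positivity), Real.norm_eq_abs]
      rw [e]
      calc _ ≤ (r * |G t|) * R := by
            refine mul_le_mul ?_ hg (norm_nonneg _) (by positivity)
            exact mul_le_mul_of_nonneg_right hc2 (abs_nonneg _)
        _ = _ := by ring
    refine (norm_add_le _ _).trans ?_
    have hR := g.R0
    have := mul_le_mul_of_nonneg_left hG hR
    linarith
  · refine Eventually.of_forall fun t _ => ?_
    rcases eq_or_lt_of_le (g.h0 t) with h0 | h0
    · simp [← h0]
    · have hsp := Real.sqrt_pos.2 h0
      have hsq := Real.mul_self_sqrt h0.le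
      have e : √(h t) • (V t + G t • gam h b t) - (√(h t) * G t / 2) • gam h b t =
        (√(h t + 0))⁻¹ • (h t • (V t + G t • gam h b t)) +
        (-(h t * G t / (2 * √(h t + 0))) / √(h t + 0) ^ 2) • b t := by
        rw [add_zero, g.b_eq t, smul_smul, smul_smul, sub_eq_add_neg, ← neg_smul]
        congr 2
        · field_simp; nlinarith
        · rw [Real.sq_sqrt h0.le]; field_simp; rw [Real.sq_sqrt h0.le]; ring
      rw [e]
      have hl : Tendsto (fun n : ℕ => √(h t + 1 / ((n:ℝ) + 1))) atTop (𝓝 (√(h t + 0))) :=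
        Real.continuous_sqrt.continuousAt.tendsto.comp (tendsto_const_nhds.add eps_tendsto)
      have hne : √(h t + 0) ≠ 0 := by rw [add_zero]; exact hsp.ne'
      refine ((hl.inv₀ hne).smul tendsto_const_nhds).add (Tendsto.smul ?_ tendsto_const_nhds)
      refine Tendsto.div (Tendsto.neg (tendsto_const_nhds.div (tendsto_const_nhds.mul hl) ?_))
        (hl.pow 2) ?_ <;> positivity
  · intro t _
    rcases eq_or_lt_of_le (g.h0 t) with h0 | h0
    · simp [← h0, g.b_eq t]
    · have hsp := Real.sqrt_pos.2 h0
      have hl : Tendsto (fun n : ℕ => √(h t + 1 / ((n:ℝ) + 1))) atTop (𝓝 (√(h t + 0))) :=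
        Real.continuous_sqrt.continuousAt.tendsto.comp (tendsto_const_nhds.add eps_tendsto)
      rw [add_zero] at hl
      have : √(h t) • gam h b t = (√(h t))⁻¹ • b t := by
        rw [g.b_eq t, smul_smul]; congr 1
        have hsq := Real.mul_self_sqrt h0.le
        field_simp; nlinarith
      rw [this]
      exact (hl.inv₀ hsp.ne').smul tendsto_const_nhds

lemma Adm.ac2 {R : ℝ} {h : ℝ → ℝ} {b : ℝ → Euc d} (g : Good R h b)
    {V : ℝ → Euc d} {G : ℝ → ℝ} (A : Adm h b V G) :
    AC2 h ∧ AC2 (fun t => √(h t)) ∧ AC2 (fun t => √(h t) • gam h b t) := by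
  obtain ⟨M, hM0, hM⟩ := g.bdd
  refine ⟨ac2_of_isInt A.eh (A.iG.const_mul M) ?_, ac2_of_isInt (A.sqrt_isInt g) A.iG ?_,
    ac2_of_isInt (A.sqrtb_isInt g) ((A.iV.const_mul 2).add (A.iG.const_mul (2 * R ^ 2))) ?_⟩
  · intro t ht
    have h1 := hM t (Ioo_subset_Icc_self ht)
    have h0 := g.h0 t
    rw [Real.norm_eq_abs, sq_abs]
    have : 0 ≤ h t * G t ^ 2 := by positivity
    calc (h t * G t) ^ 2 = h t * (h t * G t ^ 2) := by ring
      _ ≤ _ := mul_le_mul_of_nonneg_right h1 this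
  · intro t ht
    have h0 := g.h0 t
    rw [Real.norm_eq_abs, sq_abs, div_pow, mul_pow, Real.sq_sqrt h0]
    have : 0 ≤ h t * G t ^ 2 := by positivity
    linarith
  · intro t ht
    have h0 := g.h0 t
    have e : √(h t) • (V t + G t • gam h b t) - (√(h t) * G t / 2) • gam h b t =
      √(h t) • (V t + (G t / 2) • gam h b t) := by module
    have hn : ‖V t + (G t / 2) • gam h b t‖ ≤ ‖V t‖ + |G t| * R := by
      refine (norm_add_le _ _).trans ?_
      rw [norm_smul, Real.norm_eq_abs, abs_div, abs_two]
      have := g.gam_le t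
      have h2 : |G t| / 2 * ‖gam h b t‖ ≤ |G t| * R :=
        mul_le_mul (by linarith [abs_nonneg (G t)]) this (norm_nonneg _) (abs_nonneg _)
      linarith
    rw [e, norm_smul, mul_pow, Real.norm_eq_abs, sq_abs, Real.sq_sqrt h0]
    have h3 : ‖V t + (G t / 2) • gam h b t‖ ^ 2 ≤ 2 * ‖V t‖ ^ 2 + 2 * R ^ 2 * G t ^ 2 := by
      have := pow_le_pow_left₀ (norm_nonneg _) hn 2
      have e2 : G t ^ 2 = |G t| ^ 2 := (sq_abs _).symm
      rw [e2]
      nlinarith [sq_nonneg (‖V t‖ - |G t| * R)]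
    have := mul_le_mul_of_nonneg_left h3 h0
    simp only [Pi.add_apply]
    linarith

lemma IsTest.bounds {φ : XX d → ℝ} (hφ : IsTest φ) :
    ∃ C, 0 ≤ C ∧ (∀ x, |φ x| ≤ C) ∧ ∀ x, ‖fderiv ℝ φ x‖ ≤ C := by
  obtain ⟨h1, h2, h3⟩ := hφ
  obtain ⟨C0, hC0⟩ := h1.continuous.bounded_above_of_compact_support h2
  obtain ⟨C1, hC1⟩ := (h1.continuous_fderiv (by simp)).bounded_above_of_compact_support
    (h2.fderiv (𝕜 := ℝ))
  refine ⟨max C0 C1, (norm_nonneg _).trans ((hC0 0).trans (le_max_left _ _)),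
    fun x => (hC0 x).trans (le_max_left _ _), fun x => (hC1 x).trans (le_max_right _ _)⟩

lemma IsTest.zero_of {φ : XX d → ℝ} (hφ : IsTest φ) {t : ℝ} (ht : t ∉ Ioo (0:ℝ) 1) (x : Euc d) :
    φ (t, x) = 0 :=
  image_eq_zero_of_notMem_tsupport fun h => ht (hφ.2.2 h).1

lemma q_bounds {h ε : ℝ} (hh : 0 ≤ h) (hε : 0 < ε) : 0 ≤ h / (h + ε) ∧ h / (h + ε) ≤ 1 := by
  refine ⟨by positivity, ?_⟩
  rw [div_le_one (by positivity)]; linarith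

/-- the continuity equation along an admissible pair -/
lemma Adm.ce {R : ℝ} {h : ℝ → ℝ} {b : ℝ → Euc d} (g : Good R h b)
    {V : ℝ → Euc d} {G : ℝ → ℝ} (A : Adm h b V G) {φ : XX d → ℝ} (hφ : IsTest φ) :
    ∫ t in Ioo (0:ℝ) 1, h t * (fderiv ℝ φ (t, gam h b t) (1, V t) + φ (t, gam h b t) * G t) = 0 := by
  obtain ⟨C, hC0, hC, hC1⟩ := hφ.bounds
  have hR := g.R0
  have hdiff : Differentiable ℝ φ := hφ.1.differentiable (by simp)
  have hbd : IntegrableOn (fun t => (C + C + C + 2 * R * C + C) * h t + C * (h t * ‖V t‖ ^ 2)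
      + (C + 2 * R * C) * (h t * G t ^ 2)) (Ioo 0 1) :=
    ((g.h_int.const_mul _).add (A.iV.const_mul _)).add (A.iG.const_mul _)
  have key : IsInt (fun t => h t * φ (t, gam h b t))
      (fun t => h t * (fderiv ℝ φ (t, gam h b t) (1, V t) + φ (t, gam h b t) * G t)) := by
    refine isInt_of_tendsto
      (zn := fun n t => h t * φ (t, (h t + 1 / ((n:ℝ) + 1))⁻¹ • b t))
      (kn := fun n t => h t * G t * φ (t, (h t + 1 / ((n:ℝ) + 1))⁻¹ • b t) +
        h t * fderiv ℝ φ (t, (h t + 1 / ((n:ℝ) + 1))⁻¹ • b t)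
          (1, (h t + 1 / ((n:ℝ) + 1))⁻¹ • (h t • (V t + G t • gam h b t)) +
          (-(h t * G t) / (h t + 1 / ((n:ℝ) + 1)) ^ 2) • b t))
      (fun n => ?_) (ii_of_Ioo hbd) (fun n => ?_) ?_ ?_
    · have hε : (0:ℝ) < 1 / ((n:ℝ) + 1) := by positivity
      have h1 : ∀ t, h t + 1 / ((n:ℝ) + 1) ≠ 0 := fun t => by linarith [g.h0 t] |> ne_of_gt
      refine ((isInt_id.prodMk A.eh).prodMk A.eb).chain
        (Φ := fun x => x.1.2 * φ (x.1.1, (x.1.2 + 1 / ((n:ℝ) + 1))⁻¹ • x.2)) (fun t _ => ?_) ?_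
      · have c12 : ContDiffAt ℝ 1 (fun x : (ℝ × ℝ) × Euc d => x.1.2) ((t, h t), b t) :=
          (contDiff_snd.comp contDiff_fst).contDiffAt
        have c11 : ContDiffAt ℝ 1 (fun x : (ℝ × ℝ) × Euc d => x.1.1) ((t, h t), b t) :=
          (contDiff_fst.comp contDiff_fst).contDiffAt
        refine c12.mul ?_
        have cφ : ContDiff ℝ 1 φ := hφ.1.of_le (by simp)
        exact cφ.contDiffAt.comp ((t, h t), b t)
          (c11.prodMk (((c12.add contDiffAt_const).inv (h1 t)).smul contDiffAt_snd))
      · filter_upwards [A.eh.ae_hasDerivAt, A.eb.ae_hasDerivAt] with t ht htb hI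
        have e1 := (((ht hI).add_const (1 / ((n:ℝ) + 1))).inv (h1 t)).smul (htb hI)
        have e2 := (hdiff (t, (h t + 1 / ((n:ℝ) + 1))⁻¹ • b t)).hasFDerivAt.comp_hasDerivAt t
          ((hasDerivAt_id t).prodMk e1)
        exact (ht hI).mul e2
    · refine Eventually.of_forall fun t _ => ?_
      have hε : (0:ℝ) < 1 / ((n:ℝ) + 1) := by positivity
      have hh := g.h0 t
      obtain ⟨q0, q1⟩ := q_bounds hh hε
      set ε := 1 / ((n:ℝ) + 1)
      have hne : h t + ε ≠ 0 := by linarith |> ne_of_gt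
      have hg := g.gam_le t
      have hc : ‖(h t + ε)⁻¹ • (h t • (V t + G t • gam h b t)) +
          (-(h t * G t) / (h t + ε) ^ 2) • b t‖ ≤ ‖V t‖ + 2 * R * |G t| := by
        rw [g.b_eq t]
        have e : (h t + ε)⁻¹ • (h t • (V t + G t • gam h b t)) +
          (-(h t * G t) / (h t + ε) ^ 2) • (h t • gam h b t) =
          (h t / (h t + ε)) • (V t + G t • gam h b t) -
            ((h t / (h t + ε)) ^ 2 * G t) • gam h b t := by
          rw [smul_smul, smul_smul, sub_eq_add_neg, ← neg_smul]
          congr 2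
          · ring
          · field_simp
        rw [e]
        set q := h t / (h t + ε)
        have n1 : ‖V t + G t • gam h b t‖ ≤ ‖V t‖ + |G t| * R := by
          refine (norm_add_le _ _).trans ?_
          rw [norm_smul, Real.norm_eq_abs]
          gcongr
        have n2 : ‖q • (V t + G t • gam h b t)‖ ≤ ‖V t‖ + |G t| * R := by
          rw [norm_smul, Real.norm_of_nonneg q0]
          nlinarith [norm_nonneg (V t + G t • gam h b t)]
        have n3 : ‖(q ^ 2 * G t) • gam h b t‖ ≤ |G t| * R := by
          rw [norm_smul, norm_mul, Real.norm_of_nonneg (by positivity), Real.norm_eq_abs]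
          have : q ^ 2 ≤ 1 := by nlinarith
          refine mul_le_mul ?_ hg (norm_nonneg _) (abs_nonneg _)
          nlinarith [abs_nonneg (G t)]
        refine (norm_sub_le _ _).trans ?_
        linarith
      set c := (h t + ε)⁻¹ • (h t • (V t + G t • gam h b t)) +
          (-(h t * G t) / (h t + ε) ^ 2) • b t
      set x : XX d := (t, (h t + ε)⁻¹ • b t)
      have hF : ‖fderiv ℝ φ x (1, c)‖ ≤ C * (1 + (‖V t‖ + 2 * R * |G t|)) := by
        refine ((fderiv ℝ φ x).le_opNorm _).trans ?_
        refine mul_le_mul (hC1 x) ?_ (norm_nonneg _) hC0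
        rw [Prod.norm_mk]
        refine max_le ?_ ?_
        · rw [norm_one]; linarith [norm_nonneg (V t), mul_nonneg hR (abs_nonneg (G t))]
        · linarith
      have hP : ‖h t * G t * φ x‖ ≤ h t * |G t| * C := by
        rw [norm_mul, norm_mul, Real.norm_of_nonneg hh, Real.norm_eq_abs, Real.norm_eq_abs]
        exact mul_le_mul_of_nonneg_left (hC x) (by positivity)
      have hQ : ‖h t * fderiv ℝ φ x (1, c)‖ ≤ h t * (C * (1 + (‖V t‖ + 2 * R * |G t|))) := by
        rw [norm_mul, Real.norm_of_nonneg hh]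
        exact mul_le_mul_of_nonneg_left hF hh
      have a1 : |G t| ≤ 1 + G t ^ 2 := by
        rw [← sq_abs]; nlinarith [sq_nonneg (|G t| - 1)]
      have a2 : ‖V t‖ ≤ 1 + ‖V t‖ ^ 2 := by nlinarith [sq_nonneg (‖V t‖ - 1)]
      refine (norm_add_le _ _).trans ?_
      have b1 := mul_le_mul_of_nonneg_left a1 (mul_nonneg hh (by positivity : 0 ≤ C + 2 * R * C))
      have b2 := mul_le_mul_of_nonneg_left a2 (mul_nonneg hh hC0)
      have b3 : 0 ≤ C * h t := by positivity
      nlinarith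
    · refine Eventually.of_forall fun t _ => ?_
      rcases eq_or_lt_of_le (g.h0 t) with h0 | h0
      · simp [← h0]
      · have hl : Tendsto (fun n : ℕ => h t + 1 / ((n:ℝ) + 1)) atTop (𝓝 (h t)) := by
          simpa using (tendsto_const_nhds (x := h t)).add eps_tendsto
        have hli := hl.inv₀ h0.ne'
        have hb : Tendsto (fun n : ℕ => (t, (h t + 1 / ((n:ℝ) + 1))⁻¹ • b t)) atTop
            (𝓝 (t, gam h b t)) :=
          tendsto_const_nhds.prodMk_nhds (hli.smul_const _)
        have hφt := (hφ.1.continuous.tendsto _).comp hb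
        have hft := ((hφ.1.continuous_fderiv (by simp)).tendsto _).comp hb
        have hc : Tendsto (fun n : ℕ => ((1:ℝ), (h t + 1 / ((n:ℝ) + 1))⁻¹ • (h t • (V t + G t • gam h b t)) +
          (-(h t * G t) / (h t + 1 / ((n:ℝ) + 1)) ^ 2) • b t)) atTop (𝓝 (1, V t)) := by
          have e : V t = (h t)⁻¹ • (h t • (V t + G t • gam h b t)) +
            (-(h t * G t) / (h t) ^ 2) • b t := by
            rw [g.b_eq t, smul_smul, smul_smul, inv_mul_cancel₀ h0.ne',
              show -(h t * G t) / h t ^ 2 * h t = - G t by field_simp]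
            module
          rw [e]
          conv => 
            enter [1, n, 2, 1, 2, 2]
            rw [← e]
          refine tendsto_const_nhds.prodMk_nhds ((hli.smul_const _).add (Tendsto.smul_const ?_ _))
          exact tendsto_const_nhds.div (hl.pow 2) (by positivity)
        have := (hφt.const_mul (h t * G t)).add (Tendsto.const_mul (h t) 
          ((isBoundedBilinearMap_apply (𝕜 := ℝ)).continuous.continuousAt.tendsto.comp
            (hft.prodMk_nhds hc)))
        refine (this.congr fun n => rfl).trans (le_of_eq ?_)
        congr 1; ring
    · intro t _
      rcases eq_or_lt_of_le (g.h0 t) with h0 | h0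
      · simp [← h0]
      · have hl : Tendsto (fun n : ℕ => h t + 1 / ((n:ℝ) + 1)) atTop (𝓝 (h t)) := by
          simpa using (tendsto_const_nhds (x := h t)).add eps_tendsto
        have hli := hl.inv₀ h0.ne'
        have hb : Tendsto (fun n : ℕ => (t, (h t + 1 / ((n:ℝ) + 1))⁻¹ • b t)) atTop
            (𝓝 (t, gam h b t)) :=
          tendsto_const_nhds.prodMk_nhds (hli.smul_const _)
        exact ((hφ.1.continuous.tendsto _).comp hb).const_mul _
  rw [int_Ioo, ← key.sub_eq (by simp) (by simp)]
  rw [hφ.zero_of (by simp), hφ.zero_of (by simp)]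
  simp

/-- mass of a curve -/
def hh {V : Set (Euc d)} (η : SCurve V) (t : ℝ) : ℝ := (η.toFun t Set.univ).toReal

/-- first moment of a curve -/
def bb {V : Set (Euc d)} (η : SCurve V) (t : ℝ) : Euc d := ∫ x, x ∂(η.toFun t)

lemma wdirac_univ {a : ℝ} (ha : 0 ≤ a) (x : Euc d) :
    ((ENNReal.ofReal a • Measure.dirac x : Measure (Euc d)) Set.univ).toReal = a := by
  simp [ENNReal.toReal_ofReal ha]

lemma wdirac_int {F : Type*} [NormedAddCommGroup F] [NormedSpace ℝ F] [CompleteSpace F]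
    {a : ℝ} (ha : 0 ≤ a) (x : Euc d) (f : Euc d → F) :
    ∫ y, f y ∂(ENNReal.ofReal a • Measure.dirac x : Measure (Euc d)) = a • f x := by
  rw [integral_smul_measure, integral_dirac, ENNReal.toReal_ofReal ha]

lemma hh_nonneg {V : Set (Euc d)} (η : SCurve V) (t : ℝ) : 0 ≤ hh η t := ENNReal.toReal_nonneg

lemma scurve_rep {V : Set (Euc d)} (η : SCurve V) (t : ℝ) :
    ∃ x ∈ V, η.toFun t = ENNReal.ofReal (hh η t) • Measure.dirac x ∧ bb η t = hh η t • x := by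
  obtain ⟨a, x, ha, hx, e⟩ := η.cone t
  have e1 : hh η t = a := by unfold hh; rw [e, wdirac_univ ha]
  refine ⟨x, hx, by rw [e1, e], ?_⟩
  unfold bb
  rw [e1, e, wdirac_int ha]

lemma gam_eq_of {h : ℝ → ℝ} {b : ℝ → Euc d} {t : ℝ} {x : Euc d} (h0 : h t ≠ 0)
    (e : b t = h t • x) : gam h b t = x := by
  rw [gam, e, smul_smul, inv_mul_cancel₀ h0, one_smul]

lemma gam_mem {V : Set (Euc d)} (η : SCurve V) {t : ℝ} (ht : hh η t ≠ 0) :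
    gam (hh η) (bb η) t ∈ V := by
  obtain ⟨x, hx, -, e⟩ := scurve_rep η t
  rw [gam_eq_of ht e]; exact hx

lemma scurve_eq {V : Set (Euc d)} (η : SCurve V) (t : ℝ) :
    η.toFun t = ENNReal.ofReal (hh η t) • Measure.dirac (gam (hh η) (bb η) t) := by
  obtain ⟨x, hx, e1, e⟩ := scurve_rep η t
  by_cases h0 : hh η t = 0
  · rw [e1, h0]; simp
  · rw [gam_eq_of h0 e]; exact e1

lemma scurve_int {V : Set (Euc d)} (η : SCurve V) (t : ℝ) (φ : Euc d → ℝ) :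
    ∫ x, φ x ∂(η.toFun t) = hh η t * φ (gam (hh η) (bb η) t) := by
  rw [scurve_eq η t, wdirac_int (hh_nonneg η t), smul_eq_mul]

lemma scurve_good {V : Set (Euc d)} {R : ℝ} (hR : 0 ≤ R) (hV : ∀ x ∈ V, ‖x‖ ≤ R) (η : SCurve V) :
    Good R (hh η) (bb η) where
  R0 := hR
  hc := by
    have := η.narrow (fun _ => 1) continuous_const
    refine this.congr fun t => ?_
    rw [scurve_int]; simp
  bc := by
    have : Continuous fun t => (fun i => bb η t i) := by
      refine continuous_pi fun i => ?_
      have := η.narrow (fun x => x i) (cproj i).continuous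
      refine this.congr fun t => ?_
      obtain ⟨x, hx, e1, e⟩ := scurve_rep η t
      rw [e1, e, wdirac_int (hh_nonneg η t)]
      simp
    exact (EuclideanSpace.equiv (Fin d) ℝ).symm.continuous.comp this
  h0 := hh_nonneg η
  bR := fun t => by
    obtain ⟨x, hx, -, e⟩ := scurve_rep η t
    rw [e, norm_smul, Real.norm_of_nonneg (hh_nonneg η t), mul_comm]
    exact mul_le_mul_of_nonneg_right (hV x hx) (hh_nonneg η t)

lemma Represents.hh_eq {V : Set (Euc d)} {η : SCurve V} {γ : ℝ → Euc d} {h : ℝ → ℝ}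
    (r : Represents η γ h) {t : ℝ} (ht : t ∈ Icc (0:ℝ) 1) : hh η t = h t := by
  obtain ⟨h0, -, e⟩ := r t ht
  rw [hh, e, wdirac_univ h0]

lemma Represents.bb_eq {V : Set (Euc d)} {η : SCurve V} {γ : ℝ → Euc d} {h : ℝ → ℝ}
    (r : Represents η γ h) {t : ℝ} (ht : t ∈ Icc (0:ℝ) 1) : bb η t = h t • γ t := by
  obtain ⟨h0, -, e⟩ := r t ht
  rw [bb, e, wdirac_int h0]

lemma Represents.gam_eq {V : Set (Euc d)} {η : SCurve V} {γ : ℝ → Euc d} {h : ℝ → ℝ}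
    (r : Represents η γ h) {t : ℝ} (ht : t ∈ Icc (0:ℝ) 1) (h0 : h t ≠ 0) :
    gam (hh η) (bb η) t = γ t := by
  apply gam_eq_of
  · rw [r.hh_eq ht]; exact h0
  · rw [r.hh_eq ht, r.bb_eq ht]

lemma closure_bdd {V : Set (Euc d)} (hV : IsClosureOfBoundedDomain V) :
    V.Nonempty ∧ IsCompact V ∧ ∃ R : ℝ, 0 ≤ R ∧ ∀ x ∈ V, ‖x‖ ≤ R := by
  obtain ⟨U, -, hne, -, hb, rfl⟩ := hV
  have hc : IsCompact (closure U) := hb.isCompact_closure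
  refine ⟨hne.closure, hc, ?_⟩
  obtain ⟨R, hR⟩ := hb.closure.exists_norm_le
  exact ⟨max R 0, le_max_right _ _, fun x hx => (hR x hx).trans (le_max_left _ _)⟩

/-- the measure `dt ⊗ h(t) δ_{γ(t)}` -/
def PP (h : ℝ → ℝ) (b : ℝ → Euc d) : Measure (XX d) :=
  ((volume.restrict (Ioo (0:ℝ) 1)).withDensity (fun t => ENNReal.ofReal (h t))).map
    (fun t => (t, gam h b t))

section PPsec
variable {R : ℝ} {h : ℝ → ℝ} {b : ℝ → Euc d}

lemma Good.graph_meas (g : Good R h b) : Measurable (fun t => (t, gam h b t)) :=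
  measurable_id.prodMk g.gam_meas

lemma Good.PP_lint (g : Good R h b) {f : XX d → ℝ≥0∞} (hf : Measurable f) :
    ∫⁻ x, f x ∂(PP h b) = ∫⁻ t in Ioo (0:ℝ) 1, ENNReal.ofReal (h t) * f (t, gam h b t) := by
  rw [PP, lintegral_map hf g.graph_meas]
  exact lintegral_withDensity_eq_lintegral_mul _
    g.hc.measurable.ennreal_ofReal (hf.comp g.graph_meas)

lemma Good.PP_finite (g : Good R h b) : IsFiniteMeasure (PP h b) := by
  refine ⟨?_⟩
  have := g.PP_lint (f := fun _ => 1) measurable_const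
  rw [lintegral_one] at this
  rw [this]
  simp only [mul_one]
  exact g.h_int.lintegral_lt_top

lemma Good.PP_integrable (g : Good R h b) {F : Type*} [NormedAddCommGroup F] [NormedSpace ℝ F]
    {f : XX d → F} (hf : StronglyMeasurable f) :
    Integrable f (PP h b) ↔ IntegrableOn (fun t => h t • f (t, gam h b t)) (Ioo 0 1) := by
  rw [PP, integrable_map_measure hf.aestronglyMeasurable g.graph_meas.aemeasurable,
    integrable_withDensity_iff_integrable_smul' g.hc.measurable.ennreal_ofReal
      (by simp)]
  simp only [Function.comp, ENNReal.toReal_ofReal (g.h0 _)]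
  rfl

lemma Good.PP_int (g : Good R h b) {F : Type*} [NormedAddCommGroup F] [NormedSpace ℝ F]
    {f : XX d → F} (hf : StronglyMeasurable f) :
    ∫ x, f x ∂(PP h b) = ∫ t in Ioo (0:ℝ) 1, h t • f (t, gam h b t) := by
  rw [PP, integral_map g.graph_meas.aemeasurable hf.aestronglyMeasurable,
    integral_withDensity_eq_integral_toReal_smul g.hc.measurable.ennreal_ofReal
      (by simp)]
  simp only [ENNReal.toReal_ofReal (g.h0 _)]

end PPsec

lemma curveMeasure_iff {V : Set (Euc d)} {R : ℝ} (hR : 0 ≤ R) (hV : ∀ x ∈ V, ‖x‖ ≤ R)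
    (η : SCurve V) (P : Measure (XX d)) : CurveMeasure η P ↔ P = PP (hh η) (bb η) := by
  have g := scurve_good hR hV η
  have key : ∀ s, MeasurableSet s → PP (hh η) (bb η) s =
      ∫⁻ t in Ioo (0:ℝ) 1, η.toFun t {x | (t, x) ∈ s} := by
    intro s hs
    have := g.PP_lint (f := s.indicator 1) (measurable_one.indicator hs)
    rw [lintegral_indicator_one hs] at this
    rw [this]
    refine lintegral_congr fun t => ?_
    have hm : MeasurableSet {x | (t, x) ∈ s} := measurable_prodMk_left hs
    rw [scurve_eq η t, Measure.smul_apply, Measure.dirac_apply' _ hm, smul_eq_mul]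
    rfl
  constructor
  · intro H
    ext s hs
    rw [H s hs, key s hs]
  · rintro rfl s hs
    exact key s hs

lemma dens_lint {F : Type*} [NormedAddCommGroup F] [NormedSpace ℝ F] [CompleteSpace F]
    [MeasurableSpace F] [BorelSpace F] [SecondCountableTopology F]
    {m : VectorMeasure (XX d) F} {lam : Measure (XX d)} [IsFiniteMeasure lam] {w : XX d → F}
    (H : ∀ s, MeasurableSet s → m s = ∫ x in s, w x ∂lam) (hw : Measurable w) (L : F →L[ℝ] ℝ) :
    ∫⁻ x, ENNReal.ofReal (L (w x)) ∂lam < ⊤ := by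
  have hLw : Measurable fun x => L (w x) := L.measurable.comp hw
  let A : ℕ → Set (XX d) := fun n => {x | 0 ≤ L (w x)} ∩ {x | ⌊‖w x‖⌋₊ = n}
  have hA : ∀ n, MeasurableSet (A n) := fun n =>
    (measurableSet_le measurable_const hLw).inter
      ((Nat.measurable_floor.comp hw.norm) (measurableSet_singleton n))
  have hdis : Pairwise (Function.onFun Disjoint A) := by
    intro i j hij
    rw [Function.onFun, Set.disjoint_left]
    rintro x ⟨-, h1⟩ ⟨-, h2⟩
    exact hij (h1.symm.trans h2)
  have hU : (⋃ n, A n) = {x | 0 ≤ L (w x)} := by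
    ext x; simp [A]
  have hint : ∀ n, IntegrableOn w (A n) lam := by
    intro n
    refine Measure.integrableOn_of_bounded (M := n + 1) (measure_ne_top _ _)
      hw.aestronglyMeasurable ?_
    rw [ae_restrict_iff' (hA n)]
    refine Eventually.of_forall fun x hx => ?_
    have := Nat.lt_floor_add_one ‖w x‖
    rw [show ⌊‖w x‖⌋₊ = n from hx.2] at this
    exact this.le
  have hsum : Summable fun n => L (m (A n)) := by
    have := (m.m_iUnion' hA hdis).summable
    exact L.summable this
  have hval : ∀ n, L (m (A n)) = ∫ x in A n, L (w x) ∂lam := fun n => by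
    rw [H _ (hA n), ← L.integral_comp_comm (hint n)]
  have hnn : ∀ n, 0 ≤ L (m (A n)) := fun n => by
    rw [hval n]
    exact setIntegral_nonneg (hA n) fun x hx => hx.1
  have hl : ∀ n, ∫⁻ x in A n, ENNReal.ofReal (L (w x)) ∂lam = ENNReal.ofReal (L (m (A n))) := by
    intro n
    rw [hval n, ofReal_integral_eq_lintegral_ofReal (L.integrable_comp (hint n))]
    rw [EventuallyLE, ae_restrict_iff' (hA n)]
    exact Eventually.of_forall fun x hx => hx.1
  have e : ∫⁻ x, ENNReal.ofReal (L (w x)) ∂lam = ∫⁻ x in ⋃ n, A n, ENNReal.ofReal (L (w x)) ∂lam := by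
    rw [hU, ← lintegral_indicator (measurableSet_le measurable_const hLw)]
    refine lintegral_congr fun x => ?_
    by_cases hx : 0 ≤ L (w x)
    · simp [Set.indicator, hx]
    · simp [Set.indicator, hx, ENNReal.ofReal_eq_zero, (not_le.1 hx).le]
  rw [e, lintegral_iUnion hA hdis]
  simp_rw [hl]
  rw [← ENNReal.ofReal_tsum_of_nonneg hnn hsum]
  exact ENNReal.ofReal_lt_top

lemma dens_int {F : Type*} [NormedAddCommGroup F] [NormedSpace ℝ F] [CompleteSpace F]
    [MeasurableSpace F] [BorelSpace F] [SecondCountableTopology F]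
    {m : VectorMeasure (XX d) F} {lam : Measure (XX d)} [IsFiniteMeasure lam] {w : XX d → F}
    (H : ∀ s, MeasurableSet s → m s = ∫ x in s, w x ∂lam) (hw : Measurable w) (L : F →L[ℝ] ℝ) :
    Integrable (fun x => L (w x)) lam := by
  have hLw : Measurable fun x => L (w x) := L.measurable.comp hw
  refine ⟨hLw.aestronglyMeasurable, ?_⟩
  have h1 := dens_lint H hw L
  have h2 := dens_lint H hw (-L)
  rw [HasFiniteIntegral]
  refine lt_of_le_of_lt ?_ (ENNReal.add_lt_top.2 ⟨h1, h2⟩)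
  rw [← lintegral_add_left (hLw.ennreal_ofReal)]
  refine lintegral_mono fun x => ?_
  rw [Real.enorm_eq_ofReal_abs]
  rcases le_total 0 (L (w x)) with h | h
  · rw [abs_of_nonneg h]; exact le_self_add
  · rw [abs_of_nonpos h]; simp

lemma IsDensityS.integrable {σ : SignedMeasure (XX d)} {lam : Measure (XX d)} [IsFiniteMeasure lam]
    {u : XX d → ℝ} (H : IsDensityS σ lam u) (hu : Measurable u) : Integrable u lam :=
  dens_int H hu (ContinuousLinearMap.id ℝ ℝ)

lemma IsDensityV.integrable {m : VectorMeasure (XX d) (Euc d)} {lam : Measure (XX d)}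
    [IsFiniteMeasure lam] {w : XX d → Euc d} (H : IsDensityV m lam w) (hw : Measurable w) :
    Integrable w lam := by
  have : Integrable (fun x => fun i => w x i) lam :=
    Integrable.of_eval (fun i => dens_int H hw (cproj i))
  exact ((EuclideanSpace.equiv (Fin d) ℝ).symm.toContinuousLinearMap).integrable_comp this

lemma int_pos_neg {lam : Measure (XX d)} {u ψ : XX d → ℝ} (hu : Measurable u)
    (hui : Integrable u lam) (hψ : Measurable ψ) {C : ℝ} (hC : ∀ x, |ψ x| ≤ C) :
    ∫ x, ψ x * u x ∂lam = (∫ x, ψ x ∂(lam.withDensity fun x => ENNReal.ofReal (u x))) -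
      ∫ x, ψ x ∂(lam.withDensity fun x => ENNReal.ofReal (- u x)) := by
  rw [integral_withDensity_eq_integral_toReal_smul hu.ennreal_ofReal (by simp),
    integral_withDensity_eq_integral_toReal_smul (f := fun x => ENNReal.ofReal (-u x))
      hu.neg.ennreal_ofReal (by simp)]
  have hi : ∀ v : XX d → ℝ, Integrable v lam → Integrable
      (fun x => (ENNReal.ofReal (v x)).toReal • ψ x) lam := by
    intro v hv
    have := (hv.pos_part.bdd_mul (c := C) hψ.aestronglyMeasurable (Eventually.of_forall hC))
    refine this.congr (Eventually.of_forall fun x => ?_)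
    simp only [ENNReal.toReal_ofReal', smul_eq_mul, mul_comm]
  rw [← integral_sub (hi u hui) (hi (fun x => - u x) hui.neg)]
  refine integral_congr_ae (Eventually.of_forall fun x => ?_)
  simp only [ENNReal.toReal_ofReal', smul_eq_mul]
  rw [← sub_mul, mul_comm]
  congr 1
  rcases le_total 0 (u x) with h | h
  · rw [max_eq_left h, max_eq_right (by linarith)]; ring
  · rw [max_eq_right h, max_eq_left (by linarith)]; ring

lemma indep_S {σ : SignedMeasure (XX d)} {lam lam' : Measure (XX d)} [IsFiniteMeasure lam]
    [IsFiniteMeasure lam'] {u u' ψ : XX d → ℝ} (H : IsDensityS σ lam u) (hu : Measurable u)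
    (H' : IsDensityS σ lam' u') (hu' : Measurable u') (hψ : Measurable ψ) {C : ℝ}
    (hC : ∀ x, |ψ x| ≤ C) : ∫ x, ψ x * u x ∂lam = ∫ x, ψ x * u' x ∂lam' := by
  have i := H.integrable hu
  have i' := H'.integrable hu'
  rw [int_pos_neg hu i hψ hC, int_pos_neg hu' i' hψ hC]
  have f1 : IsFiniteMeasure (lam.withDensity fun x => ENNReal.ofReal (u x)) :=
    isFiniteMeasure_withDensity_ofReal i.2
  have f2 : IsFiniteMeasure (lam.withDensity fun x => ENNReal.ofReal (-u x)) :=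
    isFiniteMeasure_withDensity_ofReal i.neg.2
  have f3 : IsFiniteMeasure (lam'.withDensity fun x => ENNReal.ofReal (u' x)) :=
    isFiniteMeasure_withDensity_ofReal i'.2
  have f4 : IsFiniteMeasure (lam'.withDensity fun x => ENNReal.ofReal (-u' x)) :=
    isFiniteMeasure_withDensity_ofReal i'.neg.2
  have hψi : ∀ ν : Measure (XX d), IsFiniteMeasure ν → Integrable ψ ν := fun ν _ =>
    Integrable.of_bound hψ.aestronglyMeasurable C (Eventually.of_forall hC)
  have key : (lam.withDensity fun x => ENNReal.ofReal (u x)) +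
      (lam'.withDensity fun x => ENNReal.ofReal (-u' x)) =
      (lam'.withDensity fun x => ENNReal.ofReal (u' x)) +
      (lam.withDensity fun x => ENNReal.ofReal (-u x)) := by
    ext s hs
    have e1 := H s hs
    have e2 := H' s hs
    rw [integral_eq_lintegral_pos_part_sub_lintegral_neg_part i.integrableOn,
      ← withDensity_apply _ hs, ← withDensity_apply _ hs] at e1
    rw [integral_eq_lintegral_pos_part_sub_lintegral_neg_part i'.integrableOn,
      ← withDensity_apply _ hs, ← withDensity_apply _ hs] at e2
    simp only [Measure.add_apply]
    rw [← ENNReal.toReal_eq_toReal_iff' (by finiteness) (by finiteness),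
      ENNReal.toReal_add (by finiteness) (by finiteness),
      ENNReal.toReal_add (by finiteness) (by finiteness)]
    linarith
  have := congrArg (fun ν => ∫ x, ψ x ∂ν) key
  beta_reduce at this
  rw [integral_add_measure (hψi _ f1) (hψi _ f4), integral_add_measure (hψi _ f3) (hψi _ f2)] at this
  linarith

lemma IsDensityV.comp {m : VectorMeasure (XX d) (Euc d)} {lam : Measure (XX d)}
    [IsFiniteMeasure lam] {w : XX d → Euc d} (H : IsDensityV m lam w) (hw : Measurable w)
    (i : Fin d) :
    IsDensityS (m.mapRange (cproj i).toLinearMap.toAddMonoidHom (cproj i).continuous) lam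
      (fun x => w x i) := by
  intro s hs
  have := (cproj i).integral_comp_comm ((H.integrable hw).integrableOn (s := s))
  change cproj i (m s) = _
  rw [H s hs, ← this]
  rfl

lemma euc_sum (x : Euc d) : x = ∑ i, x i • EuclideanSpace.single i (1:ℝ) := by
  ext j
  simp [Finset.sum_apply, Pi.single_apply]

lemma indep_V {m : VectorMeasure (XX d) (Euc d)} {lam lam' : Measure (XX d)} [IsFiniteMeasure lam]
    [IsFiniteMeasure lam'] {w w' : XX d → Euc d} (H : IsDensityV m lam w) (hw : Measurable w)
    (H' : IsDensityV m lam' w') (hw' : Measurable w') {φ : XX d → ℝ} (hφ : IsTest φ) :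
    ∫ x, fderiv ℝ φ x ((0:ℝ), w x) ∂lam = ∫ x, fderiv ℝ φ x ((0:ℝ), w' x) ∂lam' := by
  obtain ⟨C, hC0, -, hC⟩ := hφ.bounds
  let ψ : Fin d → XX d → ℝ := fun i x => fderiv ℝ φ x ((0:ℝ), EuclideanSpace.single i (1:ℝ))
  have hψ : ∀ i, Measurable (ψ i) := fun i =>
    ((hφ.1.continuous_fderiv (by simp)).clm_apply continuous_const).measurable
  have hψC : ∀ i x, |ψ i x| ≤ C := fun i x => by
    refine ((fderiv ℝ φ x).le_opNorm _).trans ?_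
    simpa using hC x
  have e : ∀ (z : XX d → Euc d) x, fderiv ℝ φ x ((0:ℝ), z x) = ∑ i, ψ i x * z x i := by
    intro z x
    have : ((0:ℝ), z x) = ∑ i, z x i • ((0:ℝ), EuclideanSpace.single i (1:ℝ)) := by
      conv_lhs => rw [euc_sum (z x)]
      ext1
      · simp [Prod.fst_sum]
      · simp [Prod.snd_sum]
    rw [this, map_sum]
    refine Finset.sum_congr rfl fun i _ => ?_
    rw [map_smul, smul_eq_mul, mul_comm]
  have hi : ∀ {ν : Measure (XX d)} [IsFiniteMeasure ν] {z : XX d → Euc d}, IsDensityV m ν z →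
      Measurable z → ∀ i ∈ Finset.univ, Integrable (fun x => ψ i x * z x i) ν := by
    intro ν _ z hz hzm i _
    exact (dens_int hz hzm (cproj i)).bdd_mul (c := C) (hψ i).aestronglyMeasurable
      (Eventually.of_forall (hψC i))
  simp_rw [e]
  rw [integral_finsetSum _ (hi H hw), integral_finsetSum _ (hi H' hw')]
  refine Finset.sum_congr rfl fun i _ => ?_
  exact indep_S (H.comp hw i) ((cproj i).measurable.comp hw) (H'.comp hw' i)
    ((cproj i).measurable.comp hw') (hψ i) (hψC i)

/-- kinetic plus growth energy of `(h, V, G)` -/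
def En (δ : ℝ) (h : ℝ → ℝ) (V : ℝ → Euc d) (G : ℝ → ℝ) : ℝ≥0∞ :=
  ∫⁻ t in Ioo (0:ℝ) 1, ENNReal.ofReal (h t * ((‖V t‖ ^ 2 + δ ^ 2 * G t ^ 2) / 2))

/-- total mass -/
def Ma (h : ℝ → ℝ) : ℝ≥0∞ := ∫⁻ t in Ioo (0:ℝ) 1, ENNReal.ofReal (h t)

section Bsec
variable {R : ℝ} {h : ℝ → ℝ} {b : ℝ → Euc d} {V : ℝ → Euc d} {G : ℝ → ℝ}

lemma Good.PP_univ (g : Good R h b) : PP h b Set.univ = Ma h := by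
  have := g.PP_lint (f := fun _ => 1) measurable_const
  rw [lintegral_one] at this
  rw [this]; simp only [mul_one]; rfl

lemma Good.iV1 (g : Good R h b) (mV : Measurable V)
    (iV : IntegrableOn (fun t => h t * ‖V t‖ ^ 2) (Ioo 0 1)) :
    IntegrableOn (fun t => h t • V t) (Ioo 0 1) := by
  refine Integrable.mono' (g.h_int.add iV) (g.hc.measurable.smul mV).aestronglyMeasurable
    (Eventually.of_forall fun t => ?_)
  rw [norm_smul, Real.norm_of_nonneg (g.h0 t)]
  have := mul_le_mul_of_nonneg_left
    (show ‖V t‖ ≤ 1 + ‖V t‖ ^ 2 by nlinarith [sq_nonneg (‖V t‖ - 1)]) (g.h0 t)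
  simp only [Pi.add_apply]
  linarith

lemma Good.iG1 (g : Good R h b) (mG : Measurable G)
    (iG : IntegrableOn (fun t => h t * G t ^ 2) (Ioo 0 1)) :
    IntegrableOn (fun t => h t * G t) (Ioo 0 1) := by
  refine Integrable.mono' (g.h_int.add iG) (g.hc.measurable.mul mG).aestronglyMeasurable
    (Eventually.of_forall fun t => ?_)
  rw [norm_mul, Real.norm_of_nonneg (g.h0 t), Real.norm_eq_abs]
  have := mul_le_mul_of_nonneg_left
    (show |G t| ≤ 1 + G t ^ 2 by rw [← sq_abs]; nlinarith [sq_nonneg (|G t| - 1)]) (g.h0 t)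
  simp only [Pi.add_apply]
  linarith

lemma Good.ce_combine (g : Good R h b) (mV : Measurable V) (mG : Measurable G)
    (iV : IntegrableOn (fun t => h t * ‖V t‖ ^ 2) (Ioo 0 1))
    (iG : IntegrableOn (fun t => h t * G t ^ 2) (Ioo 0 1)) {φ : XX d → ℝ} (hφ : IsTest φ) :
    (∫ t in Ioo (0:ℝ) 1, h t • fderiv ℝ φ (t, gam h b t) ((1:ℝ), (0 : Euc d))) +
      (∫ t in Ioo (0:ℝ) 1, h t • fderiv ℝ φ (t, gam h b t) ((0:ℝ), V t)) +
      ∫ t in Ioo (0:ℝ) 1, h t • (φ (t, gam h b t) * G t) =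
    ∫ t in Ioo (0:ℝ) 1, h t * (fderiv ℝ φ (t, gam h b t) (1, V t) + φ (t, gam h b t) * G t) := by
  obtain ⟨C, hC0, hC, hC1⟩ := hφ.bounds
  have hc := hφ.1.continuous_fderiv (by simp)
  have s1 : StronglyMeasurable fun x : XX d => fderiv ℝ φ x ((1:ℝ), (0 : Euc d)) :=
    (hc.clm_apply continuous_const).stronglyMeasurable
  have m2 : Measurable fun x : XX d => fderiv ℝ φ x ((0:ℝ), V x.1) := by
    have : Measurable fun x : XX d => (fderiv ℝ φ x, ((0:ℝ), V x.1)) :=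
      hc.measurable.prodMk (measurable_const.prodMk (mV.comp measurable_fst))
    exact (isBoundedBilinearMap_apply (𝕜 := ℝ) (E := XX d) (F := ℝ)).continuous.measurable.comp this
  have m3 : Measurable fun x : XX d => φ x * G x.1 :=
    hφ.1.continuous.measurable.mul (mG.comp measurable_fst)
  have i1 : IntegrableOn (fun t => h t • fderiv ℝ φ (t, gam h b t) ((1:ℝ), (0 : Euc d))) (Ioo 0 1) := by
    refine Integrable.mono' (g.h_int.mul_const C)
      (g.hc.measurable.smul (s1.measurable.comp g.graph_meas)).aestronglyMeasurable
      (Eventually.of_forall fun t => ?_)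
    rw [norm_smul, Real.norm_of_nonneg (g.h0 t)]
    refine mul_le_mul_of_nonneg_left ?_ (g.h0 t)
    refine ((fderiv ℝ φ _).le_opNorm _).trans ?_
    simpa using hC1 _
  have i2 : IntegrableOn (fun t => h t • fderiv ℝ φ (t, gam h b t) ((0:ℝ), V t)) (Ioo 0 1) := by
    refine Integrable.mono' ((g.iV1 mV iV).norm.const_mul C)
      (g.hc.measurable.smul (m2.comp g.graph_meas)).aestronglyMeasurable
      (Eventually.of_forall fun t => ?_)
    rw [norm_smul, norm_smul, Real.norm_of_nonneg (g.h0 t)]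
    have : ‖fderiv ℝ φ (t, gam h b t) ((0:ℝ), V t)‖ ≤ C * ‖V t‖ := by
      refine ((fderiv ℝ φ _).le_opNorm _).trans ?_
      rw [Prod.norm_mk, norm_zero, max_eq_right (norm_nonneg _)]
      exact mul_le_mul_of_nonneg_right (hC1 _) (norm_nonneg _)
    have := mul_le_mul_of_nonneg_left this (g.h0 t)
    linarith
  have i3 : IntegrableOn (fun t => h t • (φ (t, gam h b t) * G t)) (Ioo 0 1) := by
    refine Integrable.mono' ((g.iG1 mG iG).norm.const_mul C)
      (g.hc.measurable.smul (m3.comp g.graph_meas)).aestronglyMeasurable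
      (Eventually.of_forall fun t => ?_)
    rw [norm_smul, norm_mul, norm_mul, Real.norm_of_nonneg (g.h0 t)]
    have := mul_le_mul_of_nonneg_right (hC (t, gam h b t))
      (mul_nonneg (g.h0 t) (norm_nonneg (G t)))
    rw [← Real.norm_eq_abs] at this
    linarith
  refine (congrArg₂ (· + ·) (integral_add i1 i2).symm rfl).trans ?_
  refine (integral_add (i1.add i2) i3).symm.trans ?_
  refine integral_congr_ae (Eventually.of_forall fun t => ?_)
  simp only [smul_eq_mul, Pi.add_apply]
  have : ((1:ℝ), V t) = ((1:ℝ), (0 : Euc d)) + ((0:ℝ), V t) := by simp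
  rw [this, map_add]; ring

lemma fderiv_meas {φ : XX d → ℝ} (hφ : IsTest φ) {w : XX d → Euc d} (hw : Measurable w) (c : ℝ) :
    Measurable fun x : XX d => fderiv ℝ φ x (c, w x) := by
  have hc := hφ.1.continuous_fderiv (by simp)
  have : Measurable fun x : XX d => (fderiv ℝ φ x, (c, w x)) :=
    hc.measurable.prodMk (measurable_const.prodMk hw)
  exact (isBoundedBilinearMap_apply (𝕜 := ℝ) (E := XX d) (F := ℝ)).continuous.measurable.comp this

lemma Adm.ce_meas (g : Good R h b) (A : Adm h b V G) {φ : XX d → ℝ} (hφ : IsTest φ) :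
    (∫ x, fderiv ℝ φ x ((1:ℝ), (0 : Euc d)) ∂(PP h b)) +
          (∫ x, fderiv ℝ φ x ((0:ℝ), V x.1) ∂(PP h b)) + ∫ x, φ x * G x.1 ∂(PP h b) = 0 := by
  have m3 : Measurable fun x : XX d => φ x * G x.1 :=
    hφ.1.continuous.measurable.mul (A.mG.comp measurable_fst)
  rw [g.PP_int (fderiv_meas hφ measurable_const 1).stronglyMeasurable,
    g.PP_int (fderiv_meas hφ (w := fun x => V x.1) (A.mV.comp measurable_fst) 0).stronglyMeasurable,
    g.PP_int m3.stronglyMeasurable]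
  exact (g.ce_combine A.mV A.mG A.iV A.iG hφ).trans (A.ce g hφ)

lemma Adm.JMeas_le (g : Good R h b) (A : Adm h b V G) (α β δ : ℝ) :
    ∃ (m : VectorMeasure (XX d) (Euc d)) (μ : SignedMeasure (XX d)),
      JMeas α β δ (PP h b) m μ ≤ ENNReal.ofReal β * En δ h V G + ENNReal.ofReal α * Ma h := by
  have hf := g.PP_finite
  have mw : Measurable fun x : XX d => V x.1 := A.mV.comp measurable_fst
  have mu : Measurable fun x : XX d => G x.1 := A.mG.comp measurable_fst
  have iw : Integrable (fun x : XX d => V x.1) (PP h b) :=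
    (g.PP_integrable mw.stronglyMeasurable).2 (g.iV1 A.mV A.iV)
  have iu : Integrable (fun x : XX d => G x.1) (PP h b) :=
    (g.PP_integrable mu.stronglyMeasurable).2 (g.iG1 A.mG A.iG)
  let m := (PP h b).withDensityᵥ (fun x : XX d => V x.1)
  let μ := (PP h b).withDensityᵥ (fun x : XX d => G x.1)
  have dm : IsDensityV m (PP h b) (fun x => V x.1) := fun s hs => withDensityᵥ_apply iw hs
  have dμ : IsDensityS μ (PP h b) (fun x => G x.1) := fun s hs => withDensityᵥ_apply iu hs
  have hCE : SolvesCEMeas (PP h b) m μ := by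
    intro lam hlam w u hw hu hdw hdu φ hφ
    obtain ⟨C, hC0, hC, hC1⟩ := hφ.bounds
    rw [indep_V hdw hw dm mw hφ, indep_S hdu hu dμ mu hφ.1.continuous.measurable hC]
    exact A.ce_meas g hφ
  refine ⟨m, μ, ?_⟩
  rw [JMeas, if_pos hCE, g.PP_univ]
  gcongr
  refine sInf_le ⟨PP h b, hf, fun _ => 1, fun x => V x.1, fun x => G x.1, measurable_const, mw, mu,
    fun _ => zero_le_one, fun s hs => by simp, dm, dμ, ?_⟩
  simp only [Psi, zero_lt_one, if_true]
  rw [g.PP_lint (f := fun x => ENNReal.ofReal ((‖V x.1‖ ^ 2 + δ ^ 2 * G x.1 ^ 2) / (2 * 1)))]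
  · refine lintegral_congr fun t => ?_
    rw [← ENNReal.ofReal_mul (g.h0 t), mul_one]
  · exact ((((mw.norm.pow_const 2).add ((mu.pow_const 2).const_mul _))).div_const _).ennreal_ofReal

end Bsec

lemma FF_le {V : Set (Euc d)} {R : ℝ} (hR : 0 ≤ R) (hV : ∀ x ∈ V, ‖x‖ ≤ R)
    (η : SCurve V) {v : ℝ → Euc d} {G : ℝ → ℝ} (A : Adm (hh η) (bb η) v G) (α β δ : ℝ) :
    FF α β δ η ≤ ENNReal.ofReal β * En δ (hh η) v G + ENNReal.ofReal α * Ma (hh η) := by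
  obtain ⟨m, μ, h⟩ := A.JMeas_le (scurve_good hR hV η) α β δ
  refine le_trans (sInf_le ⟨_, m, μ, ?_, rfl⟩) h
  rw [curveMeasure_iff hR hV]

section Asec
variable {R : ℝ} {h : ℝ → ℝ} {b : ℝ → Euc d} {V : ℝ → Euc d} {G : ℝ → ℝ}

/-- testing with product test functions -/
lemma prod_test (hR : 0 ≤ R) {p : ℝ → ℝ} (hp : ContDiff ℝ (⊤ : ℕ∞) p) (hpc : HasCompactSupport p)
    (hps : tsupport p ⊆ Ioo 0 1) {ℓ : Euc d → ℝ} (hℓ : ContDiff ℝ (⊤ : ℕ∞) ℓ) :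
    ∃ φ : XX d → ℝ, IsTest φ ∧ ∀ t x, ‖x‖ ≤ R → φ (t, x) = p t * ℓ x ∧
      ∀ v, fderiv ℝ φ (t, x) (1, v) = deriv p t * ℓ x + p t * fderiv ℝ ℓ x v := by
  let χ : ContDiffBump (0 : Euc d) := ⟨R + 1, R + 2, by linarith, by linarith⟩
  have h1 : ContDiff ℝ (⊤ : ℕ∞) fun x : XX d => p x.1 * (χ x.2 * ℓ x.2) :=
    (hp.comp contDiff_fst).mul ((χ.contDiff.comp contDiff_snd).mul (hℓ.comp contDiff_snd))
  have hsub : Function.support (fun x : XX d => p x.1 * (χ x.2 * ℓ x.2)) ⊆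
      tsupport p ×ˢ tsupport χ := by
    intro x hx
    rw [Function.mem_support] at hx
    have hp0 : p x.1 ≠ 0 := left_ne_zero_of_mul hx
    have hχ0 : χ x.2 ≠ 0 := left_ne_zero_of_mul (right_ne_zero_of_mul hx)
    exact ⟨subset_tsupport _ hp0, subset_tsupport _ hχ0⟩
  have hK : IsCompact (tsupport p ×ˢ tsupport χ) := hpc.isCompact.prod χ.hasCompactSupport.isCompact
  have hts := closure_minimal hsub hK.isClosed
  refine ⟨fun x => p x.1 * (χ x.2 * ℓ x.2), ⟨h1, HasCompactSupport.intro hK fun x hx => ?_, ?_⟩, ?_⟩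
  · by_contra h0
    exact hx (hsub h0)
  · intro x hx
    exact ⟨hps (hts hx).1, trivial⟩
  · intro t x hx
    have hone : ∀ᶠ y in 𝓝 (t, x), χ y.2 = 1 := by
      have : ∀ᶠ y in 𝓝 x, χ y = 1 := by
        have hm : Metric.ball (0 : Euc d) (R + 1) ∈ 𝓝 x :=
          Metric.isOpen_ball.mem_nhds (by simpa using by linarith)
        filter_upwards [hm] with y hy
        exact χ.one_of_mem_closedBall (Metric.ball_subset_closedBall hy)
      exact (continuous_snd.tendsto (t, x)).eventually this
    have hev : (fun y : XX d => p y.1 * (χ y.2 * ℓ y.2)) =ᶠ[𝓝 (t, x)] fun y => p y.1 * ℓ y.2 := by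
      filter_upwards [hone] with y hy
      rw [hy, one_mul]
    refine ⟨hev.eq_of_nhds, fun v => ?_⟩
    rw [hev.fderiv_eq]
    have d1 : HasFDerivAt (fun y : XX d => p y.1)
        ((fderiv ℝ p t).comp (ContinuousLinearMap.fst ℝ ℝ (Euc d))) (t, x) :=
      HasFDerivAt.comp (t, x) (g := p) (hp.differentiable (by simp) t).hasFDerivAt hasFDerivAt_fst
    have d2 : HasFDerivAt (fun y : XX d => ℓ y.2)
        ((fderiv ℝ ℓ x).comp (ContinuousLinearMap.snd ℝ ℝ (Euc d))) (t, x) :=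
      HasFDerivAt.comp (t, x) (g := ℓ) (hℓ.differentiable (by simp) x).hasFDerivAt hasFDerivAt_snd
    have d3 := d1.mul d2
    have d4 : fderiv ℝ (fun y : XX d => p y.1 * ℓ y.2) (t, x) = _ := d3.fderiv
    rw [d4]
    simp
    ring

lemma isInt_of_ce (g : Good R h b)
    (H : ∀ φ : XX d → ℝ, IsTest φ → ∫ t in Ioo (0:ℝ) 1,
      h t * (fderiv ℝ φ (t, gam h b t) (1, V t) + φ (t, gam h b t) * G t) = 0)
    {ℓ : Euc d → ℝ} (hℓ : ContDiff ℝ (⊤ : ℕ∞) ℓ) {f k : ℝ → ℝ} (hf : Continuous f)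
    (ef : ∀ t, f t = h t * ℓ (gam h b t))
    (ek : ∀ t, k t = h t * (fderiv ℝ ℓ (gam h b t) (V t) + ℓ (gam h b t) * G t))
    (hk : IntegrableOn k (Ioo 0 1)) : IsInt f k := by
  refine dbr hf.continuousOn hk fun p hp hpc hps => ?_
  obtain ⟨φ, hφ, hφ2⟩ := prod_test g.R0 hp hpc hps hℓ
  refine Eq.trans ?_ (H φ hφ)
  refine integral_congr_ae (Eventually.of_forall fun t => ?_)
  obtain ⟨e1, e2⟩ := hφ2 t (gam h b t) (g.gam_le t)
  beta_reduce
  rw [e1, e2, ef, ek]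
  ring

lemma adm_of_ce (g : Good R h b) (mV : Measurable V) (mG : Measurable G)
    (iV : IntegrableOn (fun t => h t * ‖V t‖ ^ 2) (Ioo 0 1))
    (iG : IntegrableOn (fun t => h t * G t ^ 2) (Ioo 0 1))
    (H : ∀ φ : XX d → ℝ, IsTest φ → ∫ t in Ioo (0:ℝ) 1,
      h t * (fderiv ℝ φ (t, gam h b t) (1, V t) + φ (t, gam h b t) * G t) = 0) :
    Adm h b V G := by
  refine ⟨mV, mG, iV, iG, ?_, ?_⟩
  · refine isInt_of_ce g H (ℓ := fun _ => 1) contDiff_const g.hc (fun t => by simp)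
      (fun t => by simp) (g.iG1 mG iG)
  · refine isInt_euc fun i => ?_
    have hint : IntegrableOn (fun t => h t • (V t + G t • gam h b t)) (Ioo 0 1) := by
      have h2 : IntegrableOn (fun t => (h t * G t) • gam h b t) (Ioo 0 1) :=
        by
        refine Integrable.mono' ((g.iG1 mG iG).norm.const_mul R)
          ((g.hc.measurable.mul mG).smul g.gam_meas).aestronglyMeasurable
          (Eventually.of_forall fun t => ?_)
        rw [norm_smul, mul_comm]
        exact mul_le_mul_of_nonneg_right (g.gam_le t) (norm_nonneg _)
      refine ((g.iV1 mV iV).add h2).congr (Eventually.of_forall fun t => ?_)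
      simp only [Pi.add_apply]
      module
    refine isInt_of_ce g H (ℓ := fun x => x i) (cproj i).contDiff
      ((cproj i).continuous.comp g.bc) (fun t => ?_) (fun t => ?_) ((cproj i).integrable_comp hint)
    · rw [g.b_eq t]; simp
    · have : fderiv ℝ (fun x : Euc d => x i) (gam h b t) = cproj i := (cproj i).fderiv
      rw [this]; simp; ring

lemma psi_eq {δ r : ℝ} (hr : 0 ≤ r) {w : Euc d} {u : ℝ} (hfin : Psi δ r w u < ⊤) :
    w = r • (r⁻¹ • w) ∧ u = r * (r⁻¹ * u) ∧ Psi δ r w u =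
      ENNReal.ofReal r * ENNReal.ofReal ((‖r⁻¹ • w‖ ^ 2 + δ ^ 2 * (r⁻¹ * u) ^ 2) / 2) := by
  rcases eq_or_lt_of_le hr with h0 | h0
  · subst h0
    have : w = 0 ∧ u = 0 := by
      by_contra hc
      simp [Psi, hc] at hfin
    obtain ⟨rfl, rfl⟩ := this
    simp [Psi]
  · refine ⟨by rw [smul_smul, mul_inv_cancel₀ h0.ne', one_smul], by field_simp, ?_⟩
    rw [Psi, if_pos h0, ← ENNReal.ofReal_mul hr]
    congr 1
    rw [norm_smul, norm_inv, Real.norm_of_nonneg hr]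
    field_simp

lemma adm_of_J (g : Good R h b) {δ : ℝ} (hδ : 0 < δ) {m : VectorMeasure (XX d) (Euc d)}
    {μ : SignedMeasure (XX d)} (hCE : SolvesCEMeas (PP h b) m μ) {e : ℝ≥0∞}
    (hB : BdeltaMeas δ (PP h b) m μ < e) :
    ∃ (V : ℝ → Euc d) (G : ℝ → ℝ), Adm h b V G ∧ En δ h V G ≤ e := by
  obtain ⟨c, ⟨lam, hlam, r, w, u, mr, mw, mu, r0, dr, dw, du, rfl⟩, hlt⟩ := sInf_lt_iff.1 hB
  have hfin : ∫⁻ x, Psi δ (r x) (w x) (u x) ∂lam ≠ ⊤ := (lt_of_lt_of_le hlt le_top).ne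
  have hP : PP h b = lam.withDensity fun x => ENNReal.ofReal (r x) := by
    ext s hs
    rw [dr s hs, withDensity_apply _ hs]
  have mPsi : Measurable fun x => Psi δ (r x) (w x) (u x) := by
    unfold Psi
    refine Measurable.ite (measurableSet_lt measurable_const mr) ?_ (Measurable.ite ?_ measurable_const
      measurable_const)
    · exact (((mw.norm.pow_const 2).add ((mu.pow_const 2).const_mul _)).div
        (mr.const_mul 2)).ennreal_ofReal
    · exact ((measurableSet_eq_fun mr measurable_const).inter
        ((measurableSet_eq_fun mw measurable_const).inter (measurableSet_eq_fun mu measurable_const)))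
  let v : XX d → Euc d := fun x => (r x)⁻¹ • w x
  let q : XX d → ℝ := fun x => (r x)⁻¹ * u x
  have mv : Measurable v := mr.inv.smul mw
  have mq : Measurable q := mr.inv.mul mu
  have hae : ∀ᵐ x ∂lam, w x = r x • v x ∧ u x = r x * q x ∧ Psi δ (r x) (w x) (u x) =
      ENNReal.ofReal (r x) * ENNReal.ofReal ((‖v x‖ ^ 2 + δ ^ 2 * q x ^ 2) / 2) := by
    filter_upwards [ae_lt_top mPsi hfin] with x hx
    exact psi_eq (r0 x) hx
  let V : ℝ → Euc d := fun t => v (t, gam h b t)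
  let G : ℝ → ℝ := fun t => q (t, gam h b t)
  have mV : Measurable V := mv.comp g.graph_meas
  have mG : Measurable G := mq.comp g.graph_meas
  have mE : Measurable fun x => ENNReal.ofReal ((‖v x‖ ^ 2 + δ ^ 2 * q x ^ 2) / 2) :=
    (((mv.norm.pow_const 2).add ((mq.pow_const 2).const_mul _)).div_const _).ennreal_ofReal
  have hEn : En δ h V G = ∫⁻ x, Psi δ (r x) (w x) (u x) ∂lam := by
    rw [lintegral_congr_ae (hae.mono fun x hx => hx.2.2)]
    have := lintegral_withDensity_eq_lintegral_mul lam mr.ennreal_ofReal mE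
    rw [← hP] at this
    refine Eq.trans ?_ this
    rw [g.PP_lint mE]
    refine lintegral_congr fun t => ?_
    rw [← ENNReal.ofReal_mul (g.h0 t)]
  have iF : IntegrableOn (fun t => h t * ((‖V t‖ ^ 2 + δ ^ 2 * G t ^ 2) / 2)) (Ioo 0 1) := by
    refine ⟨(g.hc.measurable.mul (((mV.norm.pow_const 2).add
      ((mG.pow_const 2).const_mul _)).div_const _)).aestronglyMeasurable, ?_⟩
    rw [hasFiniteIntegral_iff_ofReal]
    · change En δ h V G < ⊤
      rw [hEn]; exact hfin.lt_top
    · exact Eventually.of_forall fun t => mul_nonneg (g.h0 t) (by positivity)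
  have iV : IntegrableOn (fun t => h t * ‖V t‖ ^ 2) (Ioo 0 1) := by
    refine Integrable.mono' (iF.const_mul 2)
      (g.hc.measurable.mul (mV.norm.pow_const 2)).aestronglyMeasurable
      (Eventually.of_forall fun t => ?_)
    have h0 := g.h0 t
    rw [Real.norm_of_nonneg (by positivity)]
    have : 0 ≤ h t * (δ ^ 2 * G t ^ 2) := by positivity
    linarith
  have iG : IntegrableOn (fun t => h t * G t ^ 2) (Ioo 0 1) := by
    refine Integrable.mono' (iF.const_mul (2 / δ ^ 2))
      (g.hc.measurable.mul (mG.pow_const 2)).aestronglyMeasurable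
      (Eventually.of_forall fun t => ?_)
    have h0 := g.h0 t
    rw [Real.norm_of_nonneg (by positivity)]
    have : 0 ≤ h t * (‖V t‖ ^ 2) / δ ^ 2 := by positivity
    have e : 2 / δ ^ 2 * (h t * ((‖V t‖ ^ 2 + δ ^ 2 * G t ^ 2) / 2)) =
      h t * (‖V t‖ ^ 2) / δ ^ 2 + h t * G t ^ 2 := by field_simp
    linarith
  refine ⟨V, G, adm_of_ce g mV mG iV iG fun φ hφ => ?_, hEn.le.trans hlt.le⟩
  have := hCE lam hlam w u mw mu dw du φ hφ
  rw [← g.ce_combine mV mG iV iG hφ]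
  refine Eq.trans ?_ this
  have hconv : ∀ ψ : XX d → ℝ, Measurable ψ →
      ∫ x, r x * ψ x ∂lam = ∫ t in Ioo (0:ℝ) 1, h t • ψ (t, gam h b t) := by
    intro ψ hψ
    rw [← g.PP_int hψ.stronglyMeasurable, hP, integral_withDensity_eq_integral_toReal_smul
      mr.ennreal_ofReal (by simp)]
    simp only [ENNReal.toReal_ofReal (r0 _), smul_eq_mul]
  rw [g.PP_int (fderiv_meas hφ measurable_const 1).stronglyMeasurable]
  congr 1
  · congr 1
    rw [← hconv (fun x => fderiv ℝ φ x ((0:ℝ), v x)) (fderiv_meas hφ mv 0)]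
    refine integral_congr_ae (hae.mono fun x hx => ?_)
    beta_reduce
    conv_rhs => rw [hx.1]
    rw [show ((0:ℝ), r x • v x) = r x • ((0:ℝ), v x) by simp, map_smul, smul_eq_mul]
  · rw [← hconv (fun x => φ x * q x) (hφ.1.continuous.measurable.mul mq)]
    refine integral_congr_ae (hae.mono fun x hx => ?_)
    beta_reduce
    conv_rhs => rw [hx.2.1]
    ring

lemma Good.Ma_lt_top (g : Good R h b) : Ma h < ⊤ := g.h_int.lintegral_lt_top

end Asec

lemma exists_adm_of_FF_lt {V : Set (Euc d)} {R : ℝ} (hR : 0 ≤ R) (hV : ∀ x ∈ V, ‖x‖ ≤ R)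
    (η : SCurve V) {α β δ : ℝ} (hβ : 0 < β) (hδ : 0 < δ) {c : ℝ≥0∞} (hc : FF α β δ η < c) :
    ∃ (v : ℝ → Euc d) (G : ℝ → ℝ), Adm (hh η) (bb η) v G ∧
      ENNReal.ofReal β * En δ (hh η) v G + ENNReal.ofReal α * Ma (hh η) ≤ c := by
  have g := scurve_good hR hV η
  obtain ⟨_, ⟨P, m, μ, hP, rfl⟩, hlt⟩ := sInf_lt_iff.1 hc
  rw [curveMeasure_iff hR hV] at hP
  subst hP
  rw [JMeas] at hlt
  split_ifs at hlt with hCE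
  · rw [g.PP_univ] at hlt
    have hβ0 : ENNReal.ofReal β ≠ 0 := by simpa using hβ
    have hαM : ENNReal.ofReal α * Ma (hh η) ≠ ⊤ := ENNReal.mul_ne_top (by simp) g.Ma_lt_top.ne
    have h1 : ENNReal.ofReal β * BdeltaMeas δ (PP (hh η) (bb η)) m μ <
      c - ENNReal.ofReal α * Ma (hh η) := lt_tsub_iff_right.2 hlt
    have h2 : BdeltaMeas δ (PP (hh η) (bb η)) m μ <
        (c - ENNReal.ofReal α * Ma (hh η)) / ENNReal.ofReal β := by
      rw [ENNReal.lt_div_iff_mul_lt (Or.inl hβ0) (Or.inl (by simp)), mul_comm]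
      exact h1
    obtain ⟨v, G, A, hA⟩ := adm_of_J g hδ hCE h2
    refine ⟨v, G, A, ?_⟩
    have h3 : ENNReal.ofReal β * En δ (hh η) v G ≤ c - ENNReal.ofReal α * Ma (hh η) := by
      refine (mul_le_mul_right hA _).trans ?_
      rw [ENNReal.mul_div_cancel hβ0 (by simp)]
    refine (add_le_add_left h3 _).trans ?_
    rw [tsub_add_cancel_of_le]
    exact le_add_self.trans hlt.le
  · simp at hlt

section Dsec
variable {R : ℝ} {h : ℝ → ℝ} {b : ℝ → Euc d}

lemma IsInt.congr' {F : Type*} [NormedAddCommGroup F] [NormedSpace ℝ F] {z z' w w' : ℝ → F}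
    (H : IsInt z z') (h1 : ∀ t ∈ Icc (0:ℝ) 1, z t = w t) (h2 : ∀ᵐ t, t ∈ Ioo (0:ℝ) 1 → z' t = w' t) :
    IsInt w w' := by
  have h3 : z' =ᵐ[volume.restrict (Ioo 0 1)] w' := (ae_restrict_iff' measurableSet_Ioo).2 h2
  have h4 : IntegrableOn w' (Ioo 0 1) :=
    Integrable.congr ((intervalIntegrable_iff_integrableOn_Ioo_of_le zero_le_one).1 H.1) h3
  refine ⟨ii_of_Ioo h4, fun t ht => ?_⟩
  rw [← h1 t ht, ← h1 0 (by simp), H.2 t ht]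
  congr 1
  rw [intervalIntegral.integral_of_le ht.1, intervalIntegral.integral_of_le ht.1,
    integral_Ioc_eq_integral_Ioo, integral_Ioc_eq_integral_Ioo]
  refine integral_congr_ae (ae_restrict_of_ae_restrict_of_subset ?_ h3)
  exact Ioo_subset_Ioo le_rfl ht.2

lemma ac2_isInt {F : Type*} [NormedAddCommGroup F] [NormedSpace ℝ F] {f : ℝ → F} (hf : AC2 f) :
    ∃ f' : ℝ → F, StronglyMeasurable f' ∧ IsInt f f' ∧
      IntegrableOn (fun t => ‖f' t‖ ^ 2) (Ioo 0 1) := by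
  obtain ⟨k, hk, hk2, e⟩ := hf
  rw [integrableOn_Icc_iff_integrableOn_Ioo] at hk hk2
  have hI : IsInt f k := ⟨ii_of_Ioo hk, e⟩
  have hae := hk.1.ae_eq_mk
  refine ⟨hk.1.mk k, hk.1.stronglyMeasurable_mk, hI.congr' (fun _ _ => rfl)
    ((ae_restrict_iff' measurableSet_Ioo).1 hae), ?_⟩
  refine Integrable.congr hk2 (hae.mono fun t ht => ?_)
  beta_reduce
  rw [← ht]

lemma sqrt_cancel (g : Good R h b) (t x : ℝ) : h t * ((√(h t))⁻¹ * x) = √(h t) * x := by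
  have h0 := g.h0 t
  rcases eq_or_lt_of_le h0 with e | e
  · rw [← e]; simp
  · have : √(h t) ≠ 0 := (Real.sqrt_pos.2 e).ne'
    nth_rw 1 [← Real.mul_self_sqrt h0]
    field_simp

lemma sqrt_cancelV (g : Good R h b) (t : ℝ) (x : Euc d) :
    h t • ((√(h t))⁻¹ • x) = √(h t) • x := by
  have := sqrt_cancel g t 1
  rw [mul_one, mul_one] at this
  rw [smul_smul, this]

lemma sqrt_sq_le (g : Good R h b) (t x : ℝ) : h t * ((√(h t))⁻¹ * x) ^ 2 ≤ x ^ 2 := by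
  have h0 := g.h0 t
  rcases eq_or_lt_of_le h0 with e | e
  · rw [← e]; simp; positivity
  · refine le_of_eq ?_
    rw [mul_pow, inv_pow, Real.sq_sqrt h0]
    field_simp

lemma adm_of_xi (g : Good R h b) {x1 : ℝ → Euc d} {x2 : ℝ → ℝ} (m1 : Measurable x1)
    (m2 : Measurable x2) (i1 : IntegrableOn (fun t => ‖x1 t‖ ^ 2) (Ioo 0 1))
    (i2 : IntegrableOn (fun t => x2 t ^ 2) (Ioo 0 1))
    (eh : IsInt h fun t => √(h t) * x2 t)
    (eb : IsInt b fun t => √(h t) • x1 t + (√(h t) * x2 t) • gam h b t) :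
    ∃ (V : ℝ → Euc d) (G : ℝ → ℝ), Adm h b V G ∧ ∀ δ, En δ h V G ≤
      ∫⁻ t in Ioo (0:ℝ) 1, ENNReal.ofReal ((‖x1 t‖ ^ 2 + δ ^ 2 * x2 t ^ 2) / 2) := by
  have mh := g.hc.measurable
  have ms : Measurable fun t => (√(h t))⁻¹ := mh.sqrt.inv
  have eV : ∀ t, h t * ‖(√(h t))⁻¹ • x1 t‖ ^ 2 ≤ ‖x1 t‖ ^ 2 := fun t => by
    rw [norm_smul, norm_inv, Real.norm_of_nonneg (Real.sqrt_nonneg _)]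
    exact sqrt_sq_le g t _
  have mV : Measurable fun t => (√(h t))⁻¹ • x1 t := ms.smul m1
  have mG : Measurable fun t => (√(h t))⁻¹ * x2 t := ms.mul m2
  refine ⟨fun t => (√(h t))⁻¹ • x1 t, fun t => (√(h t))⁻¹ * x2 t,
    ⟨mV, mG, ?_, ?_, ?_, ?_⟩, fun δ => ?_⟩
  · refine Integrable.mono' i1 (mh.mul (mV.norm.pow_const 2)).aestronglyMeasurable
      (Eventually.of_forall fun t => ?_)
    rw [Real.norm_of_nonneg (mul_nonneg (g.h0 t) (by positivity))]
    exact eV t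
  · refine Integrable.mono' i2 (mh.mul (mG.pow_const 2)).aestronglyMeasurable
      (Eventually.of_forall fun t => ?_)
    rw [Real.norm_of_nonneg (mul_nonneg (g.h0 t) (by positivity))]
    exact sqrt_sq_le g t _
  · refine eh.congr' (fun _ _ => rfl) (Eventually.of_forall fun t _ => ?_)
    exact (sqrt_cancel g t _).symm
  · refine eb.congr' (fun _ _ => rfl) (Eventually.of_forall fun t _ => ?_)
    rw [smul_add, sqrt_cancelV g, smul_smul, sqrt_cancel g]
  · refine lintegral_mono fun t => ENNReal.ofReal_le_ofReal ?_
    have h1 := eV t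
    have h2 := mul_le_mul_of_nonneg_left (sqrt_sq_le g t (x2 t)) (sq_nonneg δ)
    beta_reduce
    linarith

lemma adm_of_ac2 (g : Good R h b) (h1 : AC2 fun t => √(h t))
    (h2 : AC2 fun t => √(h t) • gam h b t) : ∃ (V : ℝ → Euc d) (G : ℝ → ℝ), Adm h b V G := by
  obtain ⟨a', ma, Ia, ia⟩ := ac2_isInt h1
  obtain ⟨c', mc, Ic, ic⟩ := ac2_isInt h2
  have mg := g.gam_meas
  have hs : ∀ t, √(h t) * √(h t) = h t := fun t => Real.mul_self_sqrt (g.h0 t)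
  have dA := Ia.ae_hasDerivAt
  have dC := Ic.ae_hasDerivAt
  refine Exists.imp (fun V hV => hV.imp fun G hG => hG.1) (adm_of_xi g (x1 := fun t => c' t - a' t • gam h b t)
    (x2 := fun t => 2 * a' t) (mc.measurable.sub (ma.measurable.smul mg))
    (ma.measurable.const_mul 2) ?_ ?_ ?_ ?_)
  · refine Integrable.mono' ((ic.const_mul 2).add (ia.const_mul (2 * R ^ 2)))
      ((mc.measurable.sub (ma.measurable.smul mg)).norm.pow_const 2).aestronglyMeasurable
      (Eventually.of_forall fun t => ?_)
    rw [Real.norm_of_nonneg (by positivity)]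
    have n1 : ‖c' t - a' t • gam h b t‖ ≤ ‖c' t‖ + ‖a' t‖ * R := by
      refine (norm_sub_le _ _).trans ?_
      rw [norm_smul]
      have := g.gam_le t
      gcongr
    have n2 := pow_le_pow_left₀ (norm_nonneg _) n1 2
    refine n2.trans ?_
    simp only [Pi.add_apply]
    nlinarith [sq_nonneg (‖c' t‖ - ‖a' t‖ * R)]
  · refine (ia.const_mul 4).congr (Eventually.of_forall fun t => ?_)
    simp only [Real.norm_eq_abs, sq_abs]
    ring
  · have := Ia.chain (Φ := fun x => x ^ 2) (k := fun t => √(h t) * (2 * a' t))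
      (fun t _ => contDiffAt_id.pow 2) ?_
    · exact this.congr' (fun t _ => Real.sq_sqrt (g.h0 t)) (Eventually.of_forall fun t _ => rfl)
    · filter_upwards [dA] with t ht hI
      refine ((ht hI).pow 2).congr_deriv ?_
      simp; ring
  · have hp := Ia.prodMk Ic
    have := hp.chainE (Φ := fun x => x.1 • x.2)
      (k := fun t => √(h t) • (c' t - a' t • gam h b t) + (√(h t) * (2 * a' t)) • gam h b t)
      (fun t _ => (contDiff_fst.smul contDiff_snd).contDiffAt) ?_
    · refine this.congr' (fun t _ => ?_) (Eventually.of_forall fun t _ => rfl)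
      rw [smul_smul, hs, ← g.b_eq]
    · filter_upwards [dA, dC] with t ht ht2 hI
      refine ((ht hI).smul (ht2 hI)).congr_deriv ?_
      module

lemma rep_sqrt {V : Set (Euc d)} {η : SCurve V} {γ : ℝ → Euc d} {h : ℝ → ℝ}
    (r : Represents η γ h) {t : ℝ} (ht : t ∈ Icc (0:ℝ) 1) :
    √(h t) • γ t = √(hh η t) • gam (hh η) (bb η) t := by
  rw [r.hh_eq ht]
  by_cases h0 : h t = 0
  · simp [h0]
  · rw [r.gam_eq ht h0]

lemma AC2.congr' {F : Type*} [NormedAddCommGroup F] [NormedSpace ℝ F] {f k : ℝ → F} (hf : AC2 f)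
    (e : ∀ t ∈ Icc (0:ℝ) 1, f t = k t) : AC2 k := by
  obtain ⟨f', h1, h2, h3⟩ := hf
  refine ⟨f', h1, h2, fun t ht => ?_⟩
  rw [← e t ht, ← e 0 (by simp), h3 t ht]

lemma adm_of_rep {V : Set (Euc d)} {R : ℝ} (hR : 0 ≤ R) (hV : ∀ x ∈ V, ‖x‖ ≤ R)
    {η : SCurve V} {γ : ℝ → Euc d} {h : ℝ → ℝ} (r : Represents η γ h)
    (h1 : AC2 fun t => √(h t)) (h2 : AC2 fun t => √(h t) • γ t) :
    ∃ (v : ℝ → Euc d) (G : ℝ → ℝ), Adm (hh η) (bb η) v G :=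
  adm_of_ac2 (scurve_good hR hV η) (h1.congr' fun t ht => by rw [r.hh_eq ht])
    (h2.congr' fun t ht => rep_sqrt r ht)

lemma Adm.En_lt_top {V : ℝ → Euc d} {G : ℝ → ℝ} (A : Adm h b V G) (δ : ℝ) :
    En δ h V G < ⊤ := by
  have : IntegrableOn (fun t => h t * ((‖V t‖ ^ 2 + δ ^ 2 * G t ^ 2) / 2)) (Ioo 0 1) := by
    refine ((A.iV.add (A.iG.const_mul (δ ^ 2))).div_const 2).congr (Eventually.of_forall fun t => ?_)
    simp only [Pi.add_apply]; ring
  exact this.lintegral_lt_top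

lemma FF_domain {V : Set (Euc d)} (hV : IsClosureOfBoundedDomain V)
    {α β δ : ℝ} (hβ : 0 < β) (hδ : 0 < δ) (η : SCurve V) : FF α β δ η ≠ ⊤ ↔ MemH V η := by
  obtain ⟨⟨x0, hx0⟩, -, R, hR, hVR⟩ := closure_bdd hV
  have g := scurve_good hR hVR η
  constructor
  · intro hF
    obtain ⟨v, G, A, -⟩ := exists_adm_of_FF_lt hR hVR η hβ hδ hF.lt_top
    obtain ⟨a1, a2, a3⟩ := A.ac2 g
    classical
    refine ⟨fun t => if hh η t = 0 then x0 else gam (hh η) (bb η) t, hh η, ?_, a1, a2, ?_⟩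
    · intro t _
      refine ⟨hh_nonneg η t, ?_, ?_⟩
      · beta_reduce
        split_ifs with h0
        · exact hx0
        · exact gam_mem η h0
      · rw [scurve_eq]
        beta_reduce
        split_ifs with h0
        · simp [h0]
        · rfl
    · refine a3.congr' fun t _ => ?_
      beta_reduce
      split_ifs with h0
      · simp [h0]
      · rfl
  · rintro ⟨γ, h, r, -, h1, h2⟩
    obtain ⟨v, G, A⟩ := adm_of_rep hR hVR r h1 h2
    refine ne_top_of_le_ne_top ?_ (FF_le hR hVR η A α β δ)
    exact ENNReal.add_ne_top.2 ⟨ENNReal.mul_ne_top (by simp) (A.En_lt_top δ).ne,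
      ENNReal.mul_ne_top (by simp) g.Ma_lt_top.ne⟩

lemma Adm.formula {V : Set (Euc d)} (hR : 0 ≤ R) (hV : ∀ x ∈ V, ‖x‖ ≤ R)
    {η : SCurve V} {γ : ℝ → Euc d} {h : ℝ → ℝ} (r : Represents η γ h)
    {γ' : ℝ → Euc d} {h' : ℝ → ℝ} (D : HasAEDerivs γ h γ' h') {v : ℝ → Euc d} {G : ℝ → ℝ}
    (A : Adm (hh η) (bb η) v G) {α β : ℝ} (hα : 0 < α) (hβ : 0 < β) (δ : ℝ) :
    ENNReal.ofReal β * En δ (hh η) v G + ENNReal.ofReal α * Ma (hh η) =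
      ∫⁻ t in {t | t ∈ Ioo (0:ℝ) 1 ∧ 0 < h t},
        ENNReal.ofReal (β / 2 * ‖γ' t‖ ^ 2 * h t
          + β * δ ^ 2 / 2 * h' t ^ 2 / h t + α * h t) := by
  have g := scurve_good hR hV η
  have mh := g.hc.measurable
  have hS : {t | t ∈ Ioo (0:ℝ) 1 ∧ 0 < h t} = {t | 0 < hh η t} ∩ Ioo (0:ℝ) 1 := by
    ext t
    constructor
    · rintro ⟨h1, h2⟩
      exact ⟨by rw [mem_ofPred_eq, r.hh_eq (Ioo_subset_Icc_self h1)]; exact h2, h1⟩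
    · rintro ⟨h1, h2⟩
      rw [mem_ofPred_eq, r.hh_eq (Ioo_subset_Icc_self h2)] at h1
      exact ⟨h2, h1⟩
  have mP : MeasurableSet {t | 0 < hh η t} := measurableSet_lt measurable_const mh
  have mS : MeasurableSet {t | t ∈ Ioo (0:ℝ) 1 ∧ 0 < h t} := by
    rw [hS]; exact mP.inter measurableSet_Ioo
  obtain ⟨D1, D2⟩ := D
  rw [ae_restrict_iff' measurableSet_Ioo] at D1
  rw [ae_restrict_iff' mS] at D2
  have key : ∀ᵐ t, t ∈ {t | t ∈ Ioo (0:ℝ) 1 ∧ 0 < h t} →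
      ENNReal.ofReal (β / 2 * ‖γ' t‖ ^ 2 * h t
          + β * δ ^ 2 / 2 * h' t ^ 2 / h t + α * h t) =
      ENNReal.ofReal (β * (hh η t * ((‖v t‖ ^ 2 + δ ^ 2 * G t ^ 2) / 2)) + α * hh η t) := by
    filter_upwards [D1, D2, A.eh.ae_hasDerivAt, A.eb.ae_hasDerivAt] with t d1 d2 d3 d4 ht
    have htI := ht.1
    have hpos := ht.2
    have hev : ∀ᶠ s in 𝓝 t, s ∈ Ioo (0:ℝ) 1 := Ioo_mem_nhds htI.1 htI.2
    have e1 : h =ᶠ[𝓝 t] hh η := by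
      filter_upwards [hev] with s hs
      rw [r.hh_eq (Ioo_subset_Icc_self hs)]
    have e2 : (fun s => h s • γ s) =ᶠ[𝓝 t] bb η := by
      filter_upwards [hev] with s hs
      rw [r.bb_eq (Ioo_subset_Icc_self hs)]
    have eh : h' t = hh η t * G t := (d1 htI).unique ((d3 htI).congr_of_eventuallyEq e1)
    have eb := ((d1 htI).smul (d2 ht)).unique ((d4 htI).congr_of_eventuallyEq e2)
    have ht' := r.hh_eq (Ioo_subset_Icc_self htI)
    rw [r.gam_eq (Ioo_subset_Icc_self htI) hpos.ne', eh, ht'] at eb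
    have ev : γ' t = v t := by
      have : h t • γ' t = h t • v t := by
        have e3 : h t • (v t + G t • γ t) = h t • v t + (h t * G t) • γ t := by module
        rw [e3] at eb
        exact add_right_cancel eb
      exact smul_right_injective _ hpos.ne' this
    rw [ev, eh, ht']
    congr 1
    field_simp
  rw [setLIntegral_congr_fun_ae mS key, hS, ← Measure.restrict_restrict mP,
    ← lintegral_indicator mP]
  unfold En Ma
  rw [← lintegral_const_mul _ mh.ennreal_ofReal, ← lintegral_const_mul, ← lintegral_add_right]
  · refine lintegral_congr fun t => ?_
    have h0 := g.h0 t
    by_cases hp : 0 < hh η t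
    · rw [indicator_of_mem (by exact hp), ENNReal.ofReal_add (by positivity) (by positivity),
        ENNReal.ofReal_mul hβ.le, ENNReal.ofReal_mul hα.le]
    · rw [indicator_of_notMem (by exact hp)]
      have : hh η t = 0 := le_antisymm (not_lt.1 hp) h0
      simp [this]
  · exact mh.ennreal_ofReal.const_mul _
  · exact (mh.mul (((A.mV.norm.pow_const 2).add
        ((A.mG.pow_const 2).const_mul _)).div_const _)).ennreal_ofReal

lemma FF_formula {V : Set (Euc d)} (hV : IsClosureOfBoundedDomain V)
    {α β δ : ℝ} (hα : 0 < α) (hβ : 0 < β) (hδ : 0 < δ) (η : SCurve V) (γ : ℝ → Euc d)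
    (h : ℝ → ℝ) (γ' : ℝ → Euc d) (h' : ℝ → ℝ) (r : Represents η γ h)
    (h1 : AC2 fun t => √(h t)) (h2 : AC2 fun t => √(h t) • γ t) (D : HasAEDerivs γ h γ' h') :
    FF α β δ η = ∫⁻ t in {t | t ∈ Ioo (0:ℝ) 1 ∧ 0 < h t},
        ENNReal.ofReal (β / 2 * ‖γ' t‖ ^ 2 * h t
          + β * δ ^ 2 / 2 * h' t ^ 2 / h t + α * h t) := by
  obtain ⟨-, -, R, hR, hVR⟩ := closure_bdd hV
  apply le_antisymm
  · obtain ⟨v, G, A⟩ := adm_of_rep hR hVR r h1 h2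
    rw [← A.formula hR hVR r D hα hβ δ]
    exact FF_le hR hVR η A α β δ
  · refine le_of_forall_gt fun c hc => ?_
    obtain ⟨c', hc1, hc2⟩ := exists_between hc
    obtain ⟨v, G, A, hA⟩ := exists_adm_of_FF_lt hR hVR η hβ hδ hc1
    rw [A.formula hR hVR r D hα hβ δ] at hA
    exact hA.trans_lt hc2

end Dsec

section Weak

lemma weak_compact {H : Type*} [NormedAddCommGroup H] [InnerProductSpace ℝ H] [CompleteSpace H]
    {x : ℕ → H} {r : ℝ} (hx : ∀ n, ‖x n‖ ≤ r) (U : Ultrafilter ℕ) :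
    ∃ x0 : H, ‖x0‖ ≤ r ∧ ∀ y : H, Tendsto (fun n => inner ℝ (x n) y) U (𝓝 (inner ℝ x0 y)) := by
  have hc := WeakDual.isCompact_closedBall (𝕜 := ℝ) (E := H) 0 r
  let f : ℕ → WeakDual ℝ H := fun n => StrongDual.toWeakDual (InnerProductSpace.toDual ℝ H (x n))
  obtain ⟨L, hL, hle⟩ := hc.ultrafilter_le_nhds (U.map f) (by
    rw [Ultrafilter.coe_map, le_principal_iff, mem_map]
    refine Eventually.of_forall fun n => ?_
    rw [mem_preimage, mem_closedBall_zero_iff]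
    change ‖InnerProductSpace.toDual ℝ H (x n)‖ ≤ r
    rw [LinearIsometryEquiv.norm_map]
    exact hx n)
  refine ⟨(InnerProductSpace.toDual ℝ H).symm (WeakDual.toStrongDual L), ?_, fun y => ?_⟩
  · rw [LinearIsometryEquiv.norm_map]
    exact mem_closedBall_zero_iff.1 hL
  · rw [InnerProductSpace.toDual_symm_apply]
    have h1 : Tendsto (fun l : WeakDual ℝ H => l y) (𝓝 L) (𝓝 (L y)) :=
      (WeakDual.eval_continuous y).tendsto L
    exact h1.comp hle

lemma weak_strong {H : Type*} [NormedAddCommGroup H] [InnerProductSpace ℝ H]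
    {x : ℕ → H} {r : ℝ} (hx : ∀ n, ‖x n‖ ≤ r) {U : Filter ℕ} {x0 : H}
    (h : ∀ y : H, Tendsto (fun n => inner ℝ (x n) y) U (𝓝 (inner ℝ x0 y)))
    {y : ℕ → H} {y0 : H} (hy : Tendsto y U (𝓝 y0)) :
    Tendsto (fun n => inner ℝ (x n) (y n)) U (𝓝 (inner ℝ x0 y0)) := by
  have h1 : Tendsto (fun n => inner ℝ (x n) (y n - y0)) U (𝓝 0) := by
    have h2 : Tendsto (fun n => r * ‖y n - y0‖) U (𝓝 0) := by
      have := (tendsto_iff_norm_sub_tendsto_zero.1 hy).const_mul r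
      rwa [mul_zero] at this
    refine squeeze_zero_norm (fun n => ?_) h2
    exact (norm_inner_le_norm _ _).trans (mul_le_mul_of_nonneg_right (hx n) (norm_nonneg _))
  have := h1.add (h y0)
  rw [zero_add] at this
  refine this.congr fun n => ?_
  rw [← inner_add_right, sub_add_cancel]

variable {X : Type*} [MeasurableSpace X] {ν : Measure X}
  {E : Type*} [NormedAddCommGroup E] [InnerProductSpace ℝ E]

lemma toLp_inner {f k : X → E} (hf : MemLp f 2 ν) (hk : MemLp k 2 ν) :
    inner ℝ (hf.toLp f) (hk.toLp k) = ∫ a, inner ℝ (f a) (k a) ∂ν := by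
  rw [L2.inner_def]
  refine integral_congr_ae ?_
  filter_upwards [hf.coeFn_toLp, hk.coeFn_toLp] with a h1 h2
  rw [h1, h2]

lemma toLp_norm_sq {f : X → E} (hf : MemLp f 2 ν) :
    ‖hf.toLp f‖ ^ 2 = ∫ a, ‖f a‖ ^ 2 ∂ν := by
  rw [← real_inner_self_eq_norm_sq, toLp_inner]
  simp only [real_inner_self_eq_norm_sq]

lemma toLp_tendsto [IsFiniteMeasure ν] {f : ℕ → X → E} {f0 : X → E} {K : ℝ}
    (hf : ∀ n, MemLp (f n) 2 ν) (hf0 : MemLp f0 2 ν) (hK : ∀ n, ∀ᵐ a ∂ν, ‖f n a‖ ≤ K)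
    (hl : ∀ᵐ a ∂ν, Tendsto (fun n => f n a) atTop (𝓝 (f0 a))) :
    Tendsto (fun n => (hf n).toLp (f n)) atTop (𝓝 (hf0.toLp f0)) := by
  rw [tendsto_iff_norm_sub_tendsto_zero]
  have h1 : Tendsto (fun n => ∫ a, ‖f n a - f0 a‖ ^ 2 ∂ν) atTop (𝓝 (∫ _, (0:ℝ) ∂ν)) := by
    refine tendsto_integral_of_dominated_convergence (fun _ => (2 * K) ^ 2) (fun n => ?_)
      (integrable_const _) (fun n => ?_) ?_
    · exact (((hf n).1.sub hf0.1).norm.pow 2)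
    · have hall : ∀ᵐ a ∂ν, ∀ n, ‖f n a‖ ≤ K := ae_all_iff.2 hK
      filter_upwards [hall, hl] with a h1 h2
      rw [Real.norm_of_nonneg (by positivity)]
      have h3 : ‖f0 a‖ ≤ K := le_of_tendsto h2.norm (Eventually.of_forall h1)
      refine pow_le_pow_left₀ (norm_nonneg _) ?_ 2
      refine (norm_sub_le _ _).trans ?_
      linarith [h1 n]
    · filter_upwards [hl] with a h2
      have := (tendsto_iff_norm_sub_tendsto_zero.1 h2).pow 2
      simpa using this
  rw [integral_zero] at h1
  have h2 : ∀ n, ‖(hf n).toLp (f n) - hf0.toLp f0‖ = √(∫ a, ‖f n a - f0 a‖ ^ 2 ∂ν) := by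
    intro n
    rw [← MemLp.toLp_sub, ← Real.sqrt_sq (norm_nonneg (MemLp.toLp _ _)), toLp_norm_sq]
    rfl
  simp only [h2]
  simpa using h1.sqrt

lemma L2_weak [CompleteSpace E] [IsFiniteMeasure ν] {x1 : ℕ → X → E} {x2 : ℕ → X → ℝ} {C : ℝ}
    (m1 : ∀ n, MemLp (x1 n) 2 ν) (m2 : ∀ n, MemLp (x2 n) 2 ν)
    (hC : ∀ n, ∫ a, ‖x1 n a‖ ^ 2 ∂ν + ∫ a, x2 n a ^ 2 ∂ν ≤ C) :
    ∃ (X1 : X → E) (X2 : X → ℝ), StronglyMeasurable X1 ∧ StronglyMeasurable X2 ∧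
      MemLp X1 2 ν ∧ MemLp X2 2 ν ∧ ∫ a, ‖X1 a‖ ^ 2 ∂ν + ∫ a, X2 a ^ 2 ∂ν ≤ C ∧
      (∀ (y : ℕ → X → E) (y0 : X → E) (K : ℝ), (∀ n, AEStronglyMeasurable (y n) ν) →
        AEStronglyMeasurable y0 ν → (∀ n, ∀ᵐ a ∂ν, ‖y n a‖ ≤ K) →
        (∀ᵐ a ∂ν, Tendsto (fun n => y n a) atTop (𝓝 (y0 a))) →
        Tendsto (fun n => ∫ a, inner ℝ (x1 n a) (y n a) ∂ν) (hyperfilter ℕ)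
          (𝓝 (∫ a, inner ℝ (X1 a) (y0 a) ∂ν))) ∧
      (∀ (y : ℕ → X → ℝ) (y0 : X → ℝ) (K : ℝ), (∀ n, AEStronglyMeasurable (y n) ν) →
        AEStronglyMeasurable y0 ν → (∀ n, ∀ᵐ a ∂ν, ‖y n a‖ ≤ K) →
        (∀ᵐ a ∂ν, Tendsto (fun n => y n a) atTop (𝓝 (y0 a))) →
        Tendsto (fun n => ∫ a, x2 n a * y n a ∂ν) (hyperfilter ℕ)
          (𝓝 (∫ a, X2 a * y0 a ∂ν))) := by
  let z : ℕ → WithLp 2 (Lp E 2 ν × Lp ℝ 2 ν) := fun n =>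
    WithLp.toLp 2 ((m1 n).toLp (x1 n), (m2 n).toLp (x2 n))
  have hC0 : 0 ≤ C := le_trans (by positivity) (hC 0)
  have hz : ∀ n, ‖z n‖ ≤ √C := by
    intro n
    refine Real.le_sqrt_of_sq_le ?_
    rw [WithLp.prod_norm_sq_eq_of_L2]
    change ‖(m1 n).toLp (x1 n)‖ ^ 2 + ‖(m2 n).toLp (x2 n)‖ ^ 2 ≤ C
    rw [toLp_norm_sq, toLp_norm_sq]
    simpa using hC n
  obtain ⟨w, hw, hlim⟩ := weak_compact hz (hyperfilter ℕ)
  have hf1 : (Lp.memLp w.fst).toLp w.fst = w.fst := Lp.toLp_coeFn _ _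
  have hf2 : (Lp.memLp w.snd).toLp w.snd = w.snd := Lp.toLp_coeFn _ _
  have hU : (hyperfilter ℕ : Filter ℕ) ≤ atTop := Nat.hyperfilter_le_atTop
  refine ⟨w.fst, w.snd, Lp.stronglyMeasurable _, Lp.stronglyMeasurable _, Lp.memLp _, Lp.memLp _,
    ?_, ?_, ?_⟩
  · have h1 := toLp_norm_sq (Lp.memLp w.fst)
    have h2 := toLp_norm_sq (Lp.memLp w.snd)
    simp only [Real.norm_eq_abs, sq_abs] at h2
    rw [hf1] at h1
    rw [hf2] at h2
    rw [← h1, ← h2, ← WithLp.prod_norm_sq_eq_of_L2]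
    have := pow_le_pow_left₀ (norm_nonneg _) hw 2
    rwa [Real.sq_sqrt hC0] at this
  · intro y y0 K my my0 hK hl
    have M : ∀ n, MemLp (y n) 2 ν := fun n => MemLp.of_bound (my n) K (hK n)
    have M0 : MemLp y0 2 ν := by
      refine MemLp.of_bound my0 K ?_
      filter_upwards [ae_all_iff.2 hK, hl] with a h1 h2
      exact le_of_tendsto h2.norm (Eventually.of_forall h1)
    have ht := (toLp_tendsto M M0 hK hl).mono_left hU
    have ht2 : Tendsto (fun n => WithLp.toLp 2 ((M n).toLp (y n), (0 : Lp ℝ 2 ν))) (hyperfilter ℕ)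
        (𝓝 (WithLp.toLp 2 (M0.toLp y0, (0 : Lp ℝ 2 ν)))) :=
      ((WithLp.prod_continuous_toLp 2 _ _).tendsto _).comp (ht.prodMk_nhds tendsto_const_nhds)
    have := weak_strong hz hlim ht2
    simp only [WithLp.prod_inner_apply, inner_zero_right, add_zero] at this
    have e0 : inner ℝ w.fst (M0.toLp y0) = ∫ a, inner ℝ (w.fst a) (y0 a) ∂ν := by
      rw [← toLp_inner (Lp.memLp w.fst) M0, hf1]
    have e1 : ∀ n, inner ℝ ((m1 n).toLp (x1 n)) ((M n).toLp (y n)) =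
      ∫ a, inner ℝ (x1 n a) (y n a) ∂ν := fun n => toLp_inner _ _
    rw [← e0]
    simp only [← e1]
    exact this
  · intro y y0 K my my0 hK hl
    have M : ∀ n, MemLp (y n) 2 ν := fun n => MemLp.of_bound (my n) K (hK n)
    have M0 : MemLp y0 2 ν := by
      refine MemLp.of_bound my0 K ?_
      filter_upwards [ae_all_iff.2 hK, hl] with a h1 h2
      exact le_of_tendsto h2.norm (Eventually.of_forall h1)
    have ht := (toLp_tendsto M M0 hK hl).mono_left hU
    have ht2 : Tendsto (fun n => WithLp.toLp 2 ((0 : Lp E 2 ν), (M n).toLp (y n))) (hyperfilter ℕ)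
        (𝓝 (WithLp.toLp 2 ((0 : Lp E 2 ν), M0.toLp y0))) :=
      ((WithLp.prod_continuous_toLp 2 _ _).tendsto _).comp (tendsto_const_nhds.prodMk_nhds ht)
    have := weak_strong hz hlim ht2
    simp only [WithLp.prod_inner_apply, inner_zero_right, zero_add] at this
    have ei : ∀ s t : ℝ, s * t = inner ℝ s t := fun s t => by simp [mul_comm]
    have e0 : inner ℝ w.snd (M0.toLp y0) = ∫ a, w.snd a * y0 a ∂ν := by
      simp only [ei]
      rw [← toLp_inner (Lp.memLp w.snd) M0, hf2]
    have e1 : ∀ n, inner ℝ ((m2 n).toLp (x2 n)) ((M n).toLp (y n)) =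
      ∫ a, x2 n a * y n a ∂ν := fun n => by simp only [ei]; exact toLp_inner _ _
    rw [← e0]
    simp only [← e1]
    exact this

end Weak

section Lsc
variable {R : ℝ} {h : ℝ → ℝ} {b : ℝ → Euc d}

lemma ii_ind {F : Type*} [NormedAddCommGroup F] [NormedSpace ℝ F] (k : ℝ → F) {t : ℝ}
    (ht : t ∈ Icc (0:ℝ) 1) :
    ∫ s in Ioo (0:ℝ) 1, (Ioo (0:ℝ) t).indicator k s = ∫ s in (0:ℝ)..t, k s := by
  rw [intervalIntegral.integral_of_le ht.1, integral_Ioc_eq_integral_Ioo,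
    integral_indicator measurableSet_Ioo, Measure.restrict_restrict measurableSet_Ioo,
    inter_eq_left.2 (Ioo_subset_Ioo le_rfl ht.2)]

lemma sqrt_gam_tendsto {hn : ℕ → ℝ → ℝ} {bn : ℕ → ℝ → Euc d}
    (gn : ∀ n, Good R (hn n) (bn n)) {t : ℝ} (lh : Tendsto (fun n => hn n t) atTop (𝓝 (h t)))
    (lb : Tendsto (fun n => bn n t) atTop (𝓝 (b t))) :
    Tendsto (fun n => √(hn n t) • gam (hn n) (bn n) t) atTop (𝓝 (√(h t) • gam h b t)) := by
  by_cases h0 : h t = 0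
  · rw [h0, Real.sqrt_zero, zero_smul]
    have h1 : Tendsto (fun n => √(hn n t) * R) atTop (𝓝 0) := by
      have := lh.sqrt.mul_const R
      rwa [h0, Real.sqrt_zero, zero_mul] at this
    refine squeeze_zero_norm (fun n => ?_) h1
    rw [norm_smul, Real.norm_of_nonneg (Real.sqrt_nonneg _)]
    exact mul_le_mul_of_nonneg_left ((gn n).gam_le t) (Real.sqrt_nonneg _)
  · exact lh.sqrt.smul ((lh.inv₀ h0).smul lb)

lemma lsc_abs {δ : ℝ} (hδ : 0 < δ) (g : Good R h b) {hn : ℕ → ℝ → ℝ} {bn : ℕ → ℝ → Euc d}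
    (gn : ∀ n, Good R (hn n) (bn n)) {Vn : ℕ → ℝ → Euc d} {Gn : ℕ → ℝ → ℝ}
    (A : ∀ n, Adm (hn n) (bn n) (Vn n) (Gn n)) {M : ℝ}
    (hM : ∀ n, ∀ t ∈ Icc (0:ℝ) 1, hn n t ≤ M)
    (lh : ∀ t ∈ Icc (0:ℝ) 1, Tendsto (fun n => hn n t) atTop (𝓝 (h t)))
    (lb : ∀ t ∈ Icc (0:ℝ) 1, Tendsto (fun n => bn n t) atTop (𝓝 (b t))) {C : ℝ} (hC0 : 0 ≤ C)
    (hE : ∀ n, En δ (hn n) (Vn n) (Gn n) ≤ ENNReal.ofReal C) :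
    ∃ (V : ℝ → Euc d) (G : ℝ → ℝ), Adm h b V G ∧ En δ h V G ≤ ENNReal.ofReal C := by
  have mh : ∀ n, Measurable (hn n) := fun n => (gn n).hc.measurable
  have mx1 : ∀ n, Measurable fun t => √(hn n t) • Vn n t := fun n => (mh n).sqrt.smul (A n).mV
  have mx2 : ∀ n, Measurable fun t => δ * (√(hn n t) * Gn n t) :=
    fun n => ((mh n).sqrt.mul (A n).mG).const_mul δ
  have e1 : ∀ n t, ‖√(hn n t) • Vn n t‖ ^ 2 = hn n t * ‖Vn n t‖ ^ 2 := fun n t => by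
    rw [norm_smul, Real.norm_of_nonneg (Real.sqrt_nonneg _), mul_pow, Real.sq_sqrt ((gn n).h0 t)]
  have e2 : ∀ n t, (δ * (√(hn n t) * Gn n t)) ^ 2 = δ ^ 2 * (hn n t * Gn n t ^ 2) := fun n t => by
    rw [mul_pow, mul_pow, Real.sq_sqrt ((gn n).h0 t)]
  have L1 : ∀ n, MemLp (fun t => √(hn n t) • Vn n t) 2 (volume.restrict (Ioo 0 1)) := fun n => by
    rw [memLp_two_iff_integrable_sq_norm (mx1 n).aestronglyMeasurable]
    simp only [e1]
    exact (A n).iV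
  have L2 : ∀ n, MemLp (fun t => δ * (√(hn n t) * Gn n t)) 2 (volume.restrict (Ioo 0 1)) :=
    fun n => by
    rw [memLp_two_iff_integrable_sq (mx2 n).aestronglyMeasurable]
    simp only [e2]
    exact (A n).iG.const_mul _
  have hC : ∀ n, (∫ t in Ioo (0:ℝ) 1, ‖√(hn n t) • Vn n t‖ ^ 2) +
      ∫ t in Ioo (0:ℝ) 1, (δ * (√(hn n t) * Gn n t)) ^ 2 ≤ 2 * C := fun n => by
    simp only [e1, e2]
    have i2 := (A n).iG.const_mul (δ ^ 2)
    rw [← integral_add (A n).iV i2]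
    have iF : IntegrableOn (fun t => hn n t * ((‖Vn n t‖ ^ 2 + δ ^ 2 * Gn n t ^ 2) / 2))
        (Ioo 0 1) := by
      refine (((A n).iV.add i2).div_const 2).congr (Eventually.of_forall fun t => ?_)
      simp only [Pi.add_apply]; ring
    have h1 : ENNReal.ofReal (∫ t in Ioo (0:ℝ) 1, hn n t * ((‖Vn n t‖ ^ 2 +
        δ ^ 2 * Gn n t ^ 2) / 2)) ≤ ENNReal.ofReal C := by
      rw [ofReal_integral_eq_lintegral_ofReal iF
        (Eventually.of_forall fun t => mul_nonneg ((gn n).h0 t) (by positivity))]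
      exact hE n
    have h2 := (ENNReal.ofReal_le_ofReal_iff hC0).1 h1
    refine le_trans (le_of_eq ?_) (mul_le_mul_of_nonneg_left h2 zero_le_two)
    rw [← integral_const_mul]
    refine integral_congr_ae (Eventually.of_forall fun t => ?_)
    beta_reduce
    ring
  obtain ⟨X1, X2, s1, s2, ML1, ML2, hXC, T1, T2⟩ := L2_weak L1 L2 hC
  have hU : (hyperfilter ℕ : Filter ℕ) ≤ atTop := Nat.hyperfilter_le_atTop
  have hMb : ∀ t ∈ Icc (0:ℝ) 1, h t ≤ M := fun t ht =>
    le_of_tendsto (lh t ht) (Eventually.of_forall fun n => hM n t ht)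
  have sM : ∀ n, ∀ t ∈ Icc (0:ℝ) 1, √(hn n t) ≤ √M := fun n t ht => Real.sqrt_le_sqrt (hM n t ht)
  have mhl := g.hc.measurable
  -- generic bounded test sequences
  have key1 : ∀ t ∈ Icc (0:ℝ) 1, ∀ e : Euc d, Tendsto
      (fun n => ∫ s in (0:ℝ)..t, hn n s * inner ℝ (Vn n s) e) (hyperfilter ℕ)
      (𝓝 (∫ s in (0:ℝ)..t, √(h s) * inner ℝ (X1 s) e)) := by
    intro t ht e
    have := T1 (fun n => (Ioo (0:ℝ) t).indicator fun s => √(hn n s) • e)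
      ((Ioo (0:ℝ) t).indicator fun s => √(h s) • e) (√M * ‖e‖)
      (fun n => ((((mh n).sqrt.smul_const e)).indicator measurableSet_Ioo).aestronglyMeasurable)
      ((mhl.sqrt.smul_const e).indicator measurableSet_Ioo).aestronglyMeasurable
      (fun n => (ae_restrict_iff' measurableSet_Ioo).2 (Eventually.of_forall fun s hs => ?_))
      ((ae_restrict_iff' measurableSet_Ioo).2 (Eventually.of_forall fun s hs => ?_))
    · rw [← ii_ind _ ht]
      simp only [← ii_ind _ ht]
      refine (this.congr fun n => ?_).trans (le_of_eq ?_)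
      · refine integral_congr_ae (Eventually.of_forall fun s => ?_)
        by_cases hs : s ∈ Ioo (0:ℝ) t
        · simp only [indicator_of_mem hs, inner_smul_left, inner_smul_right]
          simp only [conj_trivial, ← mul_assoc, Real.mul_self_sqrt ((gn n).h0 s)]
        · simp only [indicator_of_notMem hs, inner_zero_right]
      · congr 1
        refine integral_congr_ae (Eventually.of_forall fun s => ?_)
        by_cases hs : s ∈ Ioo (0:ℝ) t
        · simp only [indicator_of_mem hs, inner_smul_right]
        · simp only [indicator_of_notMem hs, inner_zero_right]
    · refine (norm_indicator_le_norm_self _ _).trans ?_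
      rw [norm_smul, Real.norm_of_nonneg (Real.sqrt_nonneg _)]
      exact mul_le_mul_of_nonneg_right (sM n s (Ioo_subset_Icc_self hs)) (norm_nonneg _)
    · by_cases hst : s ∈ Ioo (0:ℝ) t
      · simp only [indicator_of_mem hst]
        exact (lh s (Ioo_subset_Icc_self hs)).sqrt.smul_const e
      · simp only [indicator_of_notMem hst]
        exact tendsto_const_nhds
  have key2 : ∀ t ∈ Icc (0:ℝ) 1, Tendsto
      (fun n => ∫ s in (0:ℝ)..t, hn n s * Gn n s) (hyperfilter ℕ)
      (𝓝 (∫ s in (0:ℝ)..t, √(h s) * (δ⁻¹ * X2 s))) := by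
    intro t ht
    have := T2 (fun n => (Ioo (0:ℝ) t).indicator fun s => δ⁻¹ * √(hn n s))
      ((Ioo (0:ℝ) t).indicator fun s => δ⁻¹ * √(h s)) (δ⁻¹ * √M)
      (fun n => ((((mh n).sqrt.const_mul _)).indicator measurableSet_Ioo).aestronglyMeasurable)
      ((mhl.sqrt.const_mul _).indicator measurableSet_Ioo).aestronglyMeasurable
      (fun n => (ae_restrict_iff' measurableSet_Ioo).2 (Eventually.of_forall fun s hs => ?_))
      ((ae_restrict_iff' measurableSet_Ioo).2 (Eventually.of_forall fun s hs => ?_))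
    · rw [← ii_ind _ ht]
      simp only [← ii_ind _ ht]
      refine (this.congr fun n => ?_).trans (le_of_eq ?_)
      · refine integral_congr_ae (Eventually.of_forall fun s => ?_)
        by_cases hs : s ∈ Ioo (0:ℝ) t
        · simp only [indicator_of_mem hs]
          nth_rw 3 [← Real.mul_self_sqrt ((gn n).h0 s)]
          field_simp
        · simp only [indicator_of_notMem hs, mul_zero]
      · congr 1
        refine integral_congr_ae (Eventually.of_forall fun s => ?_)
        by_cases hs : s ∈ Ioo (0:ℝ) t
        · simp only [indicator_of_mem hs]
          ring
        · simp only [indicator_of_notMem hs, mul_zero]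
    · refine (norm_indicator_le_norm_self _ _).trans ?_
      rw [Real.norm_of_nonneg (by positivity)]
      exact mul_le_mul_of_nonneg_left (sM n s (Ioo_subset_Icc_self hs)) (by positivity)
    · by_cases hst : s ∈ Ioo (0:ℝ) t
      · simp only [indicator_of_mem hst]
        exact (lh s (Ioo_subset_Icc_self hs)).sqrt.const_mul _
      · simp only [indicator_of_notMem hst]
        exact tendsto_const_nhds
  have key3 : ∀ t ∈ Icc (0:ℝ) 1, ∀ i : Fin d, Tendsto
      (fun n => ∫ s in (0:ℝ)..t, hn n s * Gn n s * gam (hn n) (bn n) s i) (hyperfilter ℕ)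
      (𝓝 (∫ s in (0:ℝ)..t, √(h s) * (δ⁻¹ * X2 s) * gam h b s i)) := by
    intro t ht i
    have mi : ∀ n, Measurable fun s => δ⁻¹ * (√(hn n s) • gam (hn n) (bn n) s) i := fun n =>
      ((cproj i).continuous.measurable.comp ((mh n).sqrt.smul (gn n).gam_meas)).const_mul _
    have mi0 : Measurable fun s => δ⁻¹ * (√(h s) • gam h b s) i :=
      ((cproj i).continuous.measurable.comp (mhl.sqrt.smul g.gam_meas)).const_mul _
    have := T2 (fun n => (Ioo (0:ℝ) t).indicator fun s => δ⁻¹ * (√(hn n s) • gam (hn n) (bn n) s) i)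
      ((Ioo (0:ℝ) t).indicator fun s => δ⁻¹ * (√(h s) • gam h b s) i) (δ⁻¹ * (√M * R))
      (fun n => ((mi n).indicator measurableSet_Ioo).aestronglyMeasurable)
      (mi0.indicator measurableSet_Ioo).aestronglyMeasurable
      (fun n => (ae_restrict_iff' measurableSet_Ioo).2 (Eventually.of_forall fun s hs => ?_))
      ((ae_restrict_iff' measurableSet_Ioo).2 (Eventually.of_forall fun s hs => ?_))
    · rw [← ii_ind _ ht]
      simp only [← ii_ind _ ht]
      refine (this.congr fun n => ?_).trans (le_of_eq ?_)
      · refine integral_congr_ae (Eventually.of_forall fun s => ?_)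
        by_cases hs : s ∈ Ioo (0:ℝ) t
        · simp only [indicator_of_mem hs, PiLp.smul_apply, smul_eq_mul]
          have e3 := Real.mul_self_sqrt ((gn n).h0 s)
          generalize √(hn n s) = q at *
          rw [← e3]
          field_simp
        · simp only [indicator_of_notMem hs, mul_zero]
      · congr 1
        refine integral_congr_ae (Eventually.of_forall fun s => ?_)
        by_cases hs : s ∈ Ioo (0:ℝ) t
        · simp only [indicator_of_mem hs, PiLp.smul_apply, smul_eq_mul]
          ring
        · simp only [indicator_of_notMem hs, mul_zero]
    · refine (norm_indicator_le_norm_self _ _).trans ?_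
      rw [norm_mul, Real.norm_of_nonneg (by positivity : 0 ≤ δ⁻¹)]
      refine mul_le_mul_of_nonneg_left ((PiLp.norm_apply_le _ i).trans ?_) (by positivity)
      rw [norm_smul, Real.norm_of_nonneg (Real.sqrt_nonneg _)]
      exact mul_le_mul (sM n s (Ioo_subset_Icc_self hs)) ((gn n).gam_le s) (norm_nonneg _)
        (Real.sqrt_nonneg _)
    · by_cases hst : s ∈ Ioo (0:ℝ) t
      · simp only [indicator_of_mem hst]
        have hs' := Ioo_subset_Icc_self hs
        exact (((cproj i).continuous.tendsto _).comp
          (sqrt_gam_tendsto gn (lh s hs') (lb s hs'))).const_mul _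
      · simp only [indicator_of_notMem hst]
        exact tendsto_const_nhds
  -- integrability of the limits
  have j1 : IntegrableOn X1 (Ioo 0 1) := ML1.integrable (by norm_num)
  have j2 : IntegrableOn X2 (Ioo 0 1) := ML2.integrable (by norm_num)
  have k2 : IntegrableOn (fun s => √(h s) * (δ⁻¹ * X2 s)) (Ioo 0 1) := by
    refine Integrable.mono' ((j2.norm.const_mul δ⁻¹).const_mul √M)
      (mhl.sqrt.mul (s2.measurable.const_mul _)).aestronglyMeasurable
      ((ae_restrict_iff' measurableSet_Ioo).2 (Eventually.of_forall fun s hs => ?_))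
    rw [norm_mul, norm_mul, Real.norm_of_nonneg (Real.sqrt_nonneg _),
      Real.norm_of_nonneg (by positivity : 0 ≤ δ⁻¹)]
    exact mul_le_mul_of_nonneg_right (Real.sqrt_le_sqrt (hMb s (Ioo_subset_Icc_self hs)))
      (by positivity)
  have k1 : IntegrableOn (fun s => √(h s) • X1 s) (Ioo 0 1) := by
    refine Integrable.mono' (j1.norm.const_mul √M)
      (mhl.sqrt.smul s1.measurable).aestronglyMeasurable
      ((ae_restrict_iff' measurableSet_Ioo).2 (Eventually.of_forall fun s hs => ?_))
    rw [norm_smul, Real.norm_of_nonneg (Real.sqrt_nonneg _)]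
    exact mul_le_mul_of_nonneg_right (Real.sqrt_le_sqrt (hMb s (Ioo_subset_Icc_self hs)))
      (by positivity)
  have k3 : IntegrableOn (fun s => (√(h s) * (δ⁻¹ * X2 s)) • gam h b s) (Ioo 0 1) := by
    refine Integrable.mono' (k2.norm.mul_const R)
      ((mhl.sqrt.mul (s2.measurable.const_mul _)).smul g.gam_meas).aestronglyMeasurable
      (Eventually.of_forall fun s => ?_)
    rw [norm_smul]
    exact mul_le_mul_of_nonneg_left (g.gam_le s) (norm_nonneg _)
  have Ih : IsInt h fun t => √(h t) * (δ⁻¹ * X2 t) := by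
    refine ⟨ii_of_Ioo k2, fun t ht => ?_⟩
    have l1 := ((lh t ht).sub (lh 0 (by simp))).mono_left hU
    have l2 := key2 t ht
    have l3 := l2.congr fun n => ((A n).eh.sub_eq (s := 0) (by simp) ht).symm
    have := tendsto_nhds_unique l1 l3
    linarith
  have Ib : IsInt b fun t => √(h t) • X1 t + (√(h t) * (δ⁻¹ * X2 t)) • gam h b t := by
    refine isInt_euc fun i => ?_
    have k4 : IntegrableOn (fun t => (√(h t) • X1 t + (√(h t) * (δ⁻¹ * X2 t)) • gam h b t) i)
      (Ioo 0 1) := (cproj i).integrable_comp (k1.add k3)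
    have k5 : IntegrableOn (fun t => √(h t) * inner ℝ (X1 t) (EuclideanSpace.single i (1:ℝ)))
        (Ioo 0 1) := by
      refine ((cproj i).integrable_comp k1).congr (Eventually.of_forall fun s => ?_)
      simp [cproj, EuclideanSpace.inner_single_right]
    have k6 : IntegrableOn (fun t => √(h t) * (δ⁻¹ * X2 t) * gam h b t i) (Ioo 0 1) :=
      (cproj i).integrable_comp k3
    refine ⟨ii_of_Ioo k4, fun t ht => ?_⟩
    have z0 : (0:ℝ) ∈ Icc (0:ℝ) 1 := by simp
    have l1 := (((cproj i).continuous.tendsto _).comp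
      ((lb t ht).sub (lb 0 z0))).mono_left hU
    have l2 := (key1 t ht (EuclideanSpace.single i 1)).add (key3 t ht i)
    have e5 : (∫ s in (0:ℝ)..t, √(h s) * inner ℝ (X1 s) (EuclideanSpace.single i (1:ℝ))) +
        ∫ s in (0:ℝ)..t, √(h s) * (δ⁻¹ * X2 s) * gam h b s i =
        ∫ s in (0:ℝ)..t, (√(h s) • X1 s + (√(h s) * (δ⁻¹ * X2 s)) • gam h b s) i := by
      rw [← intervalIntegral.integral_add (ii_sub (ii_of_Ioo k5) z0 ht)
        (ii_sub (ii_of_Ioo k6) z0 ht)]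
      refine intervalIntegral.integral_congr fun s _ => ?_
      simp [EuclideanSpace.inner_single_right]
    have e6 : ∀ n, (∫ s in (0:ℝ)..t, hn n s * inner ℝ (Vn n s) (EuclideanSpace.single i (1:ℝ))) +
        ∫ s in (0:ℝ)..t, hn n s * Gn n s * gam (hn n) (bn n) s i =
        cproj i (bn n t - bn n 0) := by
      intro n
      have q1 : IntegrableOn (fun s => hn n s * inner ℝ (Vn n s) (EuclideanSpace.single i (1:ℝ)))
          (Ioo 0 1) := by
        refine ((cproj i).integrable_comp ((gn n).iV1 (A n).mV (A n).iV)).congr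
          (Eventually.of_forall fun s => ?_)
        simp [cproj, EuclideanSpace.inner_single_right]
      have q0 := ((A n).eb.clm (cproj i))
      have q3 : IntegrableOn (fun s => cproj i (hn n s • (Vn n s + Gn n s • gam (hn n) (bn n) s)))
          (Ioo 0 1) := (intervalIntegrable_iff_integrableOn_Ioo_of_le zero_le_one).1 q0.1
      have q2 : IntegrableOn (fun s => hn n s * Gn n s * gam (hn n) (bn n) s i) (Ioo 0 1) := by
        refine (q3.sub q1).congr (Eventually.of_forall fun s => ?_)
        simp [cproj, EuclideanSpace.inner_single_right]
        ring
      rw [map_sub, q0.sub_eq z0 ht, ← intervalIntegral.integral_add (ii_sub (ii_of_Ioo q1) z0 ht)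
        (ii_sub (ii_of_Ioo q2) z0 ht)]
      refine intervalIntegral.integral_congr fun s _ => ?_
      simp [cproj, EuclideanSpace.inner_single_right]
      ring
    have l3 := l2.congr e6
    rw [e5] at l3
    have := tendsto_nhds_unique l1 l3
    have e7 : cproj i (b t - b 0) = b t i - b 0 i := rfl
    rw [e7] at this
    linarith
  have i1 : IntegrableOn (fun t => ‖X1 t‖ ^ 2) (Ioo 0 1) :=
    (memLp_two_iff_integrable_sq_norm ML1.1).1 ML1
  have i2 : IntegrableOn (fun t => X2 t ^ 2) (Ioo 0 1) := ML2.integrable_sq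
  have e3 : ∀ t, (δ⁻¹ * X2 t) ^ 2 = δ⁻¹ ^ 2 * X2 t ^ 2 := fun t => by ring
  obtain ⟨V, G, AA, hAA⟩ := adm_of_xi g s1.measurable (s2.measurable.const_mul δ⁻¹) i1
    (by simp only [e3]; exact i2.const_mul _) Ih Ib
  refine ⟨V, G, AA, (hAA δ).trans ?_⟩
  have e4 : ∀ t, (‖X1 t‖ ^ 2 + δ ^ 2 * (δ⁻¹ * X2 t) ^ 2) / 2 = (‖X1 t‖ ^ 2 + X2 t ^ 2) / 2 :=
    fun t => by field_simp
  simp only [e4]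
  have i3 : IntegrableOn (fun t => (‖X1 t‖ ^ 2 + X2 t ^ 2) / 2) (Ioo 0 1) :=
    (i1.add i2).div_const 2
  rw [← ofReal_integral_eq_lintegral_ofReal i3
    (Eventually.of_forall fun t => by simp only [Pi.zero_apply]; positivity)]
  refine ENNReal.ofReal_le_ofReal ?_
  rw [integral_div, integral_add i1 i2]
  linarith

end Lsc

section Dist
variable {V : Set (Euc d)} {R : ℝ}

lemma flat_mem_le (η₁ η₂ : SCurve V) (s t : ℝ) {r : ℝ}
    (hr : r ∈ {r : ℝ | ∃ φ : Euc d → ℝ, Continuous φ ∧ (∀ x, |φ x| ≤ 1) ∧ LipschitzWith 1 φ ∧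
        r = (∫ x, φ x ∂(η₁.toFun s)) - ∫ x, φ x ∂(η₂.toFun t)}) : r ≤ hh η₁ s + hh η₂ t := by
  obtain ⟨φ, -, h1, -, rfl⟩ := hr
  rw [scurve_int, scurve_int]
  have a1 := h1 (gam (hh η₁) (bb η₁) s)
  have a2 := h1 (gam (hh η₂) (bb η₂) t)
  rw [abs_le] at a1 a2
  nlinarith [hh_nonneg η₁ s, hh_nonneg η₂ t]

lemma flat_le (η₁ η₂ : SCurve V) (s t : ℝ) :
    flatDist (η₁.toFun s) (η₂.toFun t) ≤ hh η₁ s + hh η₂ t := by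
  refine csSup_le ⟨0, fun _ => 0, continuous_const, by simp, LipschitzWith.const' 0, by simp⟩ ?_
  intro r hr
  exact flat_mem_le η₁ η₂ s t hr

lemma flat_test (η₁ η₂ : SCurve V) (t : ℝ) {φ : Euc d → ℝ} (h1 : ∀ x, |φ x| ≤ 1)
    (h2 : LipschitzWith 1 φ) :
    hh η₁ t * φ (gam (hh η₁) (bb η₁) t) - hh η₂ t * φ (gam (hh η₂) (bb η₂) t) ≤
      flatDist (η₁.toFun t) (η₂.toFun t) := by
  rw [← scurve_int, ← scurve_int]
  exact le_csSup ⟨_, fun r hr => flat_mem_le η₁ η₂ t t hr⟩ ⟨φ, h2.continuous, h1, h2, rfl⟩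

lemma flat_le_Ddist (hR : 0 ≤ R) (hV : ∀ x ∈ V, ‖x‖ ≤ R) (η₁ η₂ : SCurve V) {t : ℝ}
    (ht : t ∈ Icc (0:ℝ) 1) : flatDist (η₁.toFun t) (η₂.toFun t) ≤ Ddist η₁ η₂ := by
  obtain ⟨M1, -, hM1⟩ := (scurve_good hR hV η₁).bdd
  obtain ⟨M2, -, hM2⟩ := (scurve_good hR hV η₂).bdd
  refine le_csSup ⟨M1 + M2, ?_⟩ ⟨t, ht, rfl⟩
  rintro r ⟨s, hs, rfl⟩
  exact (flat_le η₁ η₂ s s).trans (add_le_add (hM1 s hs) (hM2 s hs))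

lemma Ddist_test (hR : 0 ≤ R) (hV : ∀ x ∈ V, ‖x‖ ≤ R) (η₁ η₂ : SCurve V) {t : ℝ}
    (ht : t ∈ Icc (0:ℝ) 1) {φ : Euc d → ℝ} (h1 : ∀ x, |φ x| ≤ 1) (h2 : LipschitzWith 1 φ) :
    |hh η₁ t * φ (gam (hh η₁) (bb η₁) t) - hh η₂ t * φ (gam (hh η₂) (bb η₂) t)| ≤
      Ddist η₁ η₂ := by
  have e1 := (flat_test η₁ η₂ t h1 h2).trans (flat_le_Ddist hR hV η₁ η₂ ht)
  have e2 := (flat_test η₁ η₂ t (φ := fun x => -φ x) (by simpa using h1) h2.neg).trans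
    (flat_le_Ddist hR hV η₁ η₂ ht)
  rw [abs_le]
  constructor <;> linarith

lemma Ddist_h (hR : 0 ≤ R) (hV : ∀ x ∈ V, ‖x‖ ≤ R) (η₁ η₂ : SCurve V) {t : ℝ}
    (ht : t ∈ Icc (0:ℝ) 1) : |hh η₁ t - hh η₂ t| ≤ Ddist η₁ η₂ := by
  have := Ddist_test hR hV η₁ η₂ ht (φ := fun _ => 1) (by simp) (LipschitzWith.const' 1)
  simpa using this

lemma Ddist_b (hR : 0 ≤ R) (hV : ∀ x ∈ V, ‖x‖ ≤ R) (η₁ η₂ : SCurve V) {t : ℝ}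
    (ht : t ∈ Icc (0:ℝ) 1) (i : Fin d) :
    |bb η₁ t i - bb η₂ t i| ≤ (R + 1) * Ddist η₁ η₂ := by
  have hR1 : 0 < R + 1 := by linarith
  let φ : Euc d → ℝ := fun x => max (-1) (min 1 ((R + 1)⁻¹ * x i))
  have hlip : LipschitzWith 1 φ := by
    have h0 : LipschitzWith 1 fun x : Euc d => (R + 1)⁻¹ * x i := by
      refine LipschitzWith.of_dist_le_mul fun x y => ?_
      rw [Real.dist_eq, ← mul_sub, abs_mul, abs_of_pos (inv_pos.2 hR1), NNReal.coe_one, one_mul,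
        dist_eq_norm]
      have n1 : |x i - y i| ≤ ‖x - y‖ := PiLp.norm_apply_le (x - y) i
      have n2 : (R + 1)⁻¹ ≤ 1 := inv_le_one_of_one_le₀ (by linarith)
      calc (R + 1)⁻¹ * |x i - y i| ≤ 1 * ‖x - y‖ :=
            mul_le_mul n2 n1 (abs_nonneg _) zero_le_one
        _ = _ := one_mul _
    exact (h0.const_min 1).const_max (-1)
  have hφ : ∀ x, |φ x| ≤ 1 := fun x => by
    rw [abs_le]
    exact ⟨le_max_left _ _, max_le (by norm_num) (min_le_left _ _)⟩
  have hval : ∀ η : SCurve V, (R + 1) * (hh η t * φ (gam (hh η) (bb η) t)) = bb η t i := by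
    intro η
    have g := scurve_good hR hV η
    have e : φ (gam (hh η) (bb η) t) = (R + 1)⁻¹ * gam (hh η) (bb η) t i := by
      have n1 : |gam (hh η) (bb η) t i| ≤ R := (PiLp.norm_apply_le _ i).trans (g.gam_le t)
      rw [abs_le] at n1
      have n2 : (R + 1)⁻¹ * gam (hh η) (bb η) t i ≤ 1 := by
        rw [inv_mul_le_iff₀ hR1]; linarith
      have n3 : -1 ≤ (R + 1)⁻¹ * gam (hh η) (bb η) t i := by
        rw [le_inv_mul_iff₀ hR1]; linarith
      simp only [φ]
      rw [min_eq_right n2, max_eq_right n3]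
    rw [e, g.b_eq t, PiLp.smul_apply, smul_eq_mul]
    field_simp
  rw [← hval, ← hval, ← mul_sub, abs_mul, abs_of_pos hR1]
  exact mul_le_mul_of_nonneg_left (Ddist_test hR hV η₁ η₂ ht hφ hlip) hR1.le

lemma Ddist_nonneg (hR : 0 ≤ R) (hV : ∀ x ∈ V, ‖x‖ ≤ R) (η₁ η₂ : SCurve V) :
    0 ≤ Ddist η₁ η₂ := (abs_nonneg _).trans (Ddist_h hR hV η₁ η₂ (t := 0) (by simp))

lemma Ddist_le (hR : 0 ≤ R) (hV : ∀ x ∈ V, ‖x‖ ≤ R) (η₁ η₂ : SCurve V) {ε : ℝ}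
    (h1 : ∀ t ∈ Icc (0:ℝ) 1, |hh η₁ t - hh η₂ t| ≤ ε)
    (h2 : ∀ t ∈ Icc (0:ℝ) 1, ‖bb η₁ t - bb η₂ t‖ ≤ ε) : Ddist η₁ η₂ ≤ (R + 2) * ε := by
  refine csSup_le ⟨_, 0, by simp, rfl⟩ ?_
  rintro _ ⟨t, ht, rfl⟩
  refine csSup_le ⟨0, fun _ => 0, continuous_const, by simp, LipschitzWith.const' 0, by simp⟩ ?_
  rintro _ ⟨φ, -, hφ, hl, rfl⟩
  rw [scurve_int, scurve_int]
  have g1 := scurve_good hR hV η₁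
  have g2 := scurve_good hR hV η₂
  set γ₁ := gam (hh η₁) (bb η₁) t
  set γ₂ := gam (hh η₂) (bb η₂) t
  have n1 : |φ γ₁ - φ γ₂| ≤ ‖γ₁ - γ₂‖ := by
    have := hl.dist_le_mul γ₁ γ₂
    rwa [Real.dist_eq, dist_eq_norm, NNReal.coe_one, one_mul] at this
  have n2 : hh η₁ t * ‖γ₁ - γ₂‖ ≤ ε + ε * R := by
    have e : hh η₁ t • (γ₁ - γ₂) = (bb η₁ t - bb η₂ t) - (hh η₁ t - hh η₂ t) • γ₂ := by
      rw [g1.b_eq t, g2.b_eq t]; module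
    have e2 : hh η₁ t * ‖γ₁ - γ₂‖ = ‖hh η₁ t • (γ₁ - γ₂)‖ := by
      rw [norm_smul, Real.norm_of_nonneg (g1.h0 t)]
    rw [e2, e]
    refine (norm_sub_le _ _).trans (add_le_add (h2 t ht) ?_)
    rw [norm_smul]
    exact mul_le_mul (h1 t ht) (g2.gam_le t) (norm_nonneg _) ((abs_nonneg _).trans (h1 t ht))
  have n3 : (hh η₁ t - hh η₂ t) * φ γ₂ ≤ ε := by
    refine (le_abs_self _).trans ?_
    rw [abs_mul]
    calc _ ≤ ε * 1 := mul_le_mul (h1 t ht) (hφ _) (abs_nonneg _) ((abs_nonneg _).trans (h1 t ht))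
      _ = ε := mul_one _
  have n4 : hh η₁ t * (φ γ₁ - φ γ₂) ≤ hh η₁ t * ‖γ₁ - γ₂‖ :=
    mul_le_mul_of_nonneg_left ((le_abs_self _).trans n1) (g1.h0 t)
  linarith

lemma Good.Ma_eq {h : ℝ → ℝ} {b : ℝ → Euc d} (g : Good R h b) :
    Ma h = ENNReal.ofReal (∫ t in Ioo (0:ℝ) 1, h t) :=
  (ofReal_integral_eq_lintegral_ofReal g.h_int (Eventually.of_forall g.h0)).symm

lemma lsc_core (hR : 0 ≤ R) (hV : ∀ x ∈ V, ‖x‖ ≤ R) {α β δ : ℝ} (hα : 0 < α) (hβ : 0 < β)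
    (hδ : 0 < δ) {η : SCurve V} {u : ℕ → SCurve V}
    (hD : Tendsto (fun n => Ddist (u n) η) atTop (𝓝 0)) {c : ℝ≥0∞}
    (hc : ∀ n, FF α β δ (u n) < c) : FF α β δ η ≤ c := by
  have g := scurve_good hR hV η
  refine ENNReal.le_of_forall_pos_le_add fun ε hε hct => ?_
  lift c to ℝ≥0 using hct.ne
  have hε' : (0:ℝ) < ε := hε
  have hκ : 0 < min 1 (ε / α) := lt_min one_pos (by positivity)
  obtain ⟨N, hN⟩ := eventually_atTop.1 (hD.eventually (gt_mem_nhds hκ))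
  have hsm : ∀ n, Ddist (u (n + N)) η < min 1 (ε / α) := fun n => hN _ (by omega)
  choose v G A hA using fun n => exists_adm_of_FF_lt hR hV (u (n + N)) hβ hδ (hc (n + N))
  have gn : ∀ n, Good R (hh (u (n + N))) (bb (u (n + N))) := fun n => scurve_good hR hV _
  obtain ⟨M, -, hM⟩ := g.bdd
  have hD2 : Tendsto (fun n => Ddist (u (n + N)) η) atTop (𝓝 0) := hD.comp (tendsto_add_atTop_nat N)
  have Hh : ∀ n, ∀ t ∈ Icc (0:ℝ) 1, |hh (u (n + N)) t - hh η t| ≤ Ddist (u (n + N)) η :=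
    fun n t ht => Ddist_h hR hV _ _ ht
  set I : ℝ := ∫ t in Ioo (0:ℝ) 1, hh η t with hI
  have hI0 : 0 ≤ I := integral_nonneg g.h0
  have hmass : ∀ n, α * I - ε ≤ α * ∫ t in Ioo (0:ℝ) 1, hh (u (n + N)) t := by
    intro n
    have h1 : I ≤ ∫ t in Ioo (0:ℝ) 1, (hh (u (n + N)) t + ε / α) := by
      refine setIntegral_mono_on g.h_int ((gn n).h_int.add (integrable_const _))
        measurableSet_Ioo fun t ht => ?_
      have := Hh n t (Ioo_subset_Icc_self ht)
      have h3 := (hsm n).le.trans (min_le_right _ _)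
      rw [abs_le] at this
      linarith
    rw [integral_add (gn n).h_int (integrable_const _)] at h1
    simp only [integral_const, MeasurableSet.univ, measureReal_restrict_apply, univ_inter,
      Real.volume_real_Ioo, sub_zero, zero_le_one, sup_of_le_left, smul_eq_mul, one_mul] at h1
    have h2 := mul_le_mul_of_nonneg_left h1 hα.le
    rw [mul_add, mul_div_cancel₀ _ hα.ne'] at h2
    linarith
  have hEn : ∀ n, En δ (hh (u (n + N))) (v n) (G n) ≤ ENNReal.ofReal ((c - α * I + ε) / β) ∧
      0 ≤ (c - α * I + ε) / β := by
    intro n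
    have h1 := hA n
    have hfin : En δ (hh (u (n + N))) (v n) (G n) ≠ ⊤ := ((A n).En_lt_top δ).ne
    have hJ0 : 0 ≤ ∫ t in Ioo (0:ℝ) 1, hh (u (n + N)) t := integral_nonneg (gn n).h0
    rw [(gn n).Ma_eq, ← ENNReal.ofReal_toReal hfin, ← ENNReal.ofReal_mul hβ.le,
      ← ENNReal.ofReal_mul hα.le, ← ENNReal.ofReal_add (by positivity) (by positivity),
      ← ENNReal.ofReal_coe_nnreal, ENNReal.ofReal_le_ofReal_iff (NNReal.coe_nonneg c)] at h1
    have h2 := hmass n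
    have h3 : (En δ (hh (u (n + N))) (v n) (G n)).toReal ≤ (c - α * I + ε) / β := by
      rw [le_div_iff₀ hβ, mul_comm]
      linarith
    exact ⟨by rw [← ENNReal.ofReal_toReal hfin]; exact ENNReal.ofReal_le_ofReal h3,
      ENNReal.toReal_nonneg.trans h3⟩
  obtain ⟨v0, G0, A0, hE0⟩ := lsc_abs hδ g gn A (M := M + 1) (fun n t ht => by
      have h1 := Hh n t ht
      have h2 := hM t ht
      have h3 := (hsm n).le.trans (min_le_left _ _)
      rw [abs_le] at h1
      linarith)
    (fun t ht => by
      rw [tendsto_iff_norm_sub_tendsto_zero]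
      exact squeeze_zero (fun _ => norm_nonneg _) (fun n => Hh n t ht) hD2)
    (fun t ht => by
      have hi : ∀ i, Tendsto (fun n => bb (u (n + N)) t i) atTop (𝓝 (bb η t i)) := by
        intro i
        rw [tendsto_iff_norm_sub_tendsto_zero]
        have h1 := hD2.const_mul (R + 1)
        rw [mul_zero] at h1
        exact squeeze_zero (fun _ => norm_nonneg _) (fun n => Ddist_b hR hV _ _ ht i) h1
      have h2 := ((PiLp.continuous_toLp 2 (fun _ : Fin d => ℝ)).tendsto _).comp
        (tendsto_pi_nhds.2 hi)
      exact h2)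
    (hEn 0).2 (fun n => (hEn n).1)
  refine (FF_le hR hV η A0 α β δ).trans ?_
  refine (add_le_add_left (mul_le_mul_right hE0 _) _).trans ?_
  rw [g.Ma_eq, ← ENNReal.ofReal_mul hβ.le, ← ENNReal.ofReal_mul hα.le,
    mul_div_cancel₀ _ hβ.ne', ← ENNReal.ofReal_add _ (by positivity)]
  · rw [← ENNReal.coe_add, ← ENNReal.ofReal_coe_nnreal, NNReal.coe_add]
    refine ENNReal.ofReal_le_ofReal ?_
    linarith
  · have := (hEn 0).2
    rw [le_div_iff₀ hβ] at this
    linarith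

lemma FF_lsc (hV : IsClosureOfBoundedDomain V) {α β δ : ℝ} (hα : 0 < α) (hβ : 0 < β)
    (hδ : 0 < δ) (η : SCurve V) (u : ℕ → SCurve V)
    (hD : Tendsto (fun n => Ddist (u n) η) atTop (𝓝 0)) :
    FF α β δ η ≤ liminf (fun n => FF α β δ (u n)) atTop := by
  obtain ⟨-, -, R, hR, hVR⟩ := closure_bdd hV
  refine le_of_forall_gt_imp_ge_of_dense fun c hc => ?_
  have hf : ∃ᶠ n in atTop, FF α β δ (u n) < c := frequently_lt_of_liminf_lt (by isBoundedDefault) hc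
  obtain ⟨k, hk, hk2⟩ := extraction_of_frequently_atTop hf
  exact lsc_core hR hVR hα hβ hδ (hD.comp hk.tendsto_atTop) hk2

end Dist

section Cpt
variable {V : Set (Euc d)} {R : ℝ}

lemma IsInt.dist_le {F : Type*} [NormedAddCommGroup F] [NormedSpace ℝ F] {z z' : ℝ → F}
    (hz : IsInt z z') {p Q : ℝ} (q : ℝ → ℝ) (q0 : ∀ t, 0 ≤ q t)
    (qi : IntegrableOn q (Ioo 0 1)) (hQ : ∫ t in Ioo (0:ℝ) 1, q t ≤ Q)
    (hb : ∀ t ∈ Ioo (0:ℝ) 1, ‖z' t‖ ≤ p + q t) {s t : ℝ} (hs : s ∈ Icc (0:ℝ) 1)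
    (ht : t ∈ Icc (0:ℝ) 1) : ‖z t - z s‖ ≤ p * |t - s| + Q := by
  wlog hst : s ≤ t generalizing s t
  · have := this ht hs (le_of_not_ge hst)
    rwa [norm_sub_rev, abs_sub_comm] at this
  rw [hz.sub_eq hs ht, intervalIntegral.integral_of_le hst, integral_Ioc_eq_integral_Ioo]
  have hsub : Ioo s t ⊆ Ioo 0 1 := Ioo_subset_Ioo hs.1 ht.2
  have hi : IntegrableOn (fun t => p + q t) (Ioo s t) :=
    (integrableOn_const (by simp)).add (qi.mono_set hsub)
  calc ‖∫ x in Ioo s t, z' x‖ ≤ ∫ x in Ioo s t, (p + q x) := by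
        refine norm_integral_le_of_norm_le hi ?_
        filter_upwards [ae_restrict_mem measurableSet_Ioo] with x hx using hb x (hsub hx)
    _ = p * |t - s| + ∫ x in Ioo s t, q x := by
        rw [integral_add (integrable_const _) (qi.mono_set hsub)]
        simp [abs_of_nonneg (sub_nonneg.2 hst), mul_comm, hst]
    _ ≤ p * |t - s| + Q := by
        have : ∫ x in Ioo s t, q x ≤ ∫ t in Ioo (0:ℝ) 1, q t :=
          setIntegral_mono_set qi (Eventually.of_forall q0) hsub.eventuallyLE
        linarith

lemma amgm {κ h x : ℝ} (hκ : 0 < κ) (h0 : 0 ≤ h) :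
    h * |x| ≤ h / (2 * κ) + κ / 2 * (h * x ^ 2) := by
  have h1 : 0 ≤ h * (1 - κ * |x|) ^ 2 := by positivity
  have h2 : h / (2 * κ) + κ / 2 * (h * x ^ 2) - h * |x| = h * (1 - κ * |x|) ^ 2 / (2 * κ) := by
    rw [← sq_abs x]; field_simp; ring
  have h3 : 0 ≤ h * (1 - κ * |x|) ^ 2 / (2 * κ) := by positivity
  linarith

variable {h : ℝ → ℝ} {b : ℝ → Euc d} {v : ℝ → Euc d} {G : ℝ → ℝ}

lemma Adm.sup_le (g : Good R h b) (A : Adm h b v G) {K : ℝ}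
    (k1 : ∫ t in Ioo (0:ℝ) 1, h t ≤ K) (k2 : ∫ t in Ioo (0:ℝ) 1, h t * G t ^ 2 ≤ K)
    {t : ℝ} (ht : t ∈ Icc (0:ℝ) 1) : h t ≤ 2 * K := by
  have key : ∀ s ∈ Ioo (0:ℝ) 1, h t ≤ h s + K := by
    intro s hs
    have := A.eh.dist_le (p := 0) (Q := K) (fun t => h t / 2 + 1 / 2 * (h t * G t ^ 2))
      (fun t => by have := g.h0 t; positivity)
      ((g.h_int.div_const 2).fun_add (A.iG.const_mul (1/2))) (by
        rw [integral_add (g.h_int.div_const 2) (A.iG.const_mul (1/2)), integral_div,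
          integral_const_mul]
        linarith) (fun x hx => by
        have := amgm (x := G x) one_pos (g.h0 x)
        rw [norm_mul, Real.norm_of_nonneg (g.h0 x), Real.norm_eq_abs]
        linarith) (Ioo_subset_Icc_self hs) ht
    have h2 := le_abs_self (h t - h s)
    rw [← Real.norm_eq_abs] at h2
    linarith
  have h3 : ∫ s in Ioo (0:ℝ) 1, h t ≤ ∫ s in Ioo (0:ℝ) 1, (h s + K) :=
    setIntegral_mono_on (integrableOn_const (by simp)) (g.h_int.add (integrableOn_const (by simp)))
      measurableSet_Ioo key
  rw [integral_add g.h_int (integrableOn_const (by simp))] at h3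
  simp at h3
  linarith

lemma holder_of {D C r : ℝ} (r0 : 0 ≤ r) (hr : r = 0 → D ≤ 0)
    (H : ∀ κ : ℝ, 0 < κ → D ≤ C / κ * r + C * κ) : D ≤ 2 * C * √r := by
  rcases r0.eq_or_lt with e | e
  · subst e; simpa using hr rfl
  · have h1 := H (√r) (Real.sqrt_pos.2 e)
    have h2 : C / √r * r = C * √r := by
      have : √r ≠ 0 := (Real.sqrt_pos.2 e).ne'
      field_simp
      rw [Real.sq_sqrt r0]
    linarith

lemma Adm.holder_h (g : Good R h b) (A : Adm h b v G) {K : ℝ}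
    (k1 : ∫ t in Ioo (0:ℝ) 1, h t ≤ K) (k2 : ∫ t in Ioo (0:ℝ) 1, h t * G t ^ 2 ≤ K)
    {s t : ℝ} (hs : s ∈ Icc (0:ℝ) 1) (ht : t ∈ Icc (0:ℝ) 1) :
    ‖h t - h s‖ ≤ 2 * K * √|t - s| := by
  have K0 : 0 ≤ K := (integral_nonneg g.h0).trans k1
  refine holder_of (abs_nonneg _) (fun e => ?_) fun κ hκ => ?_
  · rw [abs_eq_zero, sub_eq_zero] at e
    simp [e]
  · refine A.eh.dist_le (fun t => κ / 2 * (h t * G t ^ 2))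
      (fun t => by have := g.h0 t; positivity) (A.iG.const_mul _) (by
        rw [integral_const_mul]; nlinarith) (fun x hx => ?_) hs ht
    have h1 := amgm (x := G x) hκ (g.h0 x)
    have h2 := A.sup_le g k1 k2 (Ioo_subset_Icc_self hx)
    rw [norm_mul, Real.norm_of_nonneg (g.h0 x), Real.norm_eq_abs]
    have h3 : h x / (2 * κ) ≤ K / κ := by
      rw [div_le_div_iff₀ (by positivity) hκ]; nlinarith
    linarith

lemma Adm.holder_b (g : Good R h b) (A : Adm h b v G) {K : ℝ}
    (k1 : ∫ t in Ioo (0:ℝ) 1, h t ≤ K) (k2 : ∫ t in Ioo (0:ℝ) 1, h t * G t ^ 2 ≤ K)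
    (k3 : ∫ t in Ioo (0:ℝ) 1, h t * ‖v t‖ ^ 2 ≤ K)
    {s t : ℝ} (hs : s ∈ Icc (0:ℝ) 1) (ht : t ∈ Icc (0:ℝ) 1) :
    ‖b t - b s‖ ≤ 2 * ((1 + R) * K) * √|t - s| := by
  have K0 : 0 ≤ K := (integral_nonneg g.h0).trans k1
  have R0 := g.R0
  refine holder_of (abs_nonneg _) (fun e => ?_) fun κ hκ => ?_
  · rw [abs_eq_zero, sub_eq_zero] at e
    simp [e]
  · refine A.eb.dist_le
      (fun t => κ / 2 * (h t * ‖v t‖ ^ 2) + R * (κ / 2 * (h t * G t ^ 2)))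
      (fun t => by have := g.h0 t; positivity)
      ((A.iV.const_mul _).fun_add ((A.iG.const_mul _).const_mul _)) (by
        rw [integral_add (A.iV.const_mul _) ((A.iG.const_mul _).const_mul _),
          integral_const_mul, integral_const_mul, integral_const_mul]
        have a1 := mul_le_mul_of_nonneg_left k3 hκ.le
        have a2 := mul_le_mul_of_nonneg_left k2 (mul_nonneg R0 hκ.le)
        have a3 : 0 ≤ κ * K := by positivity
        have a4 : 0 ≤ R * κ * K := by positivity
        linarith) (fun x hx => ?_) hs ht
    have h1 := amgm (x := G x) hκ (g.h0 x)
    have h1' := amgm (x := ‖v x‖) hκ (g.h0 x)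
    rw [abs_norm] at h1'
    have h2 := A.sup_le g k1 k2 (Ioo_subset_Icc_self hx)
    have h3 : h x / (2 * κ) ≤ K / κ := by
      rw [div_le_div_iff₀ (by positivity) hκ]; nlinarith
    have h4 : ‖v x + G x • gam h b x‖ ≤ ‖v x‖ + |G x| * R := by
      refine (norm_add_le _ _).trans (add_le_add le_rfl ?_)
      rw [norm_smul, Real.norm_eq_abs]
      exact mul_le_mul_of_nonneg_left (g.gam_le x) (abs_nonneg _)
    rw [norm_smul, Real.norm_of_nonneg (g.h0 x)]
    have h5 := mul_le_mul_of_nonneg_left h4 (g.h0 x)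
    have h6 : R * (h x * |G x|) ≤ R * (K / κ + κ / 2 * (h x * G x ^ 2)) :=
      mul_le_mul_of_nonneg_left (by linarith) R0
    have h7 : (1 + R) * K / κ = K / κ + R * (K / κ) := by ring
    rw [h7]
    linarith

lemma adm_bounds {α β δ : ℝ} (hα : 0 < α) (hβ : 0 < β) (hδ : 0 < δ) (g : Good R h b)
    (A : Adm h b v G) {c : ℝ} (hc : 0 ≤ c)
    (hE : ENNReal.ofReal β * En δ h v G + ENNReal.ofReal α * Ma h ≤ ENNReal.ofReal c) :
    ∫ t in Ioo (0:ℝ) 1, h t ≤ c / α + 2 * c / β + 2 * c / (β * δ ^ 2) ∧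
    ∫ t in Ioo (0:ℝ) 1, h t * G t ^ 2 ≤ c / α + 2 * c / β + 2 * c / (β * δ ^ 2) ∧
    ∫ t in Ioo (0:ℝ) 1, h t * ‖v t‖ ^ 2 ≤ c / α + 2 * c / β + 2 * c / (β * δ ^ 2) := by
  have e : ∀ t, h t * ((‖v t‖ ^ 2 + δ ^ 2 * G t ^ 2) / 2) =
      1 / 2 * (h t * ‖v t‖ ^ 2) + δ ^ 2 / 2 * (h t * G t ^ 2) := fun t => by ring
  have hEn : En δ h v G = ENNReal.ofReal (1 / 2 * (∫ t in Ioo (0:ℝ) 1, h t * ‖v t‖ ^ 2) +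
      δ ^ 2 / 2 * ∫ t in Ioo (0:ℝ) 1, h t * G t ^ 2) := by
    rw [← integral_const_mul, ← integral_const_mul,
      ← integral_add (A.iV.const_mul _) (A.iG.const_mul _), ofReal_integral_eq_lintegral_ofReal
        ((A.iV.const_mul _).fun_add (A.iG.const_mul _))
        (Eventually.of_forall fun t => by have := g.h0 t; simp only [Pi.zero_apply]; positivity)]
    unfold En
    simp only [e]
  have i1 : 0 ≤ ∫ t in Ioo (0:ℝ) 1, h t := integral_nonneg g.h0
  have i2 : 0 ≤ ∫ t in Ioo (0:ℝ) 1, h t * G t ^ 2 :=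
    integral_nonneg fun t => by have := g.h0 t; simp only [Pi.zero_apply]; positivity
  have i3 : 0 ≤ ∫ t in Ioo (0:ℝ) 1, h t * ‖v t‖ ^ 2 :=
    integral_nonneg fun t => by have := g.h0 t; simp only [Pi.zero_apply]; positivity
  rw [hEn, g.Ma_eq, ← ENNReal.ofReal_mul hβ.le, ← ENNReal.ofReal_mul hα.le,
    ← ENNReal.ofReal_add (by positivity) (by positivity), ENNReal.ofReal_le_ofReal_iff hc] at hE
  set a1 := ∫ t in Ioo (0:ℝ) 1, h t
  set a2 := ∫ t in Ioo (0:ℝ) 1, h t * G t ^ 2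
  set a3 := ∫ t in Ioo (0:ℝ) 1, h t * ‖v t‖ ^ 2
  have p1 : 0 ≤ α * a1 := by positivity
  have p2 : 0 ≤ β * (δ ^ 2 / 2 * a2) := by positivity
  have p3 : 0 ≤ β * (1 / 2 * a3) := by positivity
  have q1 : a1 ≤ c / α := by rw [le_div_iff₀ hα]; linarith
  have q2 : a2 ≤ 2 * c / (β * δ ^ 2) := by rw [le_div_iff₀ (by positivity)]; linarith
  have q3 : a3 ≤ 2 * c / β := by rw [le_div_iff₀ hβ]; linarith
  have r1 : 0 ≤ c / α := by positivity
  have r2 : 0 ≤ 2 * c / (β * δ ^ 2) := by positivity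
  have r3 : 0 ≤ 2 * c / β := by positivity
  refine ⟨?_, ?_, ?_⟩ <;> linarith

open Classical in
lemma mk_curve (hne : V.Nonempty) (hcV : IsCompact V) (g : Good R h b)
    (ch : ∀ t, h t = h (clamp t)) (cb : ∀ t, b t = b (clamp t))
    (hm : ∀ t, h t ≠ 0 → gam h b t ∈ V) :
    ∃ η : SCurve V, ∀ t, hh η t = h t ∧ bb η t = b t := by
  obtain ⟨x0, hx0⟩ := hne
  let γ : ℝ → Euc d := fun t => if h t = 0 then x0 else gam h b t
  have hγ : ∀ t, γ t ∈ V := fun t => by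
    by_cases h0 : h t = 0
    · simp [γ, h0, hx0]
    · simp [γ, h0, hm t h0]
  have hb : ∀ t, b t = h t • γ t := fun t => by
    by_cases h0 : h t = 0
    · have := g.bR t
      rw [h0, mul_zero, norm_le_zero_iff] at this
      rw [this, h0, zero_smul]
    · simp only [γ, h0, if_false]; exact g.b_eq t
  let η : SCurve V :=
    { toFun := fun t => ENNReal.ofReal (h t) • Measure.dirac (γ t)
      clamped := fun t => by
        have : γ t = γ (clamp t) := by simp only [γ, gam, ← ch t, ← cb t]
        simp only [← ch t, ← this]
      cone := fun t => ⟨h t, γ t, g.h0 t, hγ t, rfl⟩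
      narrow := fun φ hφ => by
        simp only [wdirac_int (g.h0 _), smul_eq_mul]
        obtain ⟨C, hC⟩ := hcV.exists_bound_of_continuousOn hφ.continuousOn
        rw [continuous_iff_continuousAt]
        intro t
        by_cases h0 : h t = 0
        · rw [ContinuousAt, h0, zero_mul]
          have h1 : Tendsto (fun s => C * h s) (𝓝 t) (𝓝 0) := by
            have := (g.hc.tendsto t).const_mul C
            rwa [h0, mul_zero] at this
          refine squeeze_zero_norm (fun s => ?_) h1
          rw [norm_mul, Real.norm_of_nonneg (g.h0 s), mul_comm]
          exact mul_le_mul_of_nonneg_right (hC _ (hγ s)) (g.h0 s)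
        · have h1 : ContinuousAt (fun s => h s * φ ((h s)⁻¹ • b s)) t :=
            g.hc.continuousAt.mul (hφ.continuousAt.comp
              ((g.hc.continuousAt.inv₀ h0).smul g.bc.continuousAt))
          refine h1.congr ?_
          filter_upwards [g.hc.continuousAt.eventually_ne h0] with s hs
          simp only [γ, hs, if_false, gam] }
  refine ⟨η, fun t => ⟨?_, ?_⟩⟩
  · exact wdirac_univ (g.h0 t) (γ t)
  · rw [hb t]; exact wdirac_int (g.h0 t) (γ t) (fun x => x)

lemma clamp_mem (t : ℝ) : clamp t ∈ Icc (0:ℝ) 1 :=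
  ⟨le_max_left _ _, max_le zero_le_one (min_le_left _ _)⟩

lemma clamp_of_mem {t : ℝ} (ht : t ∈ Icc (0:ℝ) 1) : clamp t = t := by
  rw [clamp, min_eq_right ht.2, max_eq_right ht.1]

lemma FF_compact (hV : IsClosureOfBoundedDomain V) {α β δ : ℝ} (hα : 0 < α) (hβ : 0 < β)
    (hδ : 0 < δ) (c : ℝ) (hc : 0 ≤ c) (u : ℕ → SCurve V)
    (hu : ∀ n, FF α β δ (u n) ≤ ENNReal.ofReal c) :
    ∃ (η : SCurve V) (k : ℕ → ℕ), StrictMono k ∧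
        FF α β δ η ≤ ENNReal.ofReal c ∧
        Tendsto (fun n => Ddist (u (k n)) η) atTop (nhds 0) := by
  obtain ⟨hne, hcV, R, hR, hVR⟩ := closure_bdd hV
  have gn : ∀ n, Good R (hh (u n)) (bb (u n)) := fun n => scurve_good hR hVR _
  obtain ⟨K, hK⟩ : ∃ K : ℝ, K = (c + 1) / α + 2 * (c + 1) / β + 2 * (c + 1) / (β * δ ^ 2) :=
    ⟨_, rfl⟩
  have hlt : ∀ n, FF α β δ (u n) < ENNReal.ofReal (c + 1) := fun n =>
    (hu n).trans_lt ((ENNReal.ofReal_lt_ofReal_iff (by linarith)).2 (by linarith))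
  choose v G A hA using fun n => exists_adm_of_FF_lt hR hVR (u n) hβ hδ (hlt n)
  have hB := fun n => adm_bounds hα hβ hδ (gn n) (A n) (by linarith) (hA n)
  rw [← hK] at hB
  have K0 : 0 ≤ K := (integral_nonneg (gn 0).h0).trans (hB 0).1
  have hsup : ∀ n, ∀ t ∈ Icc (0:ℝ) 1, hh (u n) t ≤ 2 * K := fun n t ht =>
    (A n).sup_le (gn n) (hB n).1 (hB n).2.1 ht
  let f : ℕ → BoundedContinuousFunction (Icc (0:ℝ) 1) (ℝ × Euc d) := fun n =>
    BoundedContinuousFunction.mkOfCompact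
      ⟨fun t => (hh (u n) t, bb (u n) t),
        ((gn n).hc.comp continuous_subtype_val).prodMk
          ((gn n).bc.comp continuous_subtype_val)⟩
  have hcpt : IsCompact (closure (Set.range f)) := by
    refine BoundedContinuousFunction.arzela_ascoli
      (Metric.closedBall (0:ℝ) (2 * K) ×ˢ Metric.closedBall (0 : Euc d) (R * (2 * K)))
      ((isCompact_closedBall _ _).prod (isCompact_closedBall _ _)) _ ?_ ?_
    · rintro _ x ⟨n, rfl⟩
      have h1 := hsup n x x.2
      refine ⟨?_, ?_⟩
      · rw [mem_closedBall_zero_iff, Real.norm_eq_abs]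
        change |hh (u n) x| ≤ _
        rw [abs_of_nonneg (hh_nonneg _ _)]
        exact h1
      · rw [mem_closedBall_zero_iff]
        exact ((gn n).bR x).trans (mul_le_mul_of_nonneg_left h1 hR)
    · refine Metric.equicontinuous_of_continuity_modulus
        (fun r => 2 * ((1 + R) * K) * √r) ?_ _ ?_
      · have : Continuous fun r : ℝ => 2 * ((1 + R) * K) * √r := by fun_prop
        have := this.tendsto 0
        simpa using this
      · rintro x y ⟨_, n, rfl⟩
        change dist ((hh (u n) x, bb (u n) x) : ℝ × Euc d) (hh (u n) y, bb (u n) y) ≤ _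
        rw [Prod.dist_eq, max_le_iff]
        have hd : dist x y = |(x:ℝ) - y| := rfl
        rw [hd]
        constructor
        · rw [dist_eq_norm]
          refine ((A n).holder_h (gn n) (hB n).1 (hB n).2.1 y.2 x.2).trans ?_
          refine mul_le_mul_of_nonneg_right ?_ (Real.sqrt_nonneg _)
          nlinarith [mul_nonneg hR K0]
        · rw [dist_eq_norm]
          exact (A n).holder_b (gn n) (hB n).1 (hB n).2.1 (hB n).2.2 y.2 x.2
  obtain ⟨f0, -, k, hk, hlim⟩ := hcpt.tendsto_subseq (fun n => subset_closure (mem_range_self n))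
  have hdist : Tendsto (fun n => dist (f (k n)) f0) atTop (𝓝 0) :=
    tendsto_iff_dist_tendsto_zero.1 hlim
  have cc : Continuous fun t : ℝ => (⟨clamp t, clamp_mem t⟩ : Icc (0:ℝ) 1) := by
    refine Continuous.subtype_mk ?_ _
    unfold clamp; fun_prop
  let h : ℝ → ℝ := fun t => (f0 ⟨clamp t, clamp_mem t⟩).1
  let b : ℝ → Euc d := fun t => (f0 ⟨clamp t, clamp_mem t⟩).2
  have hfc : Continuous fun t : ℝ => f0 ⟨clamp t, clamp_mem t⟩ := f0.continuous.comp cc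
  have dh : ∀ n t, ‖hh (u (k n)) (clamp t) - h t‖ ≤ dist (f (k n)) f0 := fun n t => by
    have h1 := (f (k n)).dist_coe_le_dist (g := f0) ⟨clamp t, clamp_mem t⟩
    rw [Prod.dist_eq, max_le_iff, dist_eq_norm] at h1
    exact h1.1
  have db : ∀ n t, ‖bb (u (k n)) (clamp t) - b t‖ ≤ dist (f (k n)) f0 := fun n t => by
    have h1 := (f (k n)).dist_coe_le_dist (g := f0) ⟨clamp t, clamp_mem t⟩
    rw [Prod.dist_eq, max_le_iff, dist_eq_norm (f (k n) _).2] at h1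
    exact h1.2
  have th : ∀ t, Tendsto (fun n => hh (u (k n)) (clamp t)) atTop (𝓝 (h t)) := fun t =>
    tendsto_iff_norm_sub_tendsto_zero.2
      (squeeze_zero (fun _ => norm_nonneg _) (fun n => dh n t) hdist)
  have tb : ∀ t, Tendsto (fun n => bb (u (k n)) (clamp t)) atTop (𝓝 (b t)) := fun t =>
    tendsto_iff_norm_sub_tendsto_zero.2
      (squeeze_zero (fun _ => norm_nonneg _) (fun n => db n t) hdist)
  have g : Good R h b :=
    { R0 := hR
      hc := continuous_fst.comp hfc
      bc := continuous_snd.comp hfc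
      h0 := fun t => ge_of_tendsto' (th t) fun n => hh_nonneg _ _
      bR := fun t => le_of_tendsto_of_tendsto' (tb t).norm ((th t).const_mul R)
        fun n => (gn (k n)).bR _ }
  have cl : ∀ t, clamp (clamp t) = clamp t := fun t => clamp_of_mem (clamp_mem t)
  obtain ⟨η, hη⟩ := mk_curve hne hcV g (fun t => by simp only [h, cl])
    (fun t => by simp only [b, cl]) (fun t h0 => by
      have h1 : Tendsto (fun n => gam (hh (u (k n))) (bb (u (k n))) (clamp t)) atTop
          (𝓝 (gam h b t)) := ((th t).inv₀ h0).smul (tb t)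
      refine hcV.isClosed.mem_of_tendsto h1 ?_
      filter_upwards [(th t).eventually_ne h0] with n hn using gam_mem _ hn)
  have hD : Tendsto (fun n => Ddist (u (k n)) η) atTop (𝓝 0) := by
    have h1 := hdist.const_mul (R + 2)
    rw [mul_zero] at h1
    refine squeeze_zero (fun n => Ddist_nonneg hR hVR _ _) (fun n => ?_) h1
    refine Ddist_le hR hVR _ _ (fun t ht => ?_) fun t ht => ?_
    · rw [(hη t).1]
      have := dh n t
      rwa [clamp_of_mem ht] at this
    · rw [(hη t).2]
      have := db n t
      rwa [clamp_of_mem ht] at this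
  refine ⟨η, k, hk, ?_, hD⟩
  refine le_of_forall_gt_imp_ge_of_dense fun c' hc' => ?_
  exact lsc_core hR hVR hα hβ hδ hD (fun n => (hu _).trans_lt hc')

end Cpt

/-- **Lower semicontinuity and compactness of the restricted energy.**
The domain of `𝓕` is `H_V` with the explicit integral formula, `𝓕` is
`D`-lower semicontinuous, and its sublevel sets are (sequentially) compact. -/
theorem FF_lsc_compact_sublevels (d : ℕ) (hd : 1 ≤ d) (V : Set (Euc d))
    (hV : IsClosureOfBoundedDomain V)
    (α β δ : ℝ) (hα : 0 < α) (hβ : 0 < β) (hδ : 0 < δ) :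
    (∀ η : SCurve V, FF α β δ η ≠ ⊤ ↔ MemH V η) ∧
    (∀ (η : SCurve V) (γ : ℝ → Euc d) (h : ℝ → ℝ) (γ' : ℝ → Euc d) (h' : ℝ → ℝ),
      Represents η γ h → AC2 h → AC2 (fun t => Real.sqrt (h t)) →
      AC2 (fun t => Real.sqrt (h t) • γ t) → HasAEDerivs γ h γ' h' →
      FF α β δ η = ∫⁻ t in {t | t ∈ Ioo (0:ℝ) 1 ∧ 0 < h t},
        ENNReal.ofReal (β / 2 * ‖γ' t‖ ^ 2 * h t
          + β * δ ^ 2 / 2 * h' t ^ 2 / h t + α * h t)) ∧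
    (∀ (η : SCurve V) (u : ℕ → SCurve V),
      Tendsto (fun n => Ddist (u n) η) atTop (nhds 0) →
      FF α β δ η ≤ Filter.liminf (fun n => FF α β δ (u n)) atTop) ∧
    (∀ c : ℝ, 0 ≤ c → ∀ u : ℕ → SCurve V,
      (∀ n, FF α β δ (u n) ≤ ENNReal.ofReal c) →
      ∃ (η : SCurve V) (k : ℕ → ℕ), StrictMono k ∧
        FF α β δ η ≤ ENNReal.ofReal c ∧
        Tendsto (fun n => Ddist (u (k n)) η) atTop (nhds 0)) := by
  exact ⟨fun η => FF_domain hV hβ hδ η,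
    fun η γ h γ' h' r _ h1 h2 D => FF_formula hV hα hβ hδ η γ h γ' h' r h1 h2 D,
    fun η u hD => FF_lsc hV hα hβ hδ η u hD,
    fun c hc u hu => FF_compact hV hα hβ hδ c hc u hu⟩

end Paper
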